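/- For every 0<p≤1, the Hardy space H_p(𝔻,ℓ₂) is isomorphic to the Hilbert-valued Triebel–Lizorkin sequence space T_{p,2}(ℓ₂). -/

import Mathlib

/-!
Statement 13: For every `0 < p ≤ 1`, the Hardy space `H_p(𝔻, ℓ₂)` is isomorphic to the
Hilbert-valued Triebel–Lizorkin sequence space `T_{p,2}(ℓ₂)`.

`H_p(𝔻, ℓ₂)` is the space of analytic `F : 𝔻 → ℓ₂` with
`sup_{0≤r<1}(∫_{-1/2}^{1/2}‖F(re^{2πit})‖^p dt)^{1/p} < ∞`, and `T_{p,2}` is the discrete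
Triebel–Lizorkin space over `ℕ` associated with a natural arrangement `(J_n)` of the dyadic
subintervals of `I = [-1/2, 1/2)` (with `J_0 = I`).
-/

noncomputable section
open Filter Topology MeasureTheory ENNReal

abbrev ELL2 : Type := lp (fun _ : ℕ => ℂ) 2

def I₀ : Set ℝ := Set.Ico (-(1 : ℝ)/2) (1/2)

def circlePt (r t : ℝ) : ℂ := (r : ℂ) * Complex.exp (2 * Real.pi * t * Complex.I)

def hpIntegral (p : ℝ) (F : ℂ → ELL2) (r : ℝ) : ℝ≥0∞ :=
  ∫⁻ t in I₀, (‖F (circlePt r t)‖₊ : ℝ≥0∞) ^ p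

/-- Membership in the Hardy space `H_p(𝔻, ℓ₂)`. -/
def memHpD (p : ℝ) (F : ℂ → ELL2) : Prop :=
  DifferentiableOn ℂ F (Metric.ball 0 1) ∧
  ∃ B : ℝ≥0∞, B < ⊤ ∧ ∀ r : ℝ, 0 ≤ r → r < 1 → hpIntegral p F r ≤ B

/-- The quasi-norm of `H_p(𝔻, ℓ₂)` (with values in `[0, ∞]`). -/
def qHpD (p : ℝ) (F : ℂ → ELL2) : ℝ≥0∞ :=
  ⨆ r : Set.Ico (0 : ℝ) 1, (hpIntegral p F r.1) ^ (1/p)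

/-- A natural arrangement of the dyadic subintervals of `I = [-1/2, 1/2)`, with `J_0 = I`:
for `n ≥ 1`, writing `n = 2^k + j` with `0 ≤ j < 2^k`, `J_n` is the `j`-th dyadic interval of
length `2^{-k}`. -/
def dyadJ (n : ℕ) : Set ℝ :=
  if n = 0 then I₀ else
    Set.Ico (-(1 : ℝ)/2 + ((n - 2 ^ Nat.log 2 n : ℕ) : ℝ) * ((2 : ℝ) ^ Nat.log 2 n)⁻¹)
      (-(1 : ℝ)/2 + (((n - 2 ^ Nat.log 2 n : ℕ) : ℝ) + 1) * ((2 : ℝ) ^ Nat.log 2 n)⁻¹)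

/-- The square function `∑_n ‖γ_n‖² |J_n|^{-2/p} χ_{J_n}(t)` of the `ℓ₂`-valued
Triebel–Lizorkin space `T_{p,2}(ℓ₂)`. -/
def tlDensity (p : ℝ) (γ : ℕ → ELL2) (t : ℝ) : ℝ≥0∞ :=
  ∑' n, (‖γ n‖₊ : ℝ≥0∞) ^ (2 : ℝ) * (volume (dyadJ n)) ^ (-(2/p)) *
    (dyadJ n).indicator (fun _ => (1 : ℝ≥0∞)) t

/-- The quasi-norm of `T_{p,2}(ℓ₂)`:
`‖γ‖ = ‖(∑_n ‖γ_n‖² |J_n|^{-2/p} χ_{J_n})^{1/2}‖_{L_p(I)}`. -/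
def tlNorm (p : ℝ) (γ : ℕ → ELL2) : ℝ≥0∞ :=
  (∫⁻ t in I₀, (tlDensity p γ t) ^ (p/2)) ^ (1/p)

/-- Membership in `T_{p,2}(ℓ₂)`. -/
def memTL (p : ℝ) (γ : ℕ → ELL2) : Prop := tlNorm p γ < ⊤

section
namespace HPTL

/-! ### Abstract decomposition method -/

section Pel

def BIso {X Y : Type*} [AddCommGroup X] [Module ℂ X] [AddCommGroup Y] [Module ℂ Y]
    (qX : X → ℝ≥0∞) (qY : Y → ℝ≥0∞) : Prop :=
  ∃ (e : X ≃ₗ[ℂ] Y) (C : ℝ≥0∞), C < ⊤ ∧ (∀ x, qY (e x) ≤ C * qX x) ∧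
    (∀ y, qX (e.symm y) ≤ C * qY y)

def qProd {X Y : Type*} (qX : X → ℝ≥0∞) (qY : Y → ℝ≥0∞) : X × Y → ℝ≥0∞ :=
  fun z => qX z.1 + qY z.2

variable {X Y Z W : Type*} [AddCommGroup X] [Module ℂ X] [AddCommGroup Y] [Module ℂ Y]
  [AddCommGroup Z] [Module ℂ Z] [AddCommGroup W] [Module ℂ W]
  {qX : X → ℝ≥0∞} {qY : Y → ℝ≥0∞} {qZ : Z → ℝ≥0∞} {qW : W → ℝ≥0∞}

lemma BIso.symm (h : BIso qX qY) : BIso qY qX := by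
  obtain ⟨e, C, hC, h1, h2⟩ := h
  exact ⟨e.symm, C, hC, h2, by simpa using h1⟩

lemma BIso.trans (h : BIso qX qY) (h' : BIso qY qZ) : BIso qX qZ := by
  obtain ⟨e, C, hC, h1, h2⟩ := h
  obtain ⟨e', C', hC', h1', h2'⟩ := h'
  refine ⟨e.trans e', C * C', ENNReal.mul_lt_top hC hC', fun x => ?_, fun y => ?_⟩
  · calc qZ (e' (e x)) ≤ C' * qY (e x) := h1' _
      _ ≤ C' * (C * qX x) := by gcongr; exact h1 x
      _ = _ := by ring
  · calc qX (e.symm (e'.symm y)) ≤ C * qY (e'.symm y) := h2 _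
      _ ≤ C * (C' * qZ y) := by gcongr; exact h2' y
      _ = _ := by ring

lemma BIso.refl (qX : X → ℝ≥0∞) : BIso qX qX :=
  ⟨LinearEquiv.refl ℂ X, 1, by simp, by simp, by simp⟩

lemma BIso.prod (h : BIso qX qY) (h' : BIso qZ qW) : BIso (qProd qX qZ) (qProd qY qW) := by
  obtain ⟨e, C, hC, h1, h2⟩ := h
  obtain ⟨e', C', hC', h1', h2'⟩ := h'
  refine ⟨e.prodCongr e', C + C', ENNReal.add_lt_top.2 ⟨hC, hC'⟩, fun x => ?_, fun y => ?_⟩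
  · simp only [qProd]
    calc qY (e x.1) + qW (e' x.2) ≤ C * qX x.1 + C' * qZ x.2 := add_le_add (h1 _) (h1' _)
      _ ≤ (C + C') * qX x.1 + (C + C') * qZ x.2 := by
        gcongr
        · exact le_self_add
        · exact le_add_self
      _ = _ := by ring
  · simp only [qProd]
    calc qX (e.symm y.1) + qZ (e'.symm y.2) ≤ C * qY y.1 + C' * qW y.2 :=
          add_le_add (h2 _) (h2' _)
      _ ≤ (C + C') * qY y.1 + (C + C') * qW y.2 := by
        gcongr
        · exact le_self_add
        · exact le_add_self
      _ = _ := by ring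

lemma BIso.comm (qX : X → ℝ≥0∞) (qY : Y → ℝ≥0∞) : BIso (qProd qX qY) (qProd qY qX) :=
  ⟨LinearEquiv.prodComm ℂ X Y, 1, by simp, fun x => by simp [qProd, add_comm],
    fun x => by simp [qProd, add_comm]⟩

lemma BIso.assoc (qX : X → ℝ≥0∞) (qY : Y → ℝ≥0∞) (qZ : Z → ℝ≥0∞) :
    BIso (qProd (qProd qX qY) qZ) (qProd qX (qProd qY qZ)) :=
  ⟨LinearEquiv.prodAssoc ℂ X Y Z, 1, by simp, fun x => by simp [qProd, add_assoc],
    fun ⟨x, y, z⟩ => by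
      change qX x + qY y + qZ z ≤ 1 * (qX x + (qY y + qZ z))
      rw [one_mul, add_assoc]⟩

/-- A complemented embedding splits the space. -/
lemma BIso.split (A : X →ₗ[ℂ] Y) (B : Y →ₗ[ℂ] X) (hBA : ∀ x, B (A x) = x)
    {CA CB K : ℝ≥0∞} (hCA : CA < ⊤) (hCB : CB < ⊤) (hK : K < ⊤)
    (hA : ∀ x, qY (A x) ≤ CA * qX x) (hB : ∀ y, qX (B y) ≤ CB * qY y)
    (hadd : ∀ y y', qY (y + y') ≤ K * (qY y + qY y')) (hneg : ∀ y, qY (-y) = qY y) :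
    BIso qY (qProd qX (fun k : LinearMap.ker B => qY (k : Y))) := by
  let e : Y ≃ₗ[ℂ] X × LinearMap.ker B :=
    { toFun := fun y => (B y, ⟨y - A (B y), by simp [hBA]⟩)
      invFun := fun z => A z.1 + z.2
      map_add' := fun y y' => by
        ext
        · simp
        · simp; abel
      map_smul' := fun c y => by
        ext
        · simp
        · simp [smul_sub]
      left_inv := fun y => by simp
      right_inv := fun z => by
        have : B (z.2 : Y) = 0 := z.2.2
        ext
        · simp [hBA, this]
        · simp [hBA, this] }
  refine ⟨e, CB + K * (1 + CA * CB) + K * (CA + 1), ?_, fun y => ?_, fun z => ?_⟩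
  · have := ENNReal.mul_lt_top hCA hCB
    have h1 : (1 : ℝ≥0∞) < ⊤ := by simp
    refine ENNReal.add_lt_top.2 ⟨ENNReal.add_lt_top.2 ⟨hCB, ?_⟩, ?_⟩
    · exact ENNReal.mul_lt_top hK (ENNReal.add_lt_top.2 ⟨h1, this⟩)
    · exact ENNReal.mul_lt_top hK (ENNReal.add_lt_top.2 ⟨hCA, h1⟩)
  · change qX (B y) + qY (y - A (B y)) ≤ _
    have h1 : qY (y - A (B y)) ≤ K * (qY y + CA * (CB * qY y)) := by
      rw [sub_eq_add_neg]
      refine (hadd _ _).trans ?_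
      rw [hneg]
      gcongr
      exact (hA _).trans (by gcongr; exact hB y)
    calc _ ≤ CB * qY y + K * (qY y + CA * (CB * qY y)) := add_le_add (hB y) h1
      _ = (CB + K * (1 + CA * CB)) * qY y := by ring
      _ ≤ _ := mul_le_mul_left le_self_add _
  · change qY (A z.1 + z.2) ≤ _ * (qX z.1 + qY z.2)
    calc _ ≤ K * (CA * qX z.1 + qY z.2) := (hadd _ _).trans (by gcongr; exact hA _)
      _ ≤ K * (CA * qX z.1 + qY z.2) + K * (CA * qY z.2 + qX z.1) := le_self_add
      _ = K * (CA + 1) * (qX z.1 + qY z.2) := by ring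
      _ ≤ _ := by gcongr; exact le_add_self

theorem pelczynski (A : X →ₗ[ℂ] Y) (B : Y →ₗ[ℂ] X) (hBA : ∀ x, B (A x) = x)
    (C : Y →ₗ[ℂ] X) (D : X →ₗ[ℂ] Y) (hDC : ∀ y, D (C y) = y)
    {CA CB CC CD K : ℝ≥0∞} (hCA : CA < ⊤) (hCB : CB < ⊤) (hCC : CC < ⊤) (hCD : CD < ⊤)
    (hK : K < ⊤)
    (hA : ∀ x, qY (A x) ≤ CA * qX x) (hB : ∀ y, qX (B y) ≤ CB * qY y)
    (hC : ∀ y, qX (C y) ≤ CC * qY y) (hD : ∀ x, qY (D x) ≤ CD * qX x)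
    (haddX : ∀ y y', qX (y + y') ≤ K * (qX y + qX y')) (hnegX : ∀ y, qX (-y) = qX y)
    (haddY : ∀ y y', qY (y + y') ≤ K * (qY y + qY y')) (hnegY : ∀ y, qY (-y) = qY y)
    (hXX : BIso qX (qProd qX qX)) (hYY : BIso qY (qProd qY qY)) : BIso qX qY := by
  have h1 := BIso.split A B hBA hCA hCB hK hA hB haddY hnegY
  have h2 := BIso.split C D hDC hCC hCD hK hC hD haddX hnegX
  -- Y ≅ X × K, so X × Y ≅ Y
  have h3 : BIso (qProd qX qY) qY :=
    ((BIso.refl qX).prod h1).trans <| (BIso.assoc _ _ _).symm.trans <|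
      (hXX.symm.prod (BIso.refl _)).trans h1.symm
  have h4 : BIso (qProd qY qX) qX :=
    ((BIso.refl qY).prod h2).trans <| (BIso.assoc _ _ _).symm.trans <|
      (hYY.symm.prod (BIso.refl _)).trans h2.symm
  exact h4.symm.trans ((BIso.comm _ _).trans h3)

end Pel
end HPTL
end

section
namespace HPTL

/-! ### Coordinate maps on `ELL2` -/

lemma ell2_summable (x : ELL2) : Summable fun i => ‖x i‖ ^ (2 : ℝ) := by
  have := (lp.memℓp x).summable (by simp)
  simpa using this

lemma ell2_norm_sq (x : ELL2) : ‖x‖ ^ (2 : ℝ) = ∑' i, ‖x i‖ ^ (2 : ℝ) := by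
  have := lp.norm_rpow_eq_tsum (p := 2) (by simp) x
  simpa using this

lemma ell2_mem {x : ℕ → ℂ} (h : Summable fun i => ‖x i‖ ^ (2 : ℝ)) :
    Memℓp (E := fun _ : ℕ => ℂ) x 2 := by
  refine memℓp_gen ?_
  simpa using h

def pullFun (f : ℕ → ℕ) (hf : f.Injective) (y : ELL2) : ELL2 :=
  ⟨fun i => y (f i), ell2_mem ((ell2_summable y).comp_injective hf)⟩

@[simp] lemma pullFun_apply (f : ℕ → ℕ) (hf : f.Injective) (y : ELL2) (i : ℕ) :
    pullFun f hf y i = y (f i) := rfl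

def pull (f : ℕ → ℕ) (hf : f.Injective) : ELL2 →L[ℂ] ELL2 :=
  LinearMap.mkContinuous
    { toFun := pullFun f hf
      map_add' := fun x y => by ext i; simp
      map_smul' := fun c y => by ext i; simp } 1 (by
    intro y
    rw [one_mul]
    have : ‖pullFun f hf y‖ ^ (2 : ℝ) ≤ ‖y‖ ^ (2 : ℝ) := by
      rw [ell2_norm_sq, ell2_norm_sq]
      exact tsum_comp_le_tsum_of_inj (ell2_summable y) (fun i => by positivity) hf
    exact (Real.rpow_le_rpow_iff (norm_nonneg _) (norm_nonneg _) (by norm_num)).1 this)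

@[simp] lemma pull_apply (f : ℕ → ℕ) (hf : f.Injective) (y : ELL2) (i : ℕ) :
    pull f hf y i = y (f i) := rfl

lemma norm_pull_le (f : ℕ → ℕ) (hf : f.Injective) (y : ELL2) : ‖pull f hf y‖ ≤ ‖y‖ := by
  have := (pull f hf).le_of_opNorm_le (LinearMap.mkContinuous_norm_le _ zero_le_one _) y
  simpa using this

lemma extend_sq (f : ℕ → ℕ) (hf : f.Injective) (x : ℕ → ℂ) :
    (fun j => ‖Function.extend f x 0 j‖ ^ (2 : ℝ)) =
      Function.extend f (fun i => ‖x i‖ ^ (2 : ℝ)) 0 := by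
  ext j
  by_cases h : ∃ i, f i = j
  · obtain ⟨i, rfl⟩ := h
    rw [hf.extend_apply, hf.extend_apply]
  · rw [Function.extend_apply' _ _ _ h, Function.extend_apply' _ _ _ h]
    simp

def pushFun (f : ℕ → ℕ) (hf : f.Injective) (x : ELL2) : ELL2 :=
  ⟨Function.extend f (x : ℕ → ℂ) 0, ell2_mem (by
    rw [extend_sq f hf, ← hf.summable_iff (f := Function.extend f _ 0)
      (fun j hj => by rw [Function.extend_apply' _ _ _ hj]; rfl), Function.extend_comp hf]
    exact ell2_summable x)⟩

lemma pushFun_apply (f : ℕ → ℕ) (hf : f.Injective) (y : ELL2) (i : ℕ) :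
    pushFun f hf y (f i) = y i := hf.extend_apply _ _ _

lemma pushFun_apply' (f : ℕ → ℕ) (hf : f.Injective) (y : ELL2) (j : ℕ) (h : ¬ ∃ i, f i = j) :
    pushFun f hf y j = 0 := Function.extend_apply' _ _ _ h

lemma norm_pushFun (f : ℕ → ℕ) (hf : f.Injective) (y : ELL2) : ‖pushFun f hf y‖ = ‖y‖ := by
  have : ‖pushFun f hf y‖ ^ (2 : ℝ) = ‖y‖ ^ (2 : ℝ) := by
    rw [ell2_norm_sq, ell2_norm_sq]
    have : (fun j => ‖pushFun f hf y j‖ ^ (2 : ℝ)) = _ := extend_sq f hf y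
    rw [this, tsum_extend_zero hf]
  exact le_antisymm
    ((Real.rpow_le_rpow_iff (norm_nonneg _) (norm_nonneg _) (by norm_num)).1 this.le)
    ((Real.rpow_le_rpow_iff (norm_nonneg _) (norm_nonneg _) (by norm_num)).1 this.ge)

def push (f : ℕ → ℕ) (hf : f.Injective) : ELL2 →L[ℂ] ELL2 :=
  LinearMap.mkContinuous
    { toFun := pushFun f hf
      map_add' := fun x y => by
        ext j
        by_cases h : ∃ i, f i = j
        · obtain ⟨i, rfl⟩ := h
          simp [pushFun_apply]
        · simp [pushFun_apply' f hf _ j h]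
      map_smul' := fun c y => by
        ext j
        by_cases h : ∃ i, f i = j
        · obtain ⟨i, rfl⟩ := h
          simp [pushFun_apply]
        · simp [pushFun_apply' f hf _ j h] } 1 (by
    intro y
    rw [one_mul]
    exact (norm_pushFun f hf y).le)

lemma push_apply (f : ℕ → ℕ) (hf : f.Injective) (y : ELL2) (i : ℕ) :
    push f hf y (f i) = y i := pushFun_apply f hf y i

lemma push_apply' (f : ℕ → ℕ) (hf : f.Injective) (y : ELL2) (j : ℕ) (h : ¬ ∃ i, f i = j) :
    push f hf y j = 0 := pushFun_apply' f hf y j h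

lemma norm_push (f : ℕ → ℕ) (hf : f.Injective) (y : ELL2) : ‖push f hf y‖ = ‖y‖ :=
  norm_pushFun f hf y

@[simp] lemma pull_push (f : ℕ → ℕ) (hf : f.Injective) (y : ELL2) :
    pull f hf (push f hf y) = y := by
  ext i; simp [push_apply]

lemma pull_push_disj (f g : ℕ → ℕ) (hf : f.Injective) (hg : g.Injective)
    (h : ∀ i j, f i ≠ g j) (y : ELL2) : pull f hf (push g hg y) = 0 := by
  ext i
  rw [pull_apply, push_apply' g hg y _ (fun ⟨j, hj⟩ => h i j hj.symm)]
  rfl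

def fE : ℕ → ℕ := fun i => 2 * i
def fO : ℕ → ℕ := fun i => 2 * i + 1
lemma fE_inj : fE.Injective := fun a b h => by simp only [fE] at h; omega
lemma fO_inj : fO.Injective := fun a b h => by simp only [fO] at h; omega
lemma fE_ne_fO (i j : ℕ) : fE i ≠ fO j := by simp only [fE, fO]; omega

lemma push_pull_even_odd (y : ELL2) :
    push fE fE_inj (pull fE fE_inj y) + push fO fO_inj (pull fO fO_inj y) = y := by
  ext j
  rcases Nat.even_or_odd' j with ⟨i, h | h⟩
  · have h1 : j = fE i := h
    subst h1
    have : ¬ ∃ k, fO k = fE i := fun ⟨k, hk⟩ => fE_ne_fO i k hk.symm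
    simp [push_apply, push_apply' fO fO_inj _ _ this]
  · have h1 : j = fO i := h
    subst h1
    have : ¬ ∃ k, fE k = fO i := fun ⟨k, hk⟩ => fE_ne_fO k i hk
    simp [push_apply, push_apply' fE fE_inj _ _ this]

def fP (n : ℕ) : ℕ → ℕ := fun i => Nat.pair n i
lemma fP_inj (n : ℕ) : (fP n).Injective := fun a b h => by
  simp only [fP, Nat.pair_eq_pair] at h; exact h.2
lemma fP_ne {n m : ℕ} (h : n ≠ m) (i j : ℕ) : fP n i ≠ fP m j := by
  simp only [fP, ne_eq, Nat.pair_eq_pair, not_and]; intro h'; exact absurd h' h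

def stdBasis : HilbertBasis ℕ ℂ ELL2 := HilbertBasis.ofRepr (LinearIsometryEquiv.refl ℂ ELL2)

instance : TopologicalSpace.SeparableSpace ELL2 := by
  have h := stdBasis.dense_span
  have h2 : TopologicalSpace.IsSeparable
      (Submodule.span ℂ (Set.range stdBasis) : Set ELL2) :=
    (Set.countable_range _).isSeparable.span
  rw [← TopologicalSpace.isSeparable_univ_iff]
  have h3 := h2.closure
  rwa [← Submodule.topologicalClosure_coe, h] at h3

/-- An isometric embedding of a separable Hilbert space in `ELL2`. -/
lemma exists_isometry (H : Type*) [NormedAddCommGroup H] [InnerProductSpace ℂ H] [CompleteSpace H]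
    [SecondCountableTopology H] : Nonempty (H →ₗᵢ[ℂ] ELL2) := by
  obtain ⟨w, b, hb⟩ := exists_hilbertBasis ℂ H
  have ho : Orthonormal ℂ ((↑) : w → H) := by
    rw [← hb]; exact b.orthonormal
  have hw : Countable w := by
    have : w.PairwiseDisjoint fun x => Metric.ball x (1/2) := by
      intro x hx y hy hxy
      refine Metric.ball_disjoint_ball ?_
      have h0 : inner ℂ x y = 0 := ho.2 (i := ⟨x, hx⟩) (j := ⟨y, hy⟩) (by simpa using hxy)
      have h1 : ‖x‖ = 1 := ho.1 ⟨x, hx⟩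
      have h2 : ‖y‖ = 1 := ho.1 ⟨y, hy⟩
      have h3 := norm_sub_sq (𝕜 := ℂ) x y
      rw [h0, h1, h2] at h3
      rw [dist_eq_norm]
      simp at h3
      nlinarith [norm_nonneg (x - y)]
    exact (this.countable_of_isOpen (fun _ _ => Metric.isOpen_ball)
      (fun x _ => ⟨x, by simp⟩)).to_subtype
  obtain ⟨f, hf⟩ := exists_injective_nat w
  have h1 : Orthonormal ℂ (fun i : w => stdBasis (f i)) := stdBasis.orthonormal.comp f hf
  exact ⟨h1.orthogonalFamily.linearIsometry.comp b.repr.toLinearIsometry⟩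

end HPTL
end

section
namespace HPTL
set_option linter.all false
set_option linter.unusedSectionVars false

/-- point of the unit circle -/
def ev (t : ℝ) : ℂ := Complex.exp (2 * Real.pi * t * Complex.I)

theorem norm_ev (t : ℝ) : ‖ev t‖ = 1 := by
  unfold ev
  have : (2 * Real.pi * t * Complex.I : ℂ) = ((2 * Real.pi * t : ℝ) : ℂ) * Complex.I := by
    push_cast; ring
  rw [this, Complex.norm_exp_ofReal_mul_I]

theorem continuous_ev : Continuous ev := by unfold ev; fun_prop

theorem hasDerivAt_ev (t : ℝ) : HasDerivAt ev ((2 * Real.pi * Complex.I) * ev t) t := by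
  have h1 : HasDerivAt (fun t : ℝ => (2 * Real.pi * t * Complex.I : ℂ)) (2 * Real.pi * Complex.I) t := by
    have := ((Complex.ofRealCLM.hasDerivAt (x := t)).const_mul (2 * Real.pi : ℂ)).mul_const Complex.I
    simpa using this
  have := h1.cexp
  unfold ev
  convert this using 1
  ring

theorem circlePt_eq (r t : ℝ) : circlePt r t = (r : ℂ) * ev t := rfl

theorem ev_half : ev (1/2) = ev (-(1/2)) := by
  unfold ev
  have : (2 * Real.pi * ((1/2 : ℝ) : ℂ) * Complex.I) = (2 * Real.pi * ((-(1/2) : ℝ) : ℂ) * Complex.I) + 2 * Real.pi * Complex.I := by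
    push_cast; ring
  rw [this, Complex.exp_add, Complex.exp_two_pi_mul_I, mul_one]

theorem hasDerivAt_param (f f' : ℝ → ℝ → ℝ) (a b : ℝ)
    (hf' : Continuous (Function.uncurry f')) (hd : ∀ r t, HasDerivAt (fun r => f r t) (f' r t) r)
    (hf : ∀ r, Continuous (f r)) (r : ℝ) :
    HasDerivAt (fun r => ∫ t in a..b, f r t) (∫ t in a..b, f' r t) r := by
  have hK : IsCompact (Metric.closedBall r 1 ×ˢ Set.uIcc a b) :=
    (isCompact_closedBall r 1).prod isCompact_uIcc
  obtain ⟨C, hC⟩ := hK.exists_bound_of_continuousOn (f := Function.uncurry f') hf'.continuousOn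
  refine (intervalIntegral.hasDerivAt_integral_of_dominated_loc_of_deriv_le (F := f) (F' := f')
    (bound := fun _ => C) (s := Metric.ball r 1) (Metric.ball_mem_nhds r one_pos) ?_ ?_ ?_ ?_ ?_ ?_).2
  · exact Eventually.of_forall fun x => (hf x).aestronglyMeasurable
  · exact (hf r).intervalIntegrable _ _
  · exact (by fun_prop : Continuous (f' r)).aestronglyMeasurable
  · refine Eventually.of_forall fun t ht x hx => ?_
    exact hC (x, t) ⟨Metric.ball_subset_closedBall hx, Set.uIoc_subset_uIcc ht⟩
  · simp
  · exact Eventually.of_forall fun t ht x hx => hd x t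

theorem cslice {f : ℝ → ℝ → ℝ} (h : Continuous (Function.uncurry f)) (r : ℝ) : Continuous (fun t => f r t) :=
  h.comp (by fun_prop : Continuous fun t : ℝ => (r, t))

section green
variable {E : Type*} [NormedAddCommGroup E] [InnerProductSpace ℂ E]

def vv (F : ℂ → E) (ε r t : ℝ) : ℝ := ‖F (r * ev t)‖ ^ 2 + ε

theorem vv_pos (F : ℂ → E) {ε : ℝ} (hε : 0 < ε) (r t : ℝ) : 0 < vv F ε r t := by
  unfold vv; positivity

theorem cont_comp {G : ℂ → E} (hG : Continuous G) :
    Continuous (fun x : ℝ × ℝ => G (x.1 * ev x.2)) := by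
  have := continuous_ev
  fun_prop

theorem cont_vv {F : ℂ → E} (hF : Continuous F) (ε : ℝ) :
    Continuous (fun x : ℝ × ℝ => vv F ε x.1 x.2) := by
  have := cont_comp hF
  unfold vv; exact (this.norm.pow 2).add continuous_const

theorem deriv_r {G G' : ℂ → E} (hG : ∀ z, HasDerivAt G (G' z) z) (r t : ℝ) :
    HasDerivAt (fun r : ℝ => G (r * ev t)) (ev t • G' (r * ev t)) r := by
  have h1 : HasDerivAt (fun r : ℝ => (r * ev t : ℂ)) (ev t) r := by
    simpa using (Complex.ofRealCLM.hasDerivAt (x := r)).mul_const (ev t)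
  exact HasDerivAt.scomp r (hG _) h1

theorem deriv_t {G G' : ℂ → E} (hG : ∀ z, HasDerivAt G (G' z) z) (r t : ℝ) :
    HasDerivAt (fun t : ℝ => G (r * ev t)) 
      ((2 * Real.pi : ℝ) • (Complex.I • ((r * ev t : ℂ) • G' (r * ev t)))) t := by
  have h1 : HasDerivAt (fun t : ℝ => (r * ev t : ℂ)) (r * ((2 * Real.pi * Complex.I) * ev t)) t := 
    (hasDerivAt_ev t).const_mul _
  have := HasDerivAt.scomp t (hG (r * ev t)) h1
  have e : (2 * Real.pi : ℝ) • (Complex.I • ((r * ev t : ℂ) • G' (r * ev t))) =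
      ((r : ℂ) * ((2 * Real.pi * Complex.I) * ev t)) • G' (r * ev t) := by
    rw [← Complex.coe_smul, smul_smul, smul_smul]
    congr 1; push_cast; ring
  rw [e]; exact this

theorem deriv_inner {f g : ℝ → E} {f' g' : E} {x : ℝ} (hf : HasDerivAt f f' x) (hg : HasDerivAt g g' x) :
    HasDerivAt (fun y => (inner ℂ (f y) (g y)).re) ((inner ℂ (f x) g').re + (inner ℂ f' (g x)).re) x := by
  have := HasDerivAt.inner ℂ hf hg
  have h2 := Complex.reCLM.hasFDerivAt.comp_hasDerivAt x this
  rw [map_add] at h2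
  exact h2

theorem deriv_normsq {f : ℝ → E} {f' : E} {x : ℝ} (hf : HasDerivAt f f' x) :
    HasDerivAt (fun y => ‖f y‖ ^ 2) (2 * (inner ℂ (f x) f').re) x := by
  have := deriv_inner hf hf
  have e : (fun y => ‖f y‖ ^ 2) = fun y => (inner ℂ (f y) (f y)).re := by
    funext y
    exact (inner_self_eq_norm_sq (𝕜 := ℂ) (f y)).symm
  rw [e]
  convert this using 1
  rw [two_mul]; congr 1
  exact inner_re_symm (𝕜 := ℂ) (f x) f'



def Kf (F' : ℂ → E) : ℂ → E := fun z => z • F' z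
def Kf' (F' F'' : ℂ → E) : ℂ → E := fun z => F' z + z • F'' z

theorem hasDeriv_Kf {F' F'' : ℂ → E} (h : ∀ z, HasDerivAt F' (F'' z) z) (z : ℂ) :
    HasDerivAt (Kf F') (Kf' F' F'' z) z := by
  have := (hasDerivAt_id z).smul (h z)
  unfold Kf Kf'
  simp only [id, one_smul, add_comm (z • F'' z)] at this
  exact this

def aa (F G : ℂ → E) (r t : ℝ) : ℝ := (inner ℂ (F (r * ev t)) (G (r * ev t))).re
def WW (F F' : ℂ → E) (q ε r t : ℝ) : ℝ := q * ((vv F ε r t) ^ (q/2 - 1) * aa F (Kf F') r t)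
def TT (F F' : ℂ → E) (q ε r t : ℝ) : ℝ :=
  q * ((vv F ε r t) ^ (q/2 - 1) * aa F (fun z => Complex.I • Kf F' z) r t)

def mr (F F' : ℂ → E) (q ε r t : ℝ) : ℝ :=
  q * ((vv F ε r t) ^ (q/2 - 1) * (inner ℂ (F (r * ev t)) (ev t • F' (r * ev t))).re)
def WWr (F F' F'' : ℂ → E) (q ε r t : ℝ) : ℝ :=
  q * ((2 * (inner ℂ (F (r * ev t)) (ev t • F' (r * ev t))).re * (q/2-1) * (vv F ε r t) ^ (q/2 - 1 - 1)) * aa F (Kf F') r t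
   + (vv F ε r t) ^ (q/2 - 1) * ((inner ℂ (F (r * ev t)) (ev t • Kf' F' F'' (r * ev t))).re
      + (inner ℂ (ev t • F' (r * ev t)) (Kf F' (r * ev t))).re))
def TTt (F F' F'' : ℂ → E) (q ε r t : ℝ) : ℝ :=
  q * ((2 * (inner ℂ (F (r * ev t)) ((2 * Real.pi : ℝ) • (Complex.I • Kf F' (r * ev t)))).re * (q/2-1) * (vv F ε r t) ^ (q/2 - 1 - 1)) * aa F (fun z => Complex.I • Kf F' z) r t
   + (vv F ε r t) ^ (q/2 - 1) * ((inner ℂ (F (r * ev t)) ((2 * Real.pi : ℝ) • (Complex.I • ((r * ev t : ℂ) • (Complex.I • Kf' F' F'' (r * ev t)))))).re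
      + (inner ℂ ((2 * Real.pi : ℝ) • (Complex.I • Kf F' (r * ev t))) (Complex.I • Kf F' (r * ev t))).re))

variable {F F' F'' : ℂ → E}

theorem vv_r (hF : ∀ z, HasDerivAt F (F' z) z) (ε r t : ℝ) : HasDerivAt (fun r => vv F ε r t) (2 * (inner ℂ (F (r * ev t)) (ev t • F' (r * ev t))).re) r := by
  unfold vv
  exact (deriv_normsq (deriv_r hF r t)).add_const ε

theorem vv_t (hF : ∀ z, HasDerivAt F (F' z) z) (ε r t : ℝ) : HasDerivAt (fun t => vv F ε r t) (2 * (inner ℂ (F (r * ev t)) ((2 * Real.pi : ℝ) • (Complex.I • Kf F' (r * ev t)))).re) t := by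
  unfold vv
  exact (deriv_normsq (deriv_t hF r t)).add_const ε

theorem mm_r (hF : ∀ z, HasDerivAt F (F' z) z) (q : ℝ) {ε : ℝ} (hε : 0 < ε) (r t : ℝ) :
    HasDerivAt (fun r => (vv F ε r t) ^ (q/2)) (mr F F' q ε r t) r := by
  have := (vv_r hF ε r t).rpow_const (p := q/2) (Or.inl (vv_pos F hε r t).ne')
  convert this using 1
  unfold mr; ring

theorem WW_r (hF : ∀ z, HasDerivAt F (F' z) z) (hF' : ∀ z, HasDerivAt F' (F'' z) z) (q : ℝ) {ε : ℝ} (hε : 0 < ε) (r t : ℝ) :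
    HasDerivAt (fun r => WW F F' q ε r t) (WWr F F' F'' q ε r t) r := by
  have h1 := (vv_r hF ε r t).rpow_const (p := q/2-1) (Or.inl (vv_pos F hε r t).ne')
  have h2 := deriv_inner (deriv_r hF r t) (deriv_r (hasDeriv_Kf hF') r t)
  exact (h1.mul h2).const_mul q

theorem TT_t (hF : ∀ z, HasDerivAt F (F' z) z) (hF' : ∀ z, HasDerivAt F' (F'' z) z) (q : ℝ) {ε : ℝ} (hε : 0 < ε) (r t : ℝ) :
    HasDerivAt (fun t => TT F F' q ε r t) (TTt F F' F'' q ε r t) t := by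
  have h1 := (vv_t hF ε r t).rpow_const (p := q/2-1) (Or.inl (vv_pos F hε r t).ne')
  have h2 := deriv_inner (deriv_t hF r t) (deriv_t (G := fun z => Complex.I • Kf F' z) (G' := fun z => Complex.I • Kf' F' F'' z)
    (fun z => (hasDeriv_Kf hF' z).const_smul Complex.I) r t)
  exact (h1.mul h2).const_mul q

theorem green_pt (q : ℝ) (hq : 0 < q) (hq2 : q ≤ 2) {ε : ℝ} (hε : 0 < ε) (r t : ℝ) :
    q^2 * ((vv F ε r t) ^ (q/2-1) * ‖Kf F' (r * ev t)‖^2) ≤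
    r * WWr F F' F'' q ε r t + (1 / (2 * Real.pi)) * TTt F F' F'' q ε r t := by
  have hpi : (Real.pi : ℝ) ≠ 0 := Real.pi_ne_zero
  set z : ℂ := r * ev t with hz
  set K := Kf F' z with hK
  set v := vv F ε r t with hv
  have hv0 : 0 < v := vv_pos F hε r t
  set c : ℂ := inner ℂ (F z) K with hc
  -- rewriting
  have e1 : r * (inner ℂ (F z) (ev t • F' z)).re = c.re := by
    rw [hc, hK, Kf, inner_smul_right, inner_smul_right, hz, mul_assoc, Complex.re_ofReal_mul]
  have e2 : r * (inner ℂ (ev t • F' z) K).re = ‖K‖^2 := by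
    have : (inner ℂ K K).re = ‖K‖^2 := inner_self_eq_norm_sq (𝕜 := ℂ) K
    rw [← this]
    have h2 : K = (r : ℂ) • (ev t • F' z) := by rw [hK, Kf, smul_smul]
    conv_rhs => rw [h2, inner_smul_left, ← h2]
    rw [Complex.conj_ofReal, Complex.re_ofReal_mul]
  have e3 : ∀ x : E, (inner ℂ (F z) ((2 * Real.pi : ℝ) • x)).re = 2 * Real.pi * (inner ℂ (F z) x).re := by
    intro x
    rw [← Complex.coe_smul, inner_smul_right, Complex.re_ofReal_mul]
  have e4 : (inner ℂ (F z) (Complex.I • K)).re = - c.im := by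
    rw [inner_smul_right]; simp [hc]
  have e5 : (inner ℂ (F z) (Complex.I • (z • (Complex.I • Kf' F' F'' z)))).re = - (r * (inner ℂ (F z) (ev t • Kf' F' F'' z)).re) := by
    rw [inner_smul_right, inner_smul_right, inner_smul_right, inner_smul_right, ← Complex.re_ofReal_mul, ← Complex.neg_re]
    congr 1
    linear_combination (z * inner ℂ (F z) (Kf' F' F'' z)) * Complex.I_mul_I - (inner ℂ (F z) (Kf' F' F'' z)) * hz
  have e6 : (inner ℂ ((2 * Real.pi : ℝ) • (Complex.I • K)) (Complex.I • K)).re = 2 * Real.pi * ‖K‖^2 := by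
    rw [← Complex.coe_smul, inner_smul_left, Complex.conj_ofReal, Complex.re_ofReal_mul]
    congr 1
    have := inner_self_eq_norm_sq (𝕜 := ℂ) (Complex.I • K)
    rw [norm_smul, Complex.norm_I, one_mul] at this
    exact this
  have e7 : v ^ (q/2-1) = v^(q/2-1-1) * v := by
    rw [Real.rpow_sub_one hv0.ne' (q/2-1)]; field_simp
  have key : r * WWr F F' F'' q ε r t + (1 / (2 * Real.pi)) * TTt F F' F'' q ε r t =
      q * ((q-2) * v^(q/2-1-1) * (c.re^2 + c.im^2) + 2 * v^(q/2-1) * ‖K‖^2) := by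
    unfold WWr TTt aa
    simp only [← hz, ← hv, ← hK, e3, e4, e5, e6, ← hc]
    generalize v^(q/2-1-1) = P1
    generalize v^(q/2-1) = P2
    field_simp
    linear_combination ((q-2) * P1 * c.re) * e1 + P2 * e2
  have hcs : c.re^2 + c.im^2 ≤ v * ‖K‖^2 := by
    have h1 : ‖c‖ ≤ ‖F z‖ * ‖K‖ := norm_inner_le_norm _ _
    have h2 : c.re^2 + c.im^2 = ‖c‖^2 := by
      rw [← Complex.normSq_eq_norm_sq, Complex.normSq_apply]; ring
    rw [h2]
    calc ‖c‖^2 ≤ (‖F z‖ * ‖K‖)^2 := by gcongr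
      _ = ‖F z‖^2 * ‖K‖^2 := by ring
      _ ≤ v * ‖K‖^2 := by
        gcongr
        rw [hv, vv]; linarith
  rw [key, e7]
  have h3 : 0 ≤ v^(q/2-1-1) := by positivity
  have h4 := mul_le_mul_of_nonneg_left hcs (mul_nonneg (mul_nonneg hq.le (by linarith : (0:ℝ) ≤ 2 - q)) h3)
  nlinarith [h4]

theorem cont_WWr (hF : ∀ z, HasDerivAt F (F' z) z) (hF' : ∀ z, HasDerivAt F' (F'' z) z) (hF'' : Continuous F'') (q : ℝ) {ε : ℝ} (hε : 0 < ε) :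
    Continuous (Function.uncurry (WWr F F' F'' q ε)) := by
  have c0 : Continuous F := continuous_iff_continuousAt.2 fun z => (hF z).continuousAt
  have c1 : Continuous F' := continuous_iff_continuousAt.2 fun z => (hF' z).continuousAt
  have k1 : Continuous (Kf F') := by unfold Kf; fun_prop
  have k2 : Continuous (Kf' F' F'') := by unfold Kf'; fun_prop
  have a0 := cont_comp c0
  have a1 := cont_comp c1
  have a2 := cont_comp k1
  have a3 := cont_comp k2
  have ce : Continuous (fun x : ℝ × ℝ => ev x.2) := continuous_ev.comp continuous_snd
  have hv := cont_vv c0 ε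
  have hv1 : ∀ s : ℝ, Continuous (fun x : ℝ × ℝ => vv F ε x.1 x.2 ^ s) := fun s => 
    hv.rpow_const fun x => Or.inl (vv_pos F hε _ _).ne'
  have b1 := Complex.continuous_re.comp (a0.inner (𝕜 := ℂ) (ce.smul a1))
  have b2 := Complex.continuous_re.comp (a0.inner (𝕜 := ℂ) (ce.smul a3))
  have b3 := Complex.continuous_re.comp ((ce.smul a1).inner (𝕜 := ℂ) a2)
  have b4 := Complex.continuous_re.comp (a0.inner (𝕜 := ℂ) a2)
  exact continuous_const.mul (((((continuous_const.mul b1).mul continuous_const).mul (hv1 _)).mul b4).add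
    ((hv1 _).mul (b2.add b3)))

theorem cont_TTt (hF : ∀ z, HasDerivAt F (F' z) z) (hF' : ∀ z, HasDerivAt F' (F'' z) z) (hF'' : Continuous F'') (q : ℝ) {ε : ℝ} (hε : 0 < ε) :
    Continuous (Function.uncurry (TTt F F' F'' q ε)) := by
  have c0 : Continuous F := continuous_iff_continuousAt.2 fun z => (hF z).continuousAt
  have c1 : Continuous F' := continuous_iff_continuousAt.2 fun z => (hF' z).continuousAt
  have k1 : Continuous (Kf F') := by unfold Kf; fun_prop
  have k2 : Continuous (Kf' F' F'') := by unfold Kf'; fun_prop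
  have a0 := cont_comp c0
  have a1 := cont_comp c1
  have a2 := cont_comp k1
  have a3 := cont_comp k2
  have ce : Continuous (fun x : ℝ × ℝ => (x.1 * ev x.2 : ℂ)) := 
    (Complex.continuous_ofReal.comp continuous_fst).mul (continuous_ev.comp continuous_snd)
  have hv := cont_vv c0 ε
  have hv1 : ∀ s : ℝ, Continuous (fun x : ℝ × ℝ => vv F ε x.1 x.2 ^ s) := fun s => 
    hv.rpow_const fun x => Or.inl (vv_pos F hε _ _).ne'
  have d2 := a2.const_smul Complex.I
  have d3 := a3.const_smul Complex.I
  have b1 := Complex.continuous_re.comp (a0.inner (𝕜 := ℂ) (d2.const_smul (2 * Real.pi : ℝ)))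
  have b2 := Complex.continuous_re.comp (a0.inner (𝕜 := ℂ) (((ce.smul d3).const_smul Complex.I).const_smul (2 * Real.pi : ℝ)))
  have b3 := Complex.continuous_re.comp ((d2.const_smul (2 * Real.pi : ℝ)).inner (𝕜 := ℂ) d2)
  have b4 := Complex.continuous_re.comp (a0.inner (𝕜 := ℂ) d2)
  exact continuous_const.mul (((((continuous_const.mul b1).mul continuous_const).mul (hv1 _)).mul b4).add
    ((hv1 _).mul (b2.add b3)))

/-- The density appearing in the Green formula. -/
def DD (F F' : ℂ → E) (q ε r t : ℝ) : ℝ := (vv F ε r t) ^ (q/2-1) * ‖F' (r * ev t)‖^2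

theorem cont_DD (hF : ∀ z, HasDerivAt F (F' z) z) (hF' : ∀ z, HasDerivAt F' (F'' z) z) (q : ℝ) {ε : ℝ} (hε : 0 < ε) :
    Continuous (Function.uncurry (DD F F' q ε)) := by
  have c0 : Continuous F := continuous_iff_continuousAt.2 fun z => (hF z).continuousAt
  have c1 : Continuous F' := continuous_iff_continuousAt.2 fun z => (hF' z).continuousAt
  have a1 := cont_comp c1
  have hv := cont_vv c0 ε
  have hv1 : ∀ s : ℝ, Continuous (fun x : ℝ × ℝ => vv F ε x.1 x.2 ^ s) := fun s => 
    hv.rpow_const fun x => Or.inl (vv_pos F hε _ _).ne'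
  exact (hv1 _).mul (a1.norm.pow 2)

set_option maxHeartbeats 1000000 in
theorem green (hF : ∀ z, HasDerivAt F (F' z) z) (hF' : ∀ z, HasDerivAt F' (F'' z) z) (hF'' : Continuous F'') (q : ℝ) (hq : 0 < q) (hq2 : q ≤ 2) {ε : ℝ} (hε : 0 < ε) :
    ∫ r in (0:ℝ)..1, (1 - r) * (q^2 * (r * ∫ t in (-(1/2) : ℝ)..(1/2), DD F F' q ε r t)) ≤
      ∫ t in (-(1/2) : ℝ)..(1/2), (vv F ε 1 t) ^ (q/2) := by
  have c0 : Continuous F := continuous_iff_continuousAt.2 fun z => (hF z).continuousAt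
  have c1 : Continuous F' := continuous_iff_continuousAt.2 fun z => (hF' z).continuousAt
  have hv := cont_vv c0 ε
  have hv1 : ∀ s : ℝ, Continuous (fun x : ℝ × ℝ => vv F ε x.1 x.2 ^ s) := fun s => 
    hv.rpow_const fun x => Or.inl (vv_pos F hε _ _).ne'
  have ce : Continuous (fun x : ℝ × ℝ => ev x.2) := continuous_ev.comp continuous_snd
  have cmr : Continuous (Function.uncurry (mr F F' q ε)) :=
    continuous_const.mul ((hv1 _).mul (Complex.continuous_re.comp ((cont_comp c0).inner (𝕜 := ℂ) (ce.smul (cont_comp c1)))))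
  set m : ℝ → ℝ := fun r => ∫ t in (-(1/2) : ℝ)..(1/2), (vv F ε r t) ^ (q/2) with hm
  set w : ℝ → ℝ := fun r => ∫ t in (-(1/2) : ℝ)..(1/2), WW F F' q ε r t with hw
  set m' : ℝ → ℝ := fun r => ∫ t in (-(1/2) : ℝ)..(1/2), mr F F' q ε r t with hm'
  set w' : ℝ → ℝ := fun r => ∫ t in (-(1/2) : ℝ)..(1/2), WWr F F' F'' q ε r t with hw'
  set D : ℝ → ℝ := fun r => ∫ t in (-(1/2) : ℝ)..(1/2), DD F F' q ε r t with hD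
  have dm : ∀ r, HasDerivAt m (m' r) r := fun r => hasDerivAt_param (fun r t => (vv F ε r t)^(q/2)) (mr F F' q ε) _ _ cmr (mm_r hF q hε) 
    (fun r => cslice (f := fun r t => (vv F ε r t)^(q/2)) (hv1 _) r) r
  have wm : ∀ r t, WW F F' q ε r t = r * mr F F' q ε r t := by
    intro r t
    unfold WW mr aa Kf
    rw [inner_smul_right, inner_smul_right, mul_assoc, Complex.re_ofReal_mul]
    ring
  have cWW : ∀ r, Continuous (WW F F' q ε r) := by
    intro r
    have : WW F F' q ε r = fun t => r * mr F F' q ε r t := funext (wm r)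
    rw [this]
    exact continuous_const.mul (cslice cmr r)
  have dw : ∀ r, HasDerivAt w (w' r) r := fun r => hasDerivAt_param (WW F F' q ε) (WWr F F' F'' q ε) _ _ (cont_WWr hF hF' hF'' q hε) (WW_r hF hF' q hε) cWW r
  have wm2 : ∀ r, w r = r * m' r := by
    intro r
    simp only [hw, hm', wm]
    rw [intervalIntegral.integral_const_mul]
  have hT : ∀ r, ∫ t in (-(1/2) : ℝ)..(1/2), TTt F F' F'' q ε r t = 0 := by
    intro r
    rw [intervalIntegral.integral_eq_sub_of_hasDerivAt (f := TT F F' q ε r) (fun t _ => TT_t hF hF' q hε r t)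
      ((cslice (cont_TTt hF hF' hF'' q hε) r).intervalIntegrable _ _)]
    unfold TT aa vv
    rw [ev_half, sub_self]
  have hDnn : ∀ r, 0 ≤ D r := by
    intro r
    apply intervalIntegral.integral_nonneg (by norm_num)
    intro t _
    unfold DD
    have := vv_pos F hε r t
    positivity
  have hDc : Continuous D := 
    intervalIntegral.continuous_parametric_intervalIntegral_of_continuous' (cont_DD hF hF' q hε) _ _
  have hw'D : ∀ r, 0 < r → q^2 * (r * D r) ≤ w' r := by
    intro r hr
    have h1 : q^2 * r^2 * D r ≤ r * w' r + (1 / (2 * Real.pi)) * 0 := by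
      rw [← hT r, hD, hw', ← intervalIntegral.integral_const_mul, ← intervalIntegral.integral_const_mul, ← intervalIntegral.integral_const_mul,
        ← intervalIntegral.integral_add]
      · apply intervalIntegral.integral_mono_on (by norm_num)
        · exact (continuous_const.mul (cslice (cont_DD hF hF' q hε) r)).intervalIntegrable _ _
        · exact ((continuous_const.mul (cslice (cont_WWr hF hF' hF'' q hε) r)).add
            (continuous_const.mul (cslice (cont_TTt hF hF' hF'' q hε) r))).intervalIntegrable _ _
        · intro t _
          refine le_trans (le_of_eq ?_) (green_pt (F := F) (F' := F') (F'' := F'') q hq hq2 hε r t)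
          unfold DD Kf
          rw [norm_smul, norm_mul, norm_ev, mul_one, Complex.norm_real, Real.norm_eq_abs, mul_pow, sq_abs]
          ring
      · exact (continuous_const.mul (cslice (cont_WWr hF hF' hF'' q hε) r)).intervalIntegrable _ _
      · exact (continuous_const.mul (cslice (cont_TTt hF hF' hF'' q hε) r)).intervalIntegrable _ _
    have h2 : r * (q^2 * (r * D r)) ≤ r * w' r := by nlinarith
    exact le_of_mul_le_mul_left h2 hr
  have w0 : w 0 = 0 := by rw [wm2]; simp
  have wmono : ∀ r, 0 ≤ r → 0 ≤ w r := by
    intro r hr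
    have : MonotoneOn w (Set.Ici 0) := by
      apply monotoneOn_of_deriv_nonneg (convex_Ici 0)
      · exact fun x _ => (dw x).continuousAt.continuousWithinAt
      · exact fun x _ => (dw x).differentiableAt.differentiableWithinAt
      · intro x hx
        rw [interior_Ici] at hx
        rw [(dw x).deriv]
        have hx' : (0:ℝ) < x := hx
        exact le_trans (by have := hDnn x; positivity) (hw'D x hx)
    rw [← w0]
    exact this Set.self_mem_Ici hr hr
  have dh : ∀ r, HasDerivAt (fun r => m r + (1 - r) * w r) (m' r + (-1 * w r + (1 - r) * w' r)) r := by
    intro r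
    have h1 : HasDerivAt (fun r : ℝ => 1 - r) (-1) r := by simpa using (hasDerivAt_id r).const_sub 1
    exact (dm r).add (h1.mul (dw r))
  have fin := intervalIntegral.integral_le_sub_of_hasDeriv_right_of_le (a := 0) (b := 1) (g := fun r => m r + (1 - r) * w r)
    (g' := fun r => m' r + (-1 * w r + (1 - r) * w' r)) (φ := fun r => (1 - r) * (q^2 * (r * D r))) zero_le_one
    (fun x _ => (dh x).continuousAt.continuousWithinAt) (fun x _ => (dh x).hasDerivWithinAt)
    (Continuous.integrableOn_Icc (by fun_prop)) (by
      intro x hx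
      have h1 := hw'D x hx.1
      have h2 := wmono x hx.1.le
      have h3 : w x ≤ m' x := by
        have h4 := wm2 x
        have : 0 ≤ m' x := by
          by_contra hneg
          push Not at hneg
          nlinarith [hx.1]
        nlinarith [hx.2]
      have h5 : (1 - x) * (q^2 * (x * D x)) ≤ (1-x) * w' x := mul_le_mul_of_nonneg_left h1 (by linarith [hx.2])
      show (1 - x) * (q^2 * (x * D x)) ≤ m' x + (-1 * w x + (1 - x) * w' x)
      linarith)
  have hm0 : 0 ≤ m 0 := by
    apply intervalIntegral.integral_nonneg (by norm_num)
    intro t _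
    have := vv_pos F hε 0 t
    positivity
  simp only [sub_self, zero_mul, add_zero, w0, mul_zero] at fin
  linarith

end green
end HPTL
end

section
namespace HPTL
set_option linter.all false
set_option linter.unusedSectionVars false

theorem blaschke_le {a z : ℂ} (ha : ‖a‖ ≤ 1) (hz : ‖z‖ ≤ 1) : ‖z - a‖ ≤ ‖1 - (starRingEnd ℂ) a * z‖ := by
  apply le_of_sq_le_sq _ (norm_nonneg _)
  have h1 : ‖a‖^2 ≤ 1 := by nlinarith [norm_nonneg a]
  have h2 : ‖z‖^2 ≤ 1 := by nlinarith [norm_nonneg z]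
  rw [← Complex.normSq_eq_norm_sq, Complex.normSq_apply] at *
  rw [← Complex.normSq_eq_norm_sq, Complex.normSq_apply]
  simp at *
  nlinarith [mul_nonneg (sub_nonneg.2 h1) (sub_nonneg.2 h2)]

theorem blaschke_eq {a z : ℂ} (hz : ‖z‖ = 1) : ‖z - a‖ = ‖1 - (starRingEnd ℂ) a * z‖ := by
  have h2 : ‖z‖^2 = 1 := by rw [hz]; norm_num
  rw [← Complex.normSq_eq_norm_sq, Complex.normSq_apply] at h2
  have : ‖z - a‖^2 = ‖1 - (starRingEnd ℂ) a * z‖^2 := by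
    rw [← Complex.normSq_eq_norm_sq, Complex.normSq_apply, ← Complex.normSq_eq_norm_sq, Complex.normSq_apply]
    simp at *
    linear_combination (1 - a.re^2 - a.im^2) * h2
  exact (sq_eq_sq₀ (norm_nonneg _) (norm_nonneg _)).1 this

theorem dcc_factor {b : ℂ} (hb : ‖b‖ ≤ 1) {s : ℝ} (hs : 0 < s) :
    DiffContOnCl ℂ (fun z : ℂ => (1 - b * z) ^ (s : ℂ)) (Metric.ball 0 1) := by
  constructor
  · intro z hz
    have hz' : ‖z‖ < 1 := by simpa using hz
    apply DifferentiableAt.differentiableWithinAt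
    apply DifferentiableAt.cpow_const (by fun_prop)
    left
    have : (b * z).re ≤ ‖b * z‖ := Complex.re_le_norm _
    rw [norm_mul] at this
    simp only [Complex.sub_re, Complex.one_re]
    nlinarith [norm_nonneg b, norm_nonneg z]
  · rw [closure_ball _ one_ne_zero]
    intro z hz
    have hz' : ‖z‖ ≤ 1 := by simpa using hz
    apply ContinuousAt.continuousWithinAt
    have h1 : ContinuousAt (fun w : ℂ => w ^ (s:ℂ)) (1 - b * z) := by
      apply Complex.continuousAt_cpow_const_of_re_pos
      · left
        have : (b * z).re ≤ ‖b * z‖ := Complex.re_le_norm _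
        rw [norm_mul] at this
        simp only [Complex.sub_re, Complex.one_re]
        nlinarith [norm_nonneg b, norm_nonneg z]
      · simpa using hs
    exact ContinuousAt.comp (f := fun z : ℂ => 1 - b * z) h1 (by fun_prop)

theorem norm_cpow_r (x : ℂ) {s : ℝ} (hs : 0 < s) : ‖x ^ (s:ℂ)‖ = ‖x‖ ^ s := by
  exact Complex.norm_cpow_real x s

/-- outer majorant property -/
def Outer (s : ℝ) (f : ℂ → ℂ) : Prop := ∃ g : ℂ → ℂ, DiffContOnCl ℂ g (Metric.ball 0 1) ∧
  (∀ z, ‖z‖ < 1 → ‖f z‖ ^ s ≤ ‖g z‖) ∧ ∀ z, ‖z‖ = 1 → ‖g z‖ = ‖f z‖ ^ s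

theorem outer_const {s : ℝ} (c : ℂ) : Outer s (fun _ => c) :=
  ⟨fun _ => ((‖c‖ ^ s : ℝ) : ℂ), diffContOnCl_const, fun z _ => by
    rw [Complex.norm_real, Real.norm_eq_abs]; exact le_abs_self _, fun z _ => by
    rw [Complex.norm_real, Real.norm_eq_abs, abs_of_nonneg (by positivity)]⟩

theorem outer_mul {s : ℝ} (hs : 0 < s) {f g : ℂ → ℂ} (hf : Outer s f) (hg : Outer s g) : Outer s (fun z => f z * g z) := by
  obtain ⟨F, hF1, hF2, hF3⟩ := hf
  obtain ⟨G, hG1, hG2, hG3⟩ := hg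
  refine ⟨fun z => F z * G z, hF1.smul hG1, fun z hz => ?_, fun z hz => ?_⟩
  · rw [norm_mul, norm_mul, Real.mul_rpow (norm_nonneg _) (norm_nonneg _)]
    exact mul_le_mul (hF2 z hz) (hG2 z hz) (by positivity) (norm_nonneg _)
  · rw [norm_mul, norm_mul, Real.mul_rpow (norm_nonneg _) (norm_nonneg _), hF3 z hz, hG3 z hz]

theorem outer_linear {s : ℝ} (hs : 0 < s) (a : ℂ) : Outer s (fun z => z - a) := by
  by_cases ha : ‖a‖ ≤ 1
  · refine ⟨_, dcc_factor (b := (starRingEnd ℂ) a) (by simpa using ha) hs, fun z hz => ?_, fun z hz => ?_⟩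
    · rw [norm_cpow_r _ hs]
      exact Real.rpow_le_rpow (norm_nonneg _) (blaschke_le ha hz.le) hs.le
    · rw [norm_cpow_r _ hs, blaschke_eq hz]
  · push Not at ha
    have ha0 : a ≠ 0 := by rintro rfl; simp at ha; linarith
    have key : ∀ z : ℂ, ‖(((‖a‖^s : ℝ)) : ℂ) * (1 - a⁻¹ * z)^(s:ℂ)‖ = ‖z - a‖^s := by
      intro z
      rw [norm_mul, norm_cpow_r _ hs, Complex.norm_real, Real.norm_eq_abs, abs_of_nonneg (by positivity),
        ← Real.mul_rpow (norm_nonneg _) (norm_nonneg _), ← norm_mul, mul_sub, mul_inv_cancel_left₀ ha0, mul_one, norm_sub_rev]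
    refine ⟨fun z => (((‖a‖^s : ℝ)) : ℂ) * (1 - a⁻¹ * z)^(s:ℂ), 
      (diffContOnCl_const (c := (((‖a‖^s : ℝ)) : ℂ))).smul (dcc_factor (b := a⁻¹) (by rw [norm_inv]; exact inv_le_one_of_one_le₀ ha.le) hs), 
        fun z hz => (key z).ge, fun z hz => key z⟩

theorem outer_poly {s : ℝ} (hs : 0 < s) (f : Polynomial ℂ) : Outer s (fun z => f.eval z) := by
  have h := (IsAlgClosed.splits f).eq_prod_roots
  have hm : ∀ m : Multiset ℂ, Outer s (fun z => ((m.map fun a => Polynomial.X - Polynomial.C a).prod).eval z) := by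
    intro m
    induction m using Multiset.induction with
    | empty => simpa using outer_const (s := s) 1
    | cons a m ih =>
      simp only [Multiset.map_cons, Multiset.prod_cons, Polynomial.eval_mul]
      refine outer_mul hs ?_ ih
      simpa using outer_linear hs a
  rw [h]
  simp only [Polynomial.eval_mul]
  refine outer_mul hs ?_ (hm _)
  simpa using outer_const (s := s) f.leadingCoeff

theorem circleAverage_ev (f : ℂ → ℝ) (c : ℝ) :
    Real.circleAverage f 0 1 = ∫ τ in (c - 1/2)..(c + 1/2), f (ev τ) := by
  have hev : ∀ x : ℝ, ev x = circleMap 0 1 ((2 * Real.pi) * x) := by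
    intro x; unfold ev circleMap; push_cast; simp
  have hper : Function.Periodic (fun τ => f (ev τ)) 1 := by
    intro x
    simp only [hev]
    rw [mul_add, mul_one, periodic_circleMap]
  have h1 : ∫ τ in (c - 1/2)..(c + 1/2), f (ev τ) = ∫ τ in (0:ℝ)..1, f (ev τ) := by
    have := hper.intervalIntegral_add_eq (c - 1/2) 0
    rw [show c - 1/2 + 1 = c + 1/2 by ring, zero_add] at this
    exact this
  rw [h1, Real.circleAverage_def]
  simp only [hev]
  have h2 := intervalIntegral.integral_comp_mul_left (a := 0) (b := 1) (c := 2 * Real.pi) (fun x => f (circleMap 0 1 x)) (by positivity)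
  rw [h2]; simp

theorem pk_cont {w : ℂ} (hw : ‖w‖ < 1) : Continuous (fun τ : ℝ => poissonKernel 0 w (ev τ)) := by
  unfold poissonKernel
  have := continuous_ev
  refine Continuous.div (by fun_prop) (by fun_prop) ?_
  intro τ
  have h1 : ev τ - 0 - (w - 0) ≠ 0 := by
    intro h
    have : ev τ = w := by simpa [sub_eq_zero] using h
    rw [← this, norm_ev] at hw
    exact lt_irrefl _ hw
  have := norm_pos_iff.2 h1
  positivity

theorem pk_nonneg {w : ℂ} (hw : ‖w‖ < 1) (τ : ℝ) : 0 ≤ poissonKernel 0 w (ev τ) := by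
  unfold poissonKernel
  simp only [sub_zero, norm_ev]
  apply div_nonneg _ (by positivity)
  nlinarith [norm_nonneg w]

theorem submean_poly {s : ℝ} (hs : 0 < s) (f : Polynomial ℂ) {w : ℂ} (hw : ‖w‖ < 1) (c : ℝ) :
    ‖f.eval w‖ ^ s ≤ ∫ τ in (c - 1/2)..(c + 1/2), poissonKernel 0 w (ev τ) * ‖f.eval (ev τ)‖ ^ s := by
  obtain ⟨g, hg1, hg2, hg3⟩ := outer_poly hs f
  have h1 := hg1.circleAverage_poissonKernel_smul (w := w) (by simpa using hw)
  refine (hg2 w hw).trans ?_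
  rw [← h1, ← circleAverage_ev (fun z => poissonKernel 0 w z * ‖f.eval z‖ ^ s) c]
  rw [Real.circleAverage_def, Real.circleAverage_def, norm_smul, smul_eq_mul]
  rw [Real.norm_eq_abs, abs_of_nonneg (by positivity)]
  gcongr
  refine (intervalIntegral.norm_integral_le_integral_norm (by positivity)).trans (le_of_eq ?_)
  apply intervalIntegral.integral_congr
  intro θ _
  have e : circleMap 0 1 θ = ev (θ / (2 * Real.pi)) := by
    unfold ev circleMap
    have : (2 * (Real.pi:ℂ)) * ((θ / (2 * Real.pi) : ℝ) : ℂ) = θ := by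
      push_cast
      have : (Real.pi : ℂ) ≠ 0 := by exact_mod_cast Real.pi_ne_zero
      field_simp
    rw [this]; simp
  simp only [Pi.smul_apply', norm_smul]
  rw [e, hg3 _ (norm_ev _), Real.norm_eq_abs, abs_of_nonneg (pk_nonneg hw _)]

section
variable {E : Type*} [NormedAddCommGroup E] [InnerProductSpace ℂ E]
/-- vector valued polynomial -/
def vpoly (N : ℕ) (a : ℕ → E) (z : ℂ) : E := ∑ j ∈ Finset.range N, z ^ j • a j

theorem cont_vpoly (N : ℕ) (a : ℕ → E) : Continuous (vpoly N a) := by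
  unfold vpoly; fun_prop

theorem submean {s : ℝ} (hs : 0 < s) (N : ℕ) (a : ℕ → E) {w : ℂ} (hw : ‖w‖ < 1) (c : ℝ) :
    ‖vpoly N a w‖ ^ s ≤ ∫ τ in (c - 1/2)..(c + 1/2), poissonKernel 0 w (ev τ) * ‖vpoly N a (ev τ)‖ ^ s := by
  have hcont : Continuous fun τ => poissonKernel 0 w (ev τ) * ‖vpoly N a (ev τ)‖ ^ s := by
    refine (pk_cont hw).mul (Continuous.rpow_const ((cont_vpoly N a).comp continuous_ev).norm fun _ => Or.inr hs.le)
  by_cases h0 : vpoly N a w = 0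
  · rw [h0, norm_zero, Real.zero_rpow hs.ne']
    apply intervalIntegral.integral_nonneg (by linarith)
    intro τ _
    have := pk_nonneg hw τ
    positivity
  set e := vpoly N a w with he
  set f : Polynomial ℂ := ∑ j ∈ Finset.range N, Polynomial.C (inner ℂ e (a j)) * Polynomial.X ^ j with hf
  have hfe : ∀ z, f.eval z = inner ℂ e (vpoly N a z) := by
    intro z
    rw [hf, Polynomial.eval_finset_sum, vpoly, inner_sum]
    apply Finset.sum_congr rfl
    intro j _
    rw [inner_smul_right, Polynomial.eval_mul, Polynomial.eval_C, Polynomial.eval_pow, Polynomial.eval_X]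
    exact mul_comm _ _
  have h1 := submean_poly hs f hw c
  have hpos : 0 < ‖e‖ ^ s := Real.rpow_pos_of_pos (norm_pos_iff.2 h0) s
  have h2 : ‖f.eval w‖ ^ s = ‖e‖ ^ s * ‖e‖ ^ s := by
    have h5 : ‖((‖e‖ : ℝ) : ℂ)‖ = ‖e‖ := by rw [Complex.norm_real, norm_norm]
    rw [hfe, ← he, inner_self_eq_norm_sq_to_K, norm_pow, sq, Real.mul_rpow (norm_nonneg _) (norm_nonneg _)]
    exact congrArg₂ _ (congrArg (· ^ s) h5) (congrArg (· ^ s) h5)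
  rw [h2] at h1
  have h3 : ∫ τ in (c - 1/2)..(c + 1/2), poissonKernel 0 w (ev τ) * ‖f.eval (ev τ)‖ ^ s ≤
      ∫ τ in (c - 1/2)..(c + 1/2), ‖e‖ ^ s * (poissonKernel 0 w (ev τ) * ‖vpoly N a (ev τ)‖ ^ s) := by
    apply intervalIntegral.integral_mono_on (by linarith)
    · refine Continuous.intervalIntegrable ((pk_cont hw).mul (Continuous.rpow_const (f.continuous.comp continuous_ev).norm fun _ => Or.inr hs.le)) _ _
    · exact (continuous_const.mul hcont).intervalIntegrable _ _
    · intro τ _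
      rw [hfe, mul_left_comm]
      apply mul_le_mul_of_nonneg_left _ (pk_nonneg hw τ)
      rw [← Real.mul_rpow (norm_nonneg _) (norm_nonneg _)]
      exact Real.rpow_le_rpow (norm_nonneg _) (norm_inner_le_norm _ _) hs.le
  rw [intervalIntegral.integral_const_mul] at h3
  exact le_of_mul_le_mul_left (h1.trans h3) hpos
end
end HPTL
end

section
namespace HPTL
set_option linter.all false
set_option linter.unusedSectionVars false

/-- Hardy Littlewood maximal function -/
def Mx (g : ℝ → ℝ≥0∞) (t : ℝ) : ℝ≥0∞ :=
  ⨆ ρ : ℝ, ⨆ (_ : 0 < ρ), (∫⁻ x in Metric.closedBall t ρ, g x) / ENNReal.ofReal ρ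

theorem le_Mx (g : ℝ → ℝ≥0∞) (t : ℝ) {ρ : ℝ} (hρ : 0 < ρ) :
    (∫⁻ x in Metric.closedBall t ρ, g x) ≤ ENNReal.ofReal ρ * Mx g t := by
  have h1 : (∫⁻ x in Metric.closedBall t ρ, g x) / ENNReal.ofReal ρ ≤ Mx g t :=
    le_iSup₂_of_le ρ hρ le_rfl
  rw [mul_comm]
  exact (ENNReal.div_le_iff (by simpa using hρ) ENNReal.ofReal_ne_top).1 h1

theorem Mx_weak {g : ℝ → ℝ≥0∞} (hg : ∫⁻ x, g x ≠ ⊤) {l : ℝ} (hl : 0 < l) :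
    volume {t | ENNReal.ofReal l < Mx g t} ≤ ENNReal.ofReal (10 / l) * ∫⁻ x, g x := by
  set S := {t | ENNReal.ofReal l < Mx g t} with hS
  have h1 : ∀ t ∈ S, ∃ ρ : ℝ, 0 < ρ ∧ ENNReal.ofReal (l * ρ) ≤ ∫⁻ x in Metric.closedBall t ρ, g x := by
    intro t ht
    have ht' : ENNReal.ofReal l < Mx g t := ht
    unfold Mx at ht'
    obtain ⟨ρ, hρ⟩ := lt_iSup_iff.1 ht'
    obtain ⟨h0, hρ⟩ := lt_iSup_iff.1 hρ
    refine ⟨ρ, h0, ?_⟩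
    rw [ENNReal.ofReal_mul hl.le]
    exact (ENNReal.le_div_iff_mul_le (Or.inl (by simpa using h0)) (Or.inl ENNReal.ofReal_ne_top)).1 hρ.le
  choose! ρ hρ0 hρ using h1
  obtain ⟨u, huS, hu1, hu2⟩ := Vitali.exists_disjoint_subfamily_covering_enlargement_closedBall S (fun t => t) ρ
    ((∫⁻ x, g x).toReal / l) (by
      intro t ht
      rw [le_div_iff₀ hl, mul_comm]
      rw [← ENNReal.ofReal_le_iff_le_toReal hg]
      exact (hρ t ht).trans (setLIntegral_le_lintegral _ _)) 5 (by norm_num)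
  have hcount : u.Countable := by
    have := hu1.countable_of_nonempty_interior (fun a ha => by
      rw [interior_closedBall _ (hρ0 a (huS ha)).ne']
      exact ⟨a, Metric.mem_ball_self (hρ0 a (huS ha))⟩)
    exact this
  have := hcount.to_subtype
  have hcov : S ⊆ ⋃ b ∈ u, Metric.closedBall b (5 * ρ b) := by
    intro t ht
    obtain ⟨b, hb, hb2⟩ := hu2 t ht
    exact Set.mem_iUnion₂.2 ⟨b, hb, hb2 (Metric.mem_closedBall_self (hρ0 t ht).le)⟩
  calc volume S ≤ volume (⋃ b ∈ u, Metric.closedBall b (5 * ρ b)) := measure_mono hcov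
    _ ≤ ∑' b : u, volume (Metric.closedBall (b:ℝ) (5 * ρ b)) := measure_biUnion_le _ hcount _
    _ ≤ ∑' b : u, ENNReal.ofReal (10 / l) * ∫⁻ x in Metric.closedBall (b:ℝ) (ρ b), g x := by
        apply ENNReal.tsum_le_tsum
        intro b
        rw [Real.volume_closedBall]
        calc ENNReal.ofReal (2 * (5 * ρ b)) = ENNReal.ofReal (10 / l) * ENNReal.ofReal (l * ρ b) := by
              rw [← ENNReal.ofReal_mul (by positivity)]
              congr 1; field_simp; ring
          _ ≤ _ := by gcongr; exact hρ b (huS b.2)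
    _ = ENNReal.ofReal (10 / l) * ∫⁻ x in ⋃ b ∈ u, Metric.closedBall b (ρ b), g x := by
        rw [ENNReal.tsum_mul_left, lintegral_biUnion hcount (fun _ _ => Metric.isClosed_closedBall.measurableSet) hu1]
    _ ≤ _ := by gcongr; exact Measure.restrict_le_self

theorem Mx_strong {g : ℝ → ℝ≥0∞} (hgm : Measurable g) (hg : ∫⁻ x, g x ≠ ⊤) {f : ℝ → ℝ} (hf : Measurable f)
    (hf0 : ∀ t, 0 ≤ f t) (hfM : ∀ t, ENNReal.ofReal (f t) ≤ Mx g t) :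
    ∫⁻ t, ENNReal.ofReal (f t ^ (2:ℝ)) ≤ 160 * ∫⁻ x, g x ^ (2:ℝ) := by
  have key : ∀ l : ℝ, 0 < l → volume {t | l < f t} * ENNReal.ofReal (l ^ ((2:ℝ) - 1)) ≤
      20 * ∫⁻ x, {x | ENNReal.ofReal (l/4) < g x}.indicator g x := by
    intro l hl
    set g1 := {x | ENNReal.ofReal (l/4) < g x}.indicator g with hg1
    have hms : MeasurableSet {x | ENNReal.ofReal (l/4) < g x} := measurableSet_lt measurable_const hgm
    have hle : ∀ x, g x ≤ g1 x + ENNReal.ofReal (l/4) := by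
      intro x
      by_cases h : ENNReal.ofReal (l/4) < g x
      · rw [hg1, Set.indicator_of_mem (show x ∈ {x | ENNReal.ofReal (l/4) < g x} from h)]; exact le_self_add
      · exact (not_lt.1 h).trans le_add_self
    have hg1f : ∫⁻ x, g1 x ≠ ⊤ := ((lintegral_mono (Set.indicator_le_self _ _)).trans_lt (lt_top_iff_ne_top.2 hg)).ne
    have hMle : ∀ t, Mx g t ≤ Mx g1 t + ENNReal.ofReal (l/2) := by
      intro t
      apply iSup₂_le
      intro ρ hρ
      rw [ENNReal.div_le_iff (by simpa using hρ) ENNReal.ofReal_ne_top]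
      calc ∫⁻ x in Metric.closedBall t ρ, g x ≤ ∫⁻ x in Metric.closedBall t ρ, (g1 x + ENNReal.ofReal (l/4)) := lintegral_mono hle
        _ = (∫⁻ x in Metric.closedBall t ρ, g1 x) + ENNReal.ofReal (l/4) * ENNReal.ofReal (2 * ρ) := by
            rw [lintegral_add_right _ measurable_const, setLIntegral_const, Real.volume_closedBall]
        _ ≤ ENNReal.ofReal ρ * Mx g1 t + ENNReal.ofReal (l/2) * ENNReal.ofReal ρ := by
            refine add_le_add (le_Mx g1 t hρ) ?_
            · rw [← ENNReal.ofReal_mul (by positivity), ← ENNReal.ofReal_mul (by positivity)]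
              apply le_of_eq; congr 1; ring
        _ = _ := by ring
    have hsub : {t | l < f t} ⊆ {t | ENNReal.ofReal (l/2) < Mx g1 t} := by
      intro t ht
      by_contra hcon
      have hcon' : Mx g1 t ≤ ENNReal.ofReal (l/2) := not_lt.1 hcon
      have h1 := (hfM t).trans ((hMle t).trans (add_le_add_left hcon' _))
      rw [← ENNReal.ofReal_add (by positivity) (by positivity), add_halves, ENNReal.ofReal_le_ofReal_iff hl.le] at h1
      exact absurd ht (not_lt.2 h1)
    calc volume {t | l < f t} * ENNReal.ofReal (l ^ ((2:ℝ) - 1)) 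
        ≤ (ENNReal.ofReal (10 / (l/2)) * ∫⁻ x, g1 x) * ENNReal.ofReal (l ^ ((2:ℝ) - 1)) := by
          gcongr
          exact (measure_mono hsub).trans (Mx_weak hg1f (by positivity))
      _ = (ENNReal.ofReal (10 / (l/2)) * ENNReal.ofReal (l ^ ((2:ℝ) - 1))) * ∫⁻ x, g1 x := by ring
      _ = 20 * ∫⁻ x, g1 x := by
          rw [← ENNReal.ofReal_mul (by positivity)]
          congr 1
          rw [show (2:ℝ) - 1 = 1 by norm_num, Real.rpow_one]
          rw [show 10 / (l/2) * l = 20 by field_simp; norm_num]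
          simp
  rw [lintegral_rpow_eq_lintegral_meas_lt_mul volume (Eventually.of_forall hf0) hf.aemeasurable two_pos]
  have hset : MeasurableSet {y : ℝ × ℝ | ENNReal.ofReal (y.1/4) < g y.2} := 
    measurableSet_lt (by fun_prop) (hgm.comp measurable_snd)
  calc ENNReal.ofReal 2 * ∫⁻ l in Set.Ioi (0:ℝ), volume {t | l < f t} * ENNReal.ofReal (l ^ ((2:ℝ) - 1))
      ≤ ENNReal.ofReal 2 * ∫⁻ l in Set.Ioi (0:ℝ), 20 * ∫⁻ x, {x | ENNReal.ofReal (l/4) < g x}.indicator g x := by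
        gcongr 1
        exact setLIntegral_mono' measurableSet_Ioi key
    _ = ENNReal.ofReal 2 * (20 * ∫⁻ l in Set.Ioi (0:ℝ), ∫⁻ x, {x | ENNReal.ofReal (l/4) < g x}.indicator g x) := by
        rw [lintegral_const_mul']; simp
    _ = ENNReal.ofReal 2 * (20 * ∫⁻ x, ∫⁻ l in Set.Ioi (0:ℝ), {x | ENNReal.ofReal (l/4) < g x}.indicator g x) := by
        rw [lintegral_lintegral_swap]
        have : Measurable (({y : ℝ × ℝ | ENNReal.ofReal (y.1/4) < g y.2}).indicator (fun y => g y.2)) :=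
          (hgm.comp measurable_snd).indicator hset
        exact this.aemeasurable
    _ ≤ ENNReal.ofReal 2 * (20 * ∫⁻ x, 4 * g x ^ (2:ℝ)) := by
        gcongr with x
        by_cases htop : g x = ⊤
        · simp [htop]
        calc ∫⁻ l in Set.Ioi (0:ℝ), {x | ENNReal.ofReal (l/4) < g x}.indicator g x 
            ≤ ∫⁻ l in Set.Ioi (0:ℝ), (Set.Ioo 0 (4 * (g x).toReal)).indicator (fun _ => g x) l := by
              apply setLIntegral_mono' measurableSet_Ioi
              intro l hl
              have hl' : (0:ℝ) < l := hl
              by_cases h : ENNReal.ofReal (l/4) < g x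
              · rw [Set.indicator_of_mem (show x ∈ {x | ENNReal.ofReal (l/4) < g x} from h), Set.indicator_of_mem]
                have := (ENNReal.ofReal_lt_iff_lt_toReal (by positivity) htop).1 h
                exact ⟨hl', by linarith⟩
              · rw [Set.indicator_of_notMem (show x ∉ {x | ENNReal.ofReal (l/4) < g x} from h)]; exact zero_le
          _ ≤ ∫⁻ l, (Set.Ioo 0 (4 * (g x).toReal)).indicator (fun _ => g x) l := setLIntegral_le_lintegral _ _
          _ = g x * ENNReal.ofReal (4 * (g x).toReal) := by
              rw [lintegral_indicator measurableSet_Ioo, setLIntegral_const, Real.volume_Ioo, sub_zero]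
          _ ≤ _ := by
              rw [ENNReal.ofReal_mul (by norm_num), ENNReal.ofReal_toReal htop, ENNReal.rpow_two]
              apply le_of_eq
              simp; ring
    _ = _ := by
        rw [lintegral_const_mul' _ _ (by simp), ← mul_assoc, ← mul_assoc]
        congr 1
        simp; norm_num

theorem kernel_max (g : ℝ → ℝ≥0∞) (hg : Measurable g) {t t' δ : ℝ} (hδ : 0 < δ) (htt : |t - t'| ≤ δ) :
    ∫⁻ τ, ENNReal.ofReal (δ / max (δ^2) ((τ - t')^2)) * g τ ≤ 16 * Mx g t := by
  have hpt : ∀ τ, ENNReal.ofReal (δ / max (δ^2) ((τ - t')^2)) * g τ ≤ 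
      ∑' i : ℕ, ENNReal.ofReal (4 * (1/4)^i / δ) * (Metric.closedBall t' (2^i * δ)).indicator g τ := by
    intro τ
    have hex : ∃ i : ℕ, |τ - t'| ≤ 2^i * δ := by
      obtain ⟨i, hi⟩ := pow_unbounded_of_one_lt (|τ - t'| / δ) (one_lt_two)
      exact ⟨i, by rw [div_lt_iff₀ hδ] at hi; exact hi.le⟩
    classical
    set i := Nat.find hex with hi
    have hi1 : |τ - t'| ≤ 2^i * δ := Nat.find_spec hex
    refine le_trans ?_ (ENNReal.le_tsum i)
    rw [Set.indicator_of_mem (by rw [Metric.mem_closedBall, Real.dist_eq]; exact hi1)]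
    refine mul_le_mul_left (ENNReal.ofReal_le_ofReal ?_) _
    by_cases h0 : i = 0
    · rw [h0, pow_zero, mul_one]
      have : δ^2 ≤ max (δ^2) ((τ - t')^2) := le_max_left _ _
      calc δ / max (δ^2) ((τ - t')^2) ≤ δ / δ^2 := by gcongr
        _ = 1 / δ := by field_simp
        _ ≤ 4 / δ := by gcongr; norm_num
    · have h2 := Nat.find_min hex (m := i - 1) (by omega)
      push Not at h2
      have h3 : (2^i : ℝ) = 2 * 2^(i-1) := by rw [← pow_succ']; congr 1; omega
      have h4 : (2^(i-1) * δ)^2 ≤ max (δ^2) ((τ - t')^2) := by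
        refine le_trans ?_ (le_max_right _ _)
        rw [← sq_abs (τ - t')]
        gcongr
      have h5 : ((1/4:ℝ))^i = 1 / (2^i * 2^i) := by
        rw [← mul_pow, one_div_pow]; norm_num
      calc δ / max (δ^2) ((τ - t')^2) ≤ δ / (2^(i-1) * δ)^2 := by gcongr
        _ = 4 * (1/4)^i / δ := by
          rw [h5, h3]; field_simp; ring
  calc _ ≤ ∫⁻ τ, ∑' i : ℕ, ENNReal.ofReal (4 * (1/4)^i / δ) * (Metric.closedBall t' (2^i * δ)).indicator g τ := lintegral_mono hpt
    _ = ∑' i : ℕ, ENNReal.ofReal (4 * (1/4)^i / δ) * ∫⁻ τ in Metric.closedBall t' (2^i * δ), g τ := by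
        rw [lintegral_tsum]
        · congr 1; funext i
          rw [lintegral_const_mul' _ _ ENNReal.ofReal_ne_top, lintegral_indicator Metric.isClosed_closedBall.measurableSet]
        · intro i
          exact ((hg.indicator Metric.isClosed_closedBall.measurableSet).const_mul _).aemeasurable
    _ ≤ ∑' i : ℕ, ENNReal.ofReal (8 * (1/2)^i) * Mx g t := by
        apply ENNReal.tsum_le_tsum
        intro i
        have hp : (0:ℝ) < 2^i := by positivity
        have hsub : Metric.closedBall t' (2^i * δ) ⊆ Metric.closedBall t (2 * 2^i * δ) := by
          apply Metric.closedBall_subset_closedBall'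
          rw [dist_comm, Real.dist_eq]
          have : (1:ℝ) ≤ 2^i := one_le_pow₀ (by norm_num)
          nlinarith
        calc _ ≤ ENNReal.ofReal (4 * (1/4)^i / δ) * (ENNReal.ofReal (2 * 2^i * δ) * Mx g t) := by
              gcongr
              exact (lintegral_mono_set hsub).trans (le_Mx g t (by positivity))
          _ = _ := by
              rw [← mul_assoc, ← ENNReal.ofReal_mul (by positivity)]
              congr 2
              have : ((1/4:ℝ))^i = (1/2)^i * (1/2)^i := by rw [← mul_pow]; norm_num
              have h2 : ((1/2:ℝ))^i * 2^i = 1 := by rw [← mul_pow]; norm_num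
              rw [this]
              generalize ((1/2:ℝ))^i = A at *
              generalize (2:ℝ)^i = B at *
              field_simp
              linear_combination (8 * A) * h2
    _ = 16 * Mx g t := by
        rw [ENNReal.tsum_mul_right, ← ENNReal.ofReal_tsum_of_nonneg (fun i => by positivity)
          (summable_geometric_two.mul_left 8), tsum_mul_left, tsum_geometric_two]
        congr 1; norm_num
end HPTL
end

section
namespace HPTL
set_option linter.all false
set_option linter.unusedSectionVars false

/-- dyadic level -/
def lev (n : ℕ) : ℕ := Nat.log 2 n
/-- length of the n-th interval -/
def len (n : ℕ) : ℝ := ((2:ℝ) ^ lev n)⁻¹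
/-- radial part of the n-th box -/
def Rad (n : ℕ) : Set ℝ := Set.Ico (1 - len n) (1 - len n / 2)

theorem len_pos (n : ℕ) : 0 < len n := by unfold len; positivity
theorem len_le_one (n : ℕ) : len n ≤ 1 := by
  unfold len; exact inv_le_one_of_one_le₀ (one_le_pow₀ (by norm_num))

theorem dyadJ_zero : dyadJ 0 = I₀ := by simp [dyadJ]

theorem dyadJ_one : dyadJ 1 = I₀ := by
  simp [dyadJ, I₀]; norm_num

theorem two_pow_lev_le {n : ℕ} (hn : n ≠ 0) : 2 ^ lev n ≤ n := Nat.pow_log_le_self 2 hn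

theorem lt_two_pow_lev (n : ℕ) : n < 2 ^ (lev n + 1) := Nat.lt_pow_succ_log_self (by norm_num) n

theorem mem_dyadJ {n : ℕ} (hn : n ≠ 0) (t : ℝ) :
    t ∈ dyadJ n ↔ (n : ℝ) ≤ (t + 3/2) * 2 ^ lev n ∧ (t + 3/2) * 2 ^ lev n < n + 1 := by
  have h1 : ((n - 2 ^ Nat.log 2 n : ℕ) : ℝ) = (n : ℝ) - 2 ^ lev n := by
    have h := two_pow_lev_le hn
    unfold lev at h ⊢
    rw [Nat.cast_sub h]; simp
  have hp : (0:ℝ) < 2 ^ lev n := by positivity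
  unfold dyadJ
  rw [if_neg hn, h1, Set.mem_Ico]
  change _ + ((n:ℝ) - 2 ^ lev n) * (2 ^ lev n)⁻¹ ≤ t ∧ t < _ + ((n:ℝ) - 2 ^ lev n + 1) * (2 ^ lev n)⁻¹ ↔ _
  rw [← div_eq_mul_inv, ← div_eq_mul_inv]
  constructor
  · rintro ⟨h, h'⟩
    have h2 : ((n:ℝ) - 2 ^ lev n) / 2 ^ lev n ≤ t + 1/2 := by linarith
    have h3 : t + 1/2 < ((n:ℝ) - 2 ^ lev n + 1) / 2 ^ lev n := by linarith
    rw [div_le_iff₀ hp] at h2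
    rw [lt_div_iff₀ hp] at h3
    constructor <;> nlinarith
  · rintro ⟨h, h'⟩
    have h2 : ((n:ℝ) - 2 ^ lev n) / 2 ^ lev n ≤ t + 1/2 := by rw [div_le_iff₀ hp]; nlinarith
    have h3 : t + 1/2 < ((n:ℝ) - 2 ^ lev n + 1) / 2 ^ lev n := by rw [lt_div_iff₀ hp]; nlinarith
    constructor <;> linarith

theorem dyadJ_subset (n : ℕ) : dyadJ n ⊆ I₀ := by
  by_cases hn : n = 0
  · subst hn; rw [dyadJ_zero]
  intro t ht
  rw [mem_dyadJ hn] at ht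
  have hp : (0:ℝ) < 2 ^ lev n := by positivity
  have h1 : ((2:ℝ) ^ lev n) ≤ n := by exact_mod_cast two_pow_lev_le hn
  have h2 : (n : ℝ) + 1 ≤ 2 ^ lev n * 2 := by
    have := lt_two_pow_lev n
    rw [pow_succ] at this
    exact_mod_cast this
  constructor
  · by_contra hc
    push Not at hc
    nlinarith
  · by_contra hc
    push Not at hc
    nlinarith

theorem measurableSet_dyadJ (n : ℕ) : MeasurableSet (dyadJ n) := by
  unfold dyadJ I₀; split_ifs <;> exact measurableSet_Ico

theorem volume_I₀ : volume I₀ = 1 := by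
  unfold I₀; rw [Real.volume_Ico]; norm_num

theorem volume_dyadJ (n : ℕ) : volume (dyadJ n) = ENNReal.ofReal (len n) := by
  by_cases hn : n = 0
  · subst hn; rw [dyadJ_zero, volume_I₀]; simp [len, lev]
  · unfold dyadJ; rw [if_neg hn, Real.volume_Ico]
    congr 1; unfold len lev; ring

theorem abs_sub_le_len {n : ℕ} {t t' : ℝ} (ht : t ∈ dyadJ n) (ht' : t' ∈ dyadJ n) : |t - t'| ≤ len n := by
  by_cases hn : n = 0
  · subst hn; rw [dyadJ_zero] at *
    have : len 0 = 1 := by simp [len, lev]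
    rw [this, abs_le]
    unfold I₀ at *
    constructor <;> linarith [ht.1, ht.2, ht'.1, ht'.2]
  rw [mem_dyadJ hn] at *
  have hp : (0:ℝ) < 2 ^ lev n := by positivity
  unfold len
  rw [← one_div, le_div_iff₀ hp, ← abs_of_pos hp, ← abs_mul, abs_le]
  constructor <;> nlinarith

theorem lev_mono {m n : ℕ} (h : m ≤ n) : lev m ≤ lev n := Nat.log_mono_right h
theorem len_anti {m n : ℕ} (h : m ≤ n) : len n ≤ len m := by
  unfold len
  exact inv_anti₀ (by positivity) (pow_le_pow_right₀ (by norm_num) (lev_mono h))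

theorem dyadJ_nested {m n : ℕ} (hm : m ≠ 0) (hmn : m ≤ n) {t : ℝ} (h1 : t ∈ dyadJ m) (h2 : t ∈ dyadJ n) :
    dyadJ n ⊆ dyadJ m := by
  have hn : n ≠ 0 := by omega
  intro u hu
  rw [mem_dyadJ hn] at h2 hu
  rw [mem_dyadJ hm] at h1 ⊢
  obtain ⟨d, hd⟩ := Nat.exists_eq_add_of_le (lev_mono hmn)
  rw [hd, pow_add] at h2 hu
  have hpd : (0:ℝ) < 2^d := by positivity
  have ha : m * 2^d < n + 1 := by
    have : (m:ℝ) * 2^d < n + 1 := by nlinarith [h1.1, h2.2]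
    exact_mod_cast this
  have hb : n < (m+1) * 2^d := by
    have : (n:ℝ) < (m + 1) * 2^d := by nlinarith [h1.2, h2.1]
    exact_mod_cast this
  have ha' : (m:ℝ) * 2^d ≤ n := by exact_mod_cast Nat.lt_succ_iff.1 ha
  have hb' : (n:ℝ) + 1 ≤ (m+1) * 2^d := by exact_mod_cast hb
  constructor
  · by_contra hc; push Not at hc; nlinarith [hu.1]
  · by_contra hc; push Not at hc; nlinarith [hu.2]

theorem dyadJ_eq_of_lev {m n : ℕ} (hm : m ≠ 0) (hn : n ≠ 0) (hl : lev m = lev n) {t : ℝ} (h1 : t ∈ dyadJ m) (h2 : t ∈ dyadJ n) :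
    m = n := by
  rw [mem_dyadJ hn] at h2
  rw [mem_dyadJ hm, hl] at h1
  have ha : m < n + 1 := by exact_mod_cast lt_of_le_of_lt h1.1 h2.2
  have hb : n < m + 1 := by exact_mod_cast lt_of_le_of_lt h2.1 h1.2
  omega

theorem lev_eq_of_Rad {m n : ℕ} {r : ℝ} (h1 : r ∈ Rad m) (h2 : r ∈ Rad n) : lev m = lev n := by
  wlog h : lev m < lev n generalizing m n
  · rcases lt_trichotomy (lev m) (lev n) with h' | h' | h'
    · exact this h1 h2 h'
    · exact h'
    · exact (this h2 h1 h').symm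
  exfalso
  have : len n ≤ len m / 2 := by
    unfold len
    rw [div_eq_mul_inv, ← mul_inv, ← pow_succ]
    exact inv_anti₀ (by positivity) (pow_le_pow_right₀ (by norm_num) h)
  unfold Rad at *
  linarith [h1.2, h2.1]

theorem box_unique {m n : ℕ} (hm : m ≠ 0) (hn : n ≠ 0) {r t : ℝ} (h1 : r ∈ Rad m) (h2 : r ∈ Rad n)
    (h3 : t ∈ dyadJ m) (h4 : t ∈ dyadJ n) : m = n :=
  dyadJ_eq_of_lev hm hn (lev_eq_of_Rad h1 h2) h3 h4

theorem lev_two_pow_add {k j : ℕ} (hj : j < 2 ^ k) : lev (2 ^ k + j) = k := by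
  unfold lev
  rw [Nat.log_eq_iff (Or.inr ⟨by norm_num, by positivity⟩)]
  constructor
  · omega
  · rw [pow_succ]; omega

theorem exists_dyadJ (k : ℕ) {t : ℝ} (ht : t ∈ I₀) : ∃ n, n ≠ 0 ∧ lev n = k ∧ t ∈ dyadJ n := by
  unfold I₀ at ht
  have hp : (0:ℝ) < 2 ^ k := by positivity
  have h0 : 0 ≤ (t + 1/2) * 2^k := mul_nonneg (by linarith [ht.1]) hp.le
  set j := ⌊(t + 1/2) * 2^k⌋₊ with hj
  have h1 : (j:ℝ) ≤ (t+1/2) * 2^k := Nat.floor_le h0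
  have h2 : (t+1/2) * 2^k < j + 1 := Nat.lt_floor_add_one _
  have hj2 : j < 2 ^ k := by
    have : (j:ℝ) < 2^k := by nlinarith [ht.2]
    exact_mod_cast this
  have hn : 2^k + j ≠ 0 := by positivity
  refine ⟨2^k + j, hn, lev_two_pow_add hj2, ?_⟩
  rw [mem_dyadJ hn, lev_two_pow_add hj2]
  push_cast
  constructor <;> nlinarith

theorem exists_Rad {r : ℝ} (h0 : 0 ≤ r) (h1 : r < 1) : ∃ k : ℕ, ∀ n, lev n = k → r ∈ Rad n := by
  obtain ⟨k, hk1, hk2⟩ := exists_nat_pow_near_of_lt_one (x := 1 - r) (y := (1/2:ℝ)) (by linarith) (by linarith) (by norm_num) (by norm_num)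
  refine ⟨k, fun n hn => ?_⟩
  unfold Rad len
  rw [hn]
  rw [one_div, inv_pow] at hk1 hk2
  rw [pow_succ, mul_inv] at hk1
  constructor
  · linarith
  · rw [div_eq_mul_inv]; linarith

theorem exists_box {r t : ℝ} (h0 : 0 ≤ r) (h1 : r < 1) (ht : t ∈ I₀) : ∃ n, n ≠ 0 ∧ r ∈ Rad n ∧ t ∈ dyadJ n := by
  obtain ⟨k, hk⟩ := exists_Rad h0 h1
  obtain ⟨n, hn, hl, hm⟩ := exists_dyadJ k ht
  exact ⟨n, hn, hk n hl, hm⟩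

theorem Rad_bounds {n : ℕ} {r : ℝ} (h : r ∈ Rad n) : 0 ≤ r ∧ r < 1 ∧ len n < 2 * (1 - r) ∧ 1 - r ≤ len n := by
  unfold Rad at h
  have := len_pos n
  have := len_le_one n
  refine ⟨by linarith [h.1], by linarith [h.2], by linarith [h.2], by linarith [h.1]⟩

theorem ev_dist {r y : ℝ} (hr0 : 0 ≤ r) (hr1 : r ≤ 1) (hy : |y| ≤ 1/2) : max (1 - r) |y| ≤ ‖1 - r * ev y‖ := by
  apply max_le
  · have := norm_sub_norm_le (1:ℂ) (r * ev y)
    rw [norm_mul, norm_ev, mul_one, Complex.norm_real, Real.norm_eq_abs, abs_of_nonneg hr0, norm_one] at this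
    exact this
  · by_cases hr : r < 1/2
    · have := norm_sub_norm_le (1:ℂ) (r * ev y)
      rw [norm_mul, norm_ev, mul_one, Complex.norm_real, Real.norm_eq_abs, abs_of_nonneg hr0, norm_one] at this
      linarith
    · push Not at hr
      apply le_of_sq_le_sq _ (norm_nonneg _)
      have hev : ev y = ⟨Real.cos (2 * Real.pi * y), Real.sin (2 * Real.pi * y)⟩ := by
        unfold ev
        have : (2 * Real.pi * y * Complex.I : ℂ) = ((2 * Real.pi * y : ℝ) : ℂ) * Complex.I := by push_cast; ring
        rw [this]
        apply Complex.ext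
        · exact Complex.exp_ofReal_mul_I_re _
        · exact Complex.exp_ofReal_mul_I_im _
      have h1 : ‖1 - r * ev y‖^2 = (1-r)^2 + 2 * r * (1 - Real.cos (2 * Real.pi * y)) := by
        rw [← Complex.normSq_eq_norm_sq, Complex.normSq_apply, hev]
        simp
        nlinarith [Real.sin_sq_add_cos_sq (2 * Real.pi * y)]
      have h2 : 1 - Real.cos (2 * Real.pi * y) = 2 * Real.sin (Real.pi * |y|)^2 := by
        have : Real.cos (2 * Real.pi * y) = Real.cos (2 * (Real.pi * |y|)) := by
          rw [← Real.cos_abs (2 * Real.pi * y)]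
          congr 1
          rw [abs_mul, abs_of_pos (by positivity)]; ring
        rw [this, Real.cos_two_mul]
        nlinarith [Real.sin_sq_add_cos_sq (Real.pi * |y|)]
      have h3 : 2 * |y| ≤ Real.sin (Real.pi * |y|) := by
        have := Real.mul_le_sin (x := Real.pi * |y|) (by positivity) (by nlinarith [Real.pi_pos])
        calc 2 * |y| = 2 / Real.pi * (Real.pi * |y|) := by field_simp
          _ ≤ _ := this
      rw [h1, h2]
      have h4 : (2 * |y|)^2 ≤ Real.sin (Real.pi * |y|)^2 := by
        gcongr
      nlinarith [sq_nonneg (1 - r), sq_nonneg |y|, abs_nonneg y]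

theorem ev_add (x y : ℝ) : ev (x + y) = ev x * ev y := by
  unfold ev; rw [← Complex.exp_add]; congr 1; push_cast; ring

theorem ev_one_periodic (x : ℝ) : ev (x + 1) = ev x := by
  rw [ev_add]
  have : ev 1 = 1 := by unfold ev; simpa using Complex.exp_two_pi_mul_I
  rw [this, mul_one]

theorem norm_ev_sub {r t τ : ℝ} : ‖ev τ - r * ev t‖ = ‖1 - r * ev (t - τ)‖ := by
  have : ev τ - r * ev t = ev τ * (1 - r * ev (t - τ)) := by
    rw [mul_sub, mul_one, mul_left_comm, ← ev_add]; congr 3; ring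
  rw [this, norm_mul, norm_ev, one_mul]

theorem pk_le {r t τ δ : ℝ} (hr0 : 0 ≤ r) (hr1 : r < 1) (h1 : δ ≤ 2 * (1 - r)) (h2 : 1 - r ≤ δ) (hy : |τ - t| ≤ 1/2) :
    poissonKernel 0 (r * ev t) (ev τ) ≤ 8 * (δ / max (δ^2) ((τ - t)^2)) := by
  have hδ : 0 < δ := by linarith
  unfold poissonKernel
  simp only [sub_zero, norm_ev, norm_mul, mul_one, Complex.norm_real, Real.norm_eq_abs, abs_of_nonneg hr0, norm_ev_sub]
  rw [abs_sub_comm] at hy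
  have hd := ev_dist hr0 hr1.le hy
  have ha : 1 - r ≤ ‖1 - r * ev (t - τ)‖ := (le_max_left _ _).trans hd
  have hb : |t - τ| ≤ ‖1 - r * ev (t - τ)‖ := (le_max_right _ _).trans hd
  set X := ‖1 - r * ev (t - τ)‖
  have hX : 0 < X := by linarith
  have hm : max (δ^2) ((τ - t)^2) ≤ 4 * X^2 := by
    apply max_le
    · nlinarith
    · have : (τ - t)^2 = |t-τ|^2 := by rw [sq_abs]; ring
      rw [this]; nlinarith [abs_nonneg (t-τ)]
  have hmp : 0 < max (δ^2) ((τ - t)^2) := lt_max_of_lt_left (by positivity)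
  rw [mul_div_assoc', div_le_div_iff₀ (by positivity) hmp]
  have h3 : (1:ℝ)^2 - r^2 ≤ 2 * δ := by nlinarith
  have h4 : 0 ≤ (1:ℝ)^2 - r^2 := by nlinarith
  calc ((1:ℝ)^2 - r^2) * max (δ^2) ((τ - t)^2) ≤ (2 * δ) * (4 * X^2) := by gcongr
    _ = 8 * δ * X^2 := by ring

section
variable {E : Type*} [NormedAddCommGroup E] [InnerProductSpace ℂ E]

/-- sup over a box -/
def bsup (F : ℂ → E) (n : ℕ) : ℝ≥0∞ := ⨆ r ∈ Rad n, ⨆ t ∈ dyadJ n, ‖F (r * ev t)‖ₑ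
/-- dyadic nontangential maximal function -/
def NT (F : ℂ → E) (t : ℝ) : ℝ≥0∞ := ⨆ n, (dyadJ n).indicator (fun _ => bsup F n) t

theorem le_bsup (F : ℂ → E) {n : ℕ} {r t : ℝ} (hr : r ∈ Rad n) (ht : t ∈ dyadJ n) : ‖F (r * ev t)‖ₑ ≤ bsup F n :=
  le_iSup₂_of_le r hr (le_iSup₂_of_le t ht le_rfl)

theorem bsup_le_NT (F : ℂ → E) {n : ℕ} {t : ℝ} (ht : t ∈ dyadJ n) : bsup F n ≤ NT F t := by
  refine le_iSup_of_le n ?_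
  rw [Set.indicator_of_mem ht]

theorem measurable_NT (F : ℂ → E) : Measurable (NT F) := by
  unfold NT
  exact Measurable.iSup fun n => measurable_const.indicator (measurableSet_dyadJ n)

/-- truncated boundary function -/
def bdf (s : ℝ) (F : ℂ → E) (τ : ℝ) : ℝ≥0∞ :=
  (Set.Ioc (-(3/2)) (3/2:ℝ)).indicator (fun τ => ENNReal.ofReal (‖F (ev τ)‖ ^ s)) τ

theorem bsup_le_Mx {s : ℝ} (hs : 0 < s) (N : ℕ) (a : ℕ → E) {n : ℕ} {t : ℝ} (ht : t ∈ dyadJ n) :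
    (bsup (vpoly N a) n) ^ s ≤ 128 * Mx (bdf s (vpoly N a)) t := by
  have hcont : Continuous fun τ => ‖vpoly N a (ev τ)‖ ^ s :=
    (Continuous.rpow_const ((cont_vpoly N a).comp continuous_ev).norm fun _ => Or.inr hs.le)
  have hm : Measurable (bdf s (vpoly N a)) := by
    unfold bdf
    exact (hcont.measurable.ennreal_ofReal).indicator measurableSet_Ioc
  have main : ∀ r ∈ Rad n, ∀ t' ∈ dyadJ n, (‖vpoly N a (r * ev t')‖ₑ) ^ s ≤ 128 * Mx (bdf s (vpoly N a)) t := by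
    intro r hr t' ht'
    obtain ⟨hr0, hr1, hl1, hl2⟩ := Rad_bounds hr
    have hw : ‖(r * ev t' : ℂ)‖ < 1 := by
      rw [norm_mul, norm_ev, Complex.norm_real, Real.norm_eq_abs, abs_of_nonneg hr0]; linarith
    have h1 := submean hs N a hw t'
    have e1 : (‖vpoly N a (r * ev t')‖ₑ) ^ s = ENNReal.ofReal (‖vpoly N a (r * ev t')‖ ^ s) := by
      rw [← ofReal_norm_eq_enorm, ENNReal.ofReal_rpow_of_nonneg (norm_nonneg _) hs.le]
    rw [e1]
    refine (ENNReal.ofReal_le_ofReal h1).trans ?_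
    have htI := dyadJ_subset n ht'
    unfold I₀ at htI
    have hle : t' - 1/2 ≤ t' + 1/2 := by linarith
    rw [intervalIntegral.integral_of_le hle, ofReal_integral_eq_lintegral_ofReal]
    · calc ∫⁻ τ in Set.Ioc (t' - 1/2) (t' + 1/2), ENNReal.ofReal (poissonKernel 0 (r * ev t') (ev τ) * ‖vpoly N a (ev τ)‖ ^ s)
          ≤ ∫⁻ τ in Set.Ioc (t' - 1/2) (t' + 1/2), 8 * (ENNReal.ofReal (len n / max (len n ^2) ((τ - t')^2)) * bdf s (vpoly N a) τ) := by
            apply setLIntegral_mono' measurableSet_Ioc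
            intro τ hτ
            have hb : bdf s (vpoly N a) τ = ENNReal.ofReal (‖vpoly N a (ev τ)‖ ^ s) := by
              unfold bdf
              rw [Set.indicator_of_mem]
              constructor <;> linarith [hτ.1, hτ.2, htI.1, htI.2]
            rw [hb, ENNReal.ofReal_mul (pk_nonneg hw τ), ← mul_assoc]
            refine mul_le_mul_left ?_ _
            rw [show (8:ℝ≥0∞) = ENNReal.ofReal 8 by simp, ← ENNReal.ofReal_mul (by norm_num)]
            apply ENNReal.ofReal_le_ofReal
            apply pk_le hr0 hr1 hl1.le hl2
            rw [abs_le]; constructor <;> linarith [hτ.1, hτ.2]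
        _ ≤ ∫⁻ τ, 8 * (ENNReal.ofReal (len n / max (len n ^2) ((τ - t')^2)) * bdf s (vpoly N a) τ) := setLIntegral_le_lintegral _ _
        _ = 8 * ∫⁻ τ, (ENNReal.ofReal (len n / max (len n ^2) ((τ - t')^2)) * bdf s (vpoly N a) τ) := by
            rw [lintegral_const_mul' _ _ (by simp)]
        _ ≤ 8 * (16 * Mx (bdf s (vpoly N a)) t) := by
            gcongr
            exact kernel_max _ hm (len_pos n) (abs_sub_le_len ht ht')
        _ = _ := by rw [← mul_assoc]; norm_num
    · exact (((pk_cont hw).mul hcont).integrableOn_Ioc)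
    · exact Eventually.of_forall fun τ => mul_nonneg (pk_nonneg hw τ) (by positivity)
  refine (ENNReal.le_rpow_inv_iff hs).1 ?_
  unfold bsup
  refine iSup₂_le fun r hr => iSup₂_le fun t' ht' => ?_
  rw [ENNReal.le_rpow_inv_iff hs]
  exact main r hr t' ht'

end
end HPTL
end

section
namespace HPTL
set_option linter.all false
set_option linter.unusedSectionVars false

/-- the polar point -/
def pt (z : ℝ × ℝ) : ℂ := z.1 * ev z.2
/-- the boxes -/
def box (n : ℕ) : Set (ℝ × ℝ) := if n = 0 then ∅ else Rad n ×ˢ dyadJ n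
/-- full square -/
def QQ : Set (ℝ × ℝ) := Set.Ico 0 1 ×ˢ I₀

theorem continuous_pt : Continuous pt := by
  unfold pt
  exact (Complex.continuous_ofReal.comp continuous_fst).mul (continuous_ev.comp continuous_snd)

theorem measurableSet_box (n : ℕ) : MeasurableSet (box n) := by
  unfold box; split_ifs
  · exact MeasurableSet.empty
  · exact (measurableSet_Ico).prod (measurableSet_dyadJ n)

theorem box_zero : box 0 = ∅ := by simp [box]
theorem mem_box {n : ℕ} {z : ℝ × ℝ} (h : z ∈ box n) : n ≠ 0 ∧ z.1 ∈ Rad n ∧ z.2 ∈ dyadJ n := by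
  unfold box at h; split_ifs at h with h0
  · exact absurd h (Set.notMem_empty _)
  · exact ⟨h0, h.1, h.2⟩

theorem box_disj : Pairwise (Function.onFun Disjoint box) := by
  intro m n hmn
  rw [Function.onFun, Set.disjoint_left]
  intro z h1 h2
  obtain ⟨a, b, c⟩ := mem_box h1
  obtain ⟨a', b', c'⟩ := mem_box h2
  exact hmn (box_unique a a' b b' c c')

theorem box_subset (n : ℕ) : box n ⊆ QQ := by
  intro z h
  obtain ⟨a, b, c⟩ := mem_box h
  exact ⟨⟨(Rad_bounds b).1, (Rad_bounds b).2.1⟩, dyadJ_subset n c⟩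

theorem iUnion_box : (⋃ n, box n) = QQ := by
  apply Set.Subset.antisymm (Set.iUnion_subset box_subset)
  rintro z ⟨h1, h2⟩
  obtain ⟨n, hn, a, b⟩ := exists_box h1.1 h1.2 h2
  refine Set.mem_iUnion.2 ⟨n, ?_⟩
  unfold box; rw [if_neg hn]; exact ⟨a, b⟩

theorem setLIntegral_QQ {f : ℝ × ℝ → ℝ≥0∞} (hf : Measurable f) :
    ∫⁻ z in QQ, f z = ∫⁻ r in Set.Ico (0:ℝ) 1, ∫⁻ t in I₀, f (r, t) := by
  unfold QQ
  rw [Measure.volume_eq_prod, ← Measure.prod_restrict, lintegral_prod _ hf.aemeasurable]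

theorem lint_I₀ {f : ℝ → ℝ} (hf : Continuous f) (h0 : ∀ t, 0 ≤ f t) :
    ∫⁻ t in I₀, ENNReal.ofReal (f t) = ENNReal.ofReal (∫ t in (-(1/2):ℝ)..(1/2), f t) := by
  rw [intervalIntegral.integral_of_le (by norm_num), ofReal_integral_eq_lintegral_ofReal hf.integrableOn_Ioc (Eventually.of_forall h0)]
  unfold I₀
  rw [show (-(1/2):ℝ) = -1/2 by norm_num]
  exact setLIntegral_congr Ico_ae_eq_Ioc

section
variable {E : Type*} [NormedAddCommGroup E] [InnerProductSpace ℂ E]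

/-- energy of a box -/
def en (F' : ℂ → E) (n : ℕ) : ℝ≥0∞ := ∫⁻ z in box n, ENNReal.ofReal z.1 * ‖F' (pt z)‖ₑ ^ (2:ℝ)
/-- square function squared -/
def Sq (F' : ℂ → E) (t : ℝ) : ℝ≥0∞ := ∑' n, (dyadJ n).indicator (fun _ => en F' n) t

theorem NT_lt_top {F : ℂ → E} (hF : Continuous F) (t : ℝ) : NT F t < ⊤ := by
  obtain ⟨C, hC⟩ := (isCompact_closedBall (0:ℂ) 1).exists_bound_of_continuousOn hF.continuousOn
  refine lt_of_le_of_lt (b := ENNReal.ofReal C) ?_ ENNReal.ofReal_lt_top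
  refine iSup_le fun n => ?_
  refine Set.indicator_apply_le' (fun _ => ?_) (fun _ => zero_le)
  refine iSup₂_le fun r hr => iSup₂_le fun t' ht' => ?_
  rw [← ofReal_norm_eq_enorm]
  apply ENNReal.ofReal_le_ofReal
  apply hC
  obtain ⟨h0, h1, -, -⟩ := Rad_bounds hr
  rw [mem_closedBall_zero_iff, norm_mul, norm_ev, Complex.norm_real, Real.norm_eq_abs, abs_of_nonneg h0]
  linarith

theorem NT_off (F : ℂ → E) {t : ℝ} (ht : t ∉ I₀) : NT F t = 0 := by
  refine le_antisymm ?_ zero_le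
  refine iSup_le fun n => ?_
  rw [Set.indicator_of_notMem (fun h => ht (dyadJ_subset n h))]

theorem NT_strong {p : ℝ} (hp : 0 < p) (N : ℕ) (a : ℕ → E) :
    ∫⁻ t in I₀, NT (vpoly N a) t ^ p ≤ 128^2 * 160 * 3 * ∫⁻ t in I₀, ‖vpoly N a (ev t)‖ₑ ^ p := by
  set F := vpoly N a with hFdef
  have hs : 0 < p / 2 := by positivity
  have hcF : Continuous F := cont_vpoly N a
  have hcp : ∀ s : ℝ, 0 < s → Continuous fun τ => ‖F (ev τ)‖ ^ s := fun s hs =>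
    (Continuous.rpow_const (hcF.comp continuous_ev).norm fun _ => Or.inr hs.le)
  have hNT : ∀ t, NT F t ^ (p/2) ≤ 128 * Mx (bdf (p/2) F) t := by
    intro t
    refine (ENNReal.le_rpow_inv_iff hs).1 ?_
    refine iSup_le fun n => ?_
    refine Set.indicator_apply_le' (fun ht => ?_) (fun _ => zero_le)
    exact (ENNReal.le_rpow_inv_iff hs).2 (bsup_le_Mx hs N a ht)
  have hfin : ∀ t, NT F t ^ (p/2) / 128 ≠ ⊤ := fun t =>
    (ENNReal.div_lt_top (ENNReal.rpow_ne_top_of_nonneg hs.le (NT_lt_top hcF t).ne) (by norm_num)).ne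
  have hgm : Measurable (bdf (p/2) F) := by
    unfold bdf
    exact ((hcp _ hs).measurable.ennreal_ofReal).indicator measurableSet_Ioc
  have hbd : ∀ x, bdf (p/2) F x ^ (2:ℝ) = (Set.Ioc (-(3/2)) (3/2:ℝ)).indicator (fun τ => ENNReal.ofReal (‖F (ev τ)‖ ^ p)) x := by
    intro x
    unfold bdf
    by_cases hx : x ∈ Set.Ioc (-(3/2)) (3/2:ℝ)
    · rw [Set.indicator_of_mem hx, Set.indicator_of_mem hx, ENNReal.ofReal_rpow_of_nonneg (by positivity) (by norm_num),
        ← Real.rpow_mul (norm_nonneg _)]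
      congr 2; ring
    · rw [Set.indicator_of_notMem hx, Set.indicator_of_notMem hx]; simp
  have hK : ∫⁻ t in I₀, ‖F (ev t)‖ₑ ^ p = ENNReal.ofReal (∫ t in (-(1/2):ℝ)..(1/2), ‖F (ev t)‖ ^ p) := by
    rw [← lint_I₀ (hcp p hp) (fun t => by positivity)]
    congr 1; ext t
    rw [← ofReal_norm_eq_enorm, ENNReal.ofReal_rpow_of_nonneg (norm_nonneg _) hp.le]
  have hper : Function.Periodic (fun τ => ‖F (ev τ)‖ ^ p) 1 := fun x => by
    simp only [ev_one_periodic]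
  have h3 : ∫ t in (-(3/2):ℝ)..(3/2), ‖F (ev t)‖ ^ p = 3 * ∫ t in (-(1/2):ℝ)..(1/2), ‖F (ev t)‖ ^ p := by
    have e1 := hper.intervalIntegral_add_zsmul_eq 3 (-(3/2))
    have e2 := hper.intervalIntegral_add_eq (-(3/2)) (-(1/2))
    norm_num at e1 e2 ⊢
    rw [e1 (fun _ _ => (hcp p hp).intervalIntegrable _ _), e2]
  have hg2 : ∫⁻ x, bdf (p/2) F x ^ (2:ℝ) = 3 * ∫⁻ t in I₀, ‖F (ev t)‖ₑ ^ p := by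
    simp_rw [hbd]
    rw [lintegral_indicator measurableSet_Ioc, ← ofReal_integral_eq_lintegral_ofReal (hcp p hp).integrableOn_Ioc (Eventually.of_forall fun t => by positivity),
      ← intervalIntegral.integral_of_le (by norm_num), h3, hK, ENNReal.ofReal_mul (by norm_num)]
    norm_num
  have hg1 : ∫⁻ x, bdf (p/2) F x ≠ ⊤ := by
    unfold bdf
    rw [lintegral_indicator measurableSet_Ioc, ← ofReal_integral_eq_lintegral_ofReal (hcp _ hs).integrableOn_Ioc (Eventually.of_forall fun t => by positivity)]
    exact ENNReal.ofReal_ne_top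
  have hms := Mx_strong (g := bdf (p/2) F) (f := fun t => (NT F t ^ (p/2) / 128).toReal) hgm hg1
    (((measurable_NT F).pow_const _).div_const _).ennreal_toReal (fun t => ENNReal.toReal_nonneg)
    (fun t => by
      rw [ENNReal.ofReal_toReal (hfin t)]
      exact ENNReal.div_le_of_le_mul' (hNT t))
  have hpt : ∀ t, NT F t ^ p = 128^2 * ENNReal.ofReal ((NT F t ^ (p/2) / 128).toReal ^ (2:ℝ)) := by
    intro t
    rw [← ENNReal.ofReal_rpow_of_nonneg ENNReal.toReal_nonneg (by norm_num), ENNReal.ofReal_toReal (hfin t)]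
    rw [ENNReal.div_rpow_of_nonneg _ _ (by norm_num), ← ENNReal.rpow_mul]
    rw [show p/2*2 = p by ring, show (2:ℝ) = ((2:ℕ):ℝ) by norm_num, ENNReal.rpow_natCast]
    rw [ENNReal.mul_div_cancel (by norm_num) (by finiteness)]
  calc ∫⁻ t in I₀, NT F t ^ p ≤ ∫⁻ t, NT F t ^ p := setLIntegral_le_lintegral _ _
    _ = 128^2 * ∫⁻ t, ENNReal.ofReal ((NT F t ^ (p/2) / 128).toReal ^ (2:ℝ)) := by
        rw [← lintegral_const_mul' _ _ (by finiteness)]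
        congr 1; ext t; exact hpt t
    _ ≤ 128^2 * (160 * (3 * ∫⁻ t in I₀, ‖F (ev t)‖ₑ ^ p)) := by
        rw [← hg2]; gcongr
    _ = _ := by ring

theorem G_bound {F F' F'' : ℂ → E} (hF : ∀ z, HasDerivAt F (F' z) z) (hF' : ∀ z, HasDerivAt F' (F'' z) z)
    (hF'' : Continuous F'') {q : ℝ} (hq : 0 < q) (hq2 : q ≤ 2) {ε : ℝ} (hε : 0 < ε) :
    ∑' n, ENNReal.ofReal (len n) * ∫⁻ z in box n, ENNReal.ofReal (z.1 * DD F F' q ε z.1 z.2)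
      ≤ ENNReal.ofReal (2 / q^2) * ENNReal.ofReal (∫ t in (-(1/2):ℝ)..(1/2), (vv F ε 1 t) ^ (q/2)) := by
  have hcF : Continuous F := continuous_iff_continuousAt.2 fun z => (hF z).continuousAt
  have hcF' : Continuous F' := continuous_iff_continuousAt.2 fun z => (hF' z).continuousAt
  have hDD : Continuous (Function.uncurry (DD F F' q ε)) := cont_DD hF hF' q hε
  have hDD0 : ∀ r t, 0 ≤ DD F F' q ε r t := fun r t => by
    unfold DD; have := (vv_pos F hε r t).le; positivity
  have hc2 : Continuous fun z : ℝ × ℝ => 2 * (1 - z.1) * (z.1 * DD F F' q ε z.1 z.2) :=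
    (continuous_const.mul (continuous_const.sub continuous_fst)).mul (continuous_fst.mul hDD)
  have hct : Continuous fun r : ℝ => ∫ t in (-(1/2):ℝ)..(1/2), DD F F' q ε r t :=
    intervalIntegral.continuous_parametric_intervalIntegral_of_continuous' hDD _ _
  calc _ ≤ ∑' n, ∫⁻ z in box n, ENNReal.ofReal (2 * (1 - z.1) * (z.1 * DD F F' q ε z.1 z.2)) := by
        refine ENNReal.tsum_le_tsum fun n => ?_
        rw [← lintegral_const_mul' _ _ ENNReal.ofReal_ne_top]
        apply setLIntegral_mono' (measurableSet_box n)
        intro z hz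
        obtain ⟨-, h1, h2⟩ := mem_box hz
        obtain ⟨a, b, c, d⟩ := Rad_bounds h1
        rw [← ENNReal.ofReal_mul (len_pos n).le]
        apply ENNReal.ofReal_le_ofReal
        exact mul_le_mul_of_nonneg_right c.le (mul_nonneg a (hDD0 _ _))
    _ = ∫⁻ z in QQ, ENNReal.ofReal (2 * (1 - z.1) * (z.1 * DD F F' q ε z.1 z.2)) := by
        rw [← iUnion_box, lintegral_iUnion measurableSet_box box_disj]
    _ = ∫⁻ r in Set.Ico (0:ℝ) 1, ENNReal.ofReal (2 * (1 - r) * (r * ∫ t in (-(1/2):ℝ)..(1/2), DD F F' q ε r t)) := by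
        rw [setLIntegral_QQ hc2.measurable.ennreal_ofReal]
        apply setLIntegral_congr_fun measurableSet_Ico
        intro r hr
        have hcr : Continuous fun t => DD F F' q ε r t := cslice hDD r
        have h0 : 0 ≤ 2 * (1 - r) * r := mul_nonneg (by linarith [hr.2]) hr.1
        calc ∫⁻ t in I₀, ENNReal.ofReal (2 * (1 - r) * (r * DD F F' q ε r t))
            = ∫⁻ t in I₀, ENNReal.ofReal (2 * (1 - r) * r) * ENNReal.ofReal (DD F F' q ε r t) := by
              congr 1; ext t; rw [← ENNReal.ofReal_mul h0]; congr 1; ring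
          _ = ENNReal.ofReal (2 * (1 - r) * r) * ENNReal.ofReal (∫ t in (-(1/2):ℝ)..(1/2), DD F F' q ε r t) := by
              rw [lintegral_const_mul' _ _ ENNReal.ofReal_ne_top, lint_I₀ hcr (hDD0 r)]
          _ = _ := by rw [← ENNReal.ofReal_mul h0]; congr 1; ring
    _ = ENNReal.ofReal (∫ r in (0:ℝ)..1, 2 * (1 - r) * (r * ∫ t in (-(1/2):ℝ)..(1/2), DD F F' q ε r t)) := by
        have hc3 : Continuous fun r : ℝ => 2 * (1 - r) * (r * ∫ t in (-(1/2):ℝ)..(1/2), DD F F' q ε r t) :=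
          (continuous_const.mul (continuous_const.sub continuous_id)).mul (continuous_id.mul hct)
        rw [intervalIntegral.integral_of_le (by norm_num), ofReal_integral_eq_lintegral_ofReal hc3.integrableOn_Ioc]
        · exact setLIntegral_congr Ico_ae_eq_Ioc
        · rw [EventuallyLE, ae_restrict_iff' measurableSet_Ioc]
          refine Eventually.of_forall fun r hr => ?_
          have : 0 ≤ ∫ t in (-(1/2):ℝ)..(1/2), DD F F' q ε r t :=
            intervalIntegral.integral_nonneg (by norm_num) fun t _ => hDD0 r t
          exact mul_nonneg (by linarith [hr.2]) (mul_nonneg hr.1.le this)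
    _ ≤ _ := by
        rw [← ENNReal.ofReal_mul (by positivity)]
        apply ENNReal.ofReal_le_ofReal
        have hg := green hF hF' hF'' q hq hq2 hε
        have : ∫ r in (0:ℝ)..1, 2 * (1 - r) * (r * ∫ t in (-(1/2):ℝ)..(1/2), DD F F' q ε r t)
          = 2 / q^2 * ∫ r in (0:ℝ)..1, (1 - r) * (q^2 * (r * ∫ t in (-(1/2):ℝ)..(1/2), DD F F' q ε r t)) := by
          rw [← intervalIntegral.integral_const_mul]
          congr 1; ext r; field_simp
        rw [this]
        exact mul_le_mul_of_nonneg_left hg (by positivity)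

theorem A_holder {F F' F'' : ℂ → E} (hF : ∀ z, HasDerivAt F (F' z) z) (hF' : ∀ z, HasDerivAt F' (F'' z) z)
    (hF'' : Continuous F'') {p : ℝ} (hp : 0 < p) (hp1 : p ≤ 1) {ε : ℝ} (hε : 0 < ε) :
    ∫⁻ t in I₀, Sq F' t ^ (p/2) ≤
      (∫⁻ t in I₀, NT F t ^ p + ENNReal.ofReal (ε ^ (p/2))) ^ (1 - p/2) *
      (ENNReal.ofReal (2 / p^2) * ∫⁻ t in I₀, (‖F (ev t)‖ₑ ^ p + ENNReal.ofReal (ε ^ (p/2)))) ^ (p/2) := by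
  have hcF : Continuous F := continuous_iff_continuousAt.2 fun z => (hF z).continuousAt
  have hDD : Continuous (Function.uncurry (DD F F' p ε)) := cont_DD hF hF' p hε
  have hDD0 : ∀ r t, 0 ≤ DD F F' p ε r t := fun r t => by
    unfold DD; have := (vv_pos F hε r t).le; positivity
  have hp2 : 0 < p / 2 := by positivity
  have h1p : 0 ≤ 1 - p/2 := by linarith
  have haddp : ∀ a : ℝ≥0∞, (a ^ (2:ℝ) + ENNReal.ofReal ε) ^ (p/2) ≤ a ^ p + ENNReal.ofReal (ε ^ (p/2)) := by
    intro a
    refine (ENNReal.rpow_add_le_add_rpow _ _ hp2.le (by linarith)).trans ?_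
    rw [← ENNReal.rpow_mul, ENNReal.ofReal_rpow_of_pos hε, show 2 * (p/2) = p by ring]
  set G : ℝ → ℝ≥0∞ := fun t => ∑' n, (dyadJ n).indicator (fun _ => ∫⁻ z in box n, ENNReal.ofReal (z.1 * DD F F' p ε z.1 z.2)) t with hG
  have hGm : Measurable G := Measurable.ennreal_tsum fun n => measurable_const.indicator (measurableSet_dyadJ n)
  have hGi : ∫⁻ t in I₀, G t ≤ ENNReal.ofReal (2 / p^2) * ∫⁻ t in I₀, (‖F (ev t)‖ₑ ^ p + ENNReal.ofReal (ε ^ (p/2))) := by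
    rw [hG]
    rw [lintegral_tsum fun n => (measurable_const.indicator (measurableSet_dyadJ n)).aemeasurable]
    have e1 : ∀ n, ∫⁻ t in I₀, (dyadJ n).indicator (fun _ => ∫⁻ z in box n, ENNReal.ofReal (z.1 * DD F F' p ε z.1 z.2)) t
        = ENNReal.ofReal (len n) * ∫⁻ z in box n, ENNReal.ofReal (z.1 * DD F F' p ε z.1 z.2) := by
      intro n
      rw [lintegral_indicator_const (measurableSet_dyadJ n), Measure.restrict_apply (measurableSet_dyadJ n),
        Set.inter_eq_left.2 (dyadJ_subset n), volume_dyadJ, mul_comm]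
    simp_rw [e1]
    refine (G_bound hF hF' hF'' hp (by linarith) hε).trans ?_
    gcongr
    have hv : Continuous fun t => vv F ε 1 t ^ (p/2) := by
      have : Continuous fun t => vv F ε 1 t := cslice (f := vv F ε) (cont_vv hcF ε) 1
      exact this.rpow_const fun t => Or.inr hp2.le
    rw [← lint_I₀ hv (fun t => by have := (vv_pos F hε 1 t).le; positivity)]
    refine lintegral_mono fun t => ?_
    refine le_trans (le_of_eq ?_) (haddp _)
    rw [← ENNReal.ofReal_rpow_of_pos (vv_pos F hε 1 t)]
    congr 1
    unfold vv
    rw [ENNReal.ofReal_add (by positivity) hε.le, ← ofReal_norm_eq_enorm, ENNReal.ofReal_rpow_of_nonneg (norm_nonneg _) (by norm_num)]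
    simp
  have hbox : ∀ n, ∀ t ∈ dyadJ n, en F' n ≤ (NT F t ^ (2:ℝ) + ENNReal.ofReal ε) ^ (1 - p/2) *
      ∫⁻ z in box n, ENNReal.ofReal (z.1 * DD F F' p ε z.1 z.2) := by
    intro n t ht
    have hm : Measurable fun z : ℝ × ℝ => ENNReal.ofReal (z.1 * DD F F' p ε z.1 z.2) :=
      (continuous_fst.mul hDD).measurable.ennreal_ofReal
    rw [← lintegral_const_mul _ hm]
    apply setLIntegral_mono' (measurableSet_box n)
    intro z hz
    obtain ⟨-, h1, h2⟩ := mem_box hz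
    have hz0 := (Rad_bounds h1).1
    have hvp := vv_pos F hε z.1 z.2
    have e2 : ENNReal.ofReal z.1 * ‖F' (pt z)‖ₑ ^ (2:ℝ) = ENNReal.ofReal (vv F ε z.1 z.2) ^ (1 - p/2) * ENNReal.ofReal (z.1 * DD F F' p ε z.1 z.2) := by
      rw [ENNReal.ofReal_rpow_of_pos hvp, ← ENNReal.ofReal_mul (by positivity), ← ofReal_norm_eq_enorm,
        ENNReal.ofReal_rpow_of_nonneg (norm_nonneg _) (by norm_num), ← ENNReal.ofReal_mul hz0]
      congr 1
      unfold DD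
      have : vv F ε z.1 z.2 ^ (1 - p/2) * vv F ε z.1 z.2 ^ (p/2 - 1) = 1 := by
        rw [← Real.rpow_add hvp]; simp
      unfold pt
      rw [Real.rpow_two]
      linear_combination (-z.1 * ‖F' (z.1 * ev z.2)‖^2) * this
    rw [e2]
    refine mul_le_mul_left (ENNReal.rpow_le_rpow ?_ h1p) _
    unfold vv
    rw [ENNReal.ofReal_add (by positivity) hε.le]
    gcongr
    have : ENNReal.ofReal (‖F (z.1 * ev z.2)‖ ^ 2) = ‖F (z.1 * ev z.2)‖ₑ ^ (2:ℝ) := by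
      rw [← ofReal_norm_eq_enorm, ENNReal.ofReal_rpow_of_nonneg (norm_nonneg _) (by norm_num)]; simp
    rw [this]
    exact ENNReal.rpow_le_rpow ((le_bsup F h1 h2).trans (bsup_le_NT F ht)) (by norm_num)
  have hSG : ∀ t, Sq F' t ≤ (NT F t ^ (2:ℝ) + ENNReal.ofReal ε) ^ (1 - p/2) * G t := by
    intro t
    rw [hG]
    simp only
    rw [← ENNReal.tsum_mul_left]
    refine ENNReal.tsum_le_tsum fun n => ?_
    by_cases ht : t ∈ dyadJ n
    · rw [Set.indicator_of_mem ht, Set.indicator_of_mem ht]; exact hbox n t ht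
    · rw [Set.indicator_of_notMem ht, Set.indicator_of_notMem ht]; simp
  have hNm : Measurable fun t => (NT F t ^ (2:ℝ) + ENNReal.ofReal ε) ^ (p/2) :=
    (((measurable_NT F).pow_const _).add_const _).pow_const _
  calc ∫⁻ t in I₀, Sq F' t ^ (p/2) ≤ ∫⁻ t in I₀, ((NT F t ^ (2:ℝ) + ENNReal.ofReal ε) ^ (p/2)) ^ (1 - p/2) * G t ^ (p/2) := by
        refine lintegral_mono fun t => ?_
        refine (ENNReal.rpow_le_rpow (hSG t) hp2.le).trans (le_of_eq ?_)
        rw [ENNReal.mul_rpow_of_nonneg _ _ hp2.le, ← ENNReal.rpow_mul, ← ENNReal.rpow_mul, mul_comm (p/2)]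
    _ ≤ (∫⁻ t in I₀, (NT F t ^ (2:ℝ) + ENNReal.ofReal ε) ^ (p/2)) ^ (1 - p/2) * (∫⁻ t in I₀, G t) ^ (p/2) :=
        ENNReal.lintegral_mul_norm_pow_le hNm.aemeasurable hGm.aemeasurable h1p hp2.le (by ring)
    _ ≤ _ := by
        refine mul_le_mul' (ENNReal.rpow_le_rpow (lintegral_mono fun t => haddp _) h1p) (ENNReal.rpow_le_rpow hGi hp2.le)

/-- the constant of the polynomial estimate -/
def CA (p : ℝ) : ℝ≥0∞ := 128^2 * 160 * 3 + ENNReal.ofReal (2 / p^2) + 1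

theorem CA_ne_top (p : ℝ) : CA p ≠ ⊤ := by unfold CA; finiteness

theorem A_poly {p : ℝ} (hp : 0 < p) (hp1 : p ≤ 1) (N : ℕ) (a : ℕ → E) :
    ∫⁻ t in I₀, (‖vpoly N a 0‖ₑ ^ (2:ℝ) + Sq (deriv (vpoly N a)) t) ^ (p/2) ≤ (2 * CA p) * ∫⁻ t in I₀, ‖vpoly N a (ev t)‖ₑ ^ p := by
  set F := vpoly N a with hFdef
  have hcd : ContDiff ℂ ⊤ F := by
    rw [hFdef]; unfold vpoly
    exact ContDiff.sum fun j _ => (contDiff_id.pow j).smul contDiff_const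
  have hd : Differentiable ℂ F := hcd.differentiable (by simp)
  have hcd' : ContDiff ℂ ⊤ (deriv F) := ((contDiff_succ_iff_deriv (n := ⊤)).1 hcd).2.2
  have hd' : Differentiable ℂ (deriv F) := hcd'.differentiable (by simp)
  have hcd'' : ContDiff ℂ ⊤ (deriv (deriv F)) := ((contDiff_succ_iff_deriv (n := ⊤)).1 hcd').2.2
  set W := ∫⁻ t in I₀, ‖F (ev t)‖ₑ ^ p with hW
  have hp2 : 0 < p / 2 := by positivity
  have h1p : 0 ≤ 1 - p/2 := by linarith
  have hN := NT_strong hp N a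
  rw [← hFdef] at hN
  have hvol : ∀ c : ℝ≥0∞, ∫⁻ t in I₀, c = c := fun c => by rw [setLIntegral_const, volume_I₀, mul_one]
  have h1 : ∀ δ : ℝ, 0 < δ → ∫⁻ t in I₀, Sq (deriv F) t ^ (p/2) ≤ CA p * (W + ENNReal.ofReal δ) := by
    intro δ hδ
    have hε : 0 < δ ^ (2/p) := by positivity
    have := A_holder (fun z => (hd z).hasDerivAt) (fun z => (hd' z).hasDerivAt) hcd''.continuous hp hp1 hε
    have e : (δ ^ (2/p)) ^ (p/2) = δ := by
      rw [← Real.rpow_mul hδ.le]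
      rw [show 2/p*(p/2) = 1 by field_simp, Real.rpow_one]
    rw [e] at this
    rw [lintegral_add_right _ measurable_const, lintegral_add_right _ measurable_const, hvol] at this
    refine this.trans ?_
    calc _ ≤ (CA p * (W + ENNReal.ofReal δ)) ^ (1 - p/2) * (CA p * (W + ENNReal.ofReal δ)) ^ (p/2) := by
          refine mul_le_mul' (ENNReal.rpow_le_rpow ?_ h1p) (ENNReal.rpow_le_rpow ?_ hp2.le)
          · rw [mul_add]
            refine add_le_add (hN.trans ?_) ?_
            · refine mul_le_mul_left ?_ _
              unfold CA; rw [add_assoc]; exact le_self_add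
            · refine le_mul_of_one_le_left zero_le ?_
              unfold CA; exact le_add_self
          · refine mul_le_mul_left ?_ _
            unfold CA
            rw [add_right_comm]; exact le_add_self
      _ = _ := by
          rw [← ENNReal.rpow_add_of_nonneg _ _ h1p hp2.le]; simp
  have h2 : ∫⁻ t in I₀, Sq (deriv F) t ^ (p/2) ≤ CA p * W := by
    have ht : Tendsto (fun δ : ℝ => CA p * (W + ENNReal.ofReal δ)) (𝓝[>] 0) (𝓝 (CA p * (W + 0))) := by
      apply ENNReal.Tendsto.const_mul _ (Or.inr (CA_ne_top p))
      apply Tendsto.add tendsto_const_nhds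
      have : Tendsto ENNReal.ofReal (𝓝 0) (𝓝 (ENNReal.ofReal 0)) := (ENNReal.continuous_ofReal.tendsto 0)
      rw [ENNReal.ofReal_zero] at this
      exact this.mono_left nhdsWithin_le_nhds
    rw [add_zero] at ht
    exact ge_of_tendsto ht (eventually_nhdsWithin_of_forall fun δ hδ => h1 δ hδ)
  have hm : Measurable fun t => Sq (deriv F) t ^ (p/2) := by
    refine Measurable.pow_const ?_ _
    exact Measurable.ennreal_tsum fun n => measurable_const.indicator (measurableSet_dyadJ n)
  calc ∫⁻ t in I₀, (‖F 0‖ₑ ^ (2:ℝ) + Sq (deriv F) t) ^ (p/2)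
      ≤ ∫⁻ t in I₀, (NT F t ^ p + Sq (deriv F) t ^ (p/2)) := by
        apply setLIntegral_mono' measurableSet_Ico
        intro t ht
        refine (ENNReal.rpow_add_le_add_rpow _ _ hp2.le (by linarith)).trans ?_
        refine add_le_add ?_ le_rfl
        rw [← ENNReal.rpow_mul, show 2 * (p/2) = p by ring]
        refine ENNReal.rpow_le_rpow ?_ hp.le
        have h1 : t ∈ dyadJ 1 := by rw [dyadJ_one]; exact ht
        have h2 : (0:ℝ) ∈ Rad 1 := by unfold Rad len lev; simp; norm_num
        have := le_bsup F h2 h1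
        simp only [Complex.ofReal_zero, zero_mul] at this
        exact this.trans (bsup_le_NT F h1)
    _ = (∫⁻ t in I₀, NT F t ^ p) + ∫⁻ t in I₀, Sq (deriv F) t ^ (p/2) := lintegral_add_right _ hm
    _ ≤ CA p * W + CA p * W := by
        refine add_le_add (hN.trans (mul_le_mul_left ?_ _)) h2
        unfold CA; rw [add_assoc]; exact le_self_add
    _ = _ := by ring

end
end HPTL
end

section
namespace HPTL
set_option linter.all false
set_option linter.unusedSectionVars false

/-- density associated with a sequence of nonnegative numbers -/
def dens (e : ℕ → ℝ≥0∞) (t : ℝ) : ℝ≥0∞ := ∑' n, (dyadJ n).indicator (fun _ => e n) t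

theorem measurable_dens (e : ℕ → ℝ≥0∞) : Measurable (dens e) :=
  Measurable.ennreal_tsum fun n => measurable_const.indicator (measurableSet_dyadJ n)

theorem dens_liminf {e : ℕ → ℝ≥0∞} {e' : ℕ → ℕ → ℝ≥0∞} (h : ∀ n, e n ≤ liminf (fun N => e' N n) atTop) (t : ℝ) :
    dens e t ≤ liminf (fun N => dens (e' N) t) atTop := by
  unfold dens
  simp_rw [← lintegral_count]
  refine le_trans (lintegral_mono fun n => ?_) (lintegral_liminf_le fun N => measurable_of_countable _)
  by_cases ht : t ∈ dyadJ n
  · simp only [Set.indicator_of_mem ht]; exact h n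
  · simp only [Set.indicator_of_notMem ht]; exact zero_le

theorem lint_dens_liminf {e : ℕ → ℝ≥0∞} {e' : ℕ → ℕ → ℝ≥0∞} (h : ∀ n, e n ≤ liminf (fun N => e' N n) atTop) {s : ℝ} (hs : 0 < s) :
    ∫⁻ t in I₀, dens e t ^ s ≤ liminf (fun N => ∫⁻ t in I₀, dens (e' N) t ^ s) atTop := by
  refine le_trans (lintegral_mono fun t => ?_) (lintegral_liminf_le fun N => (measurable_dens _).pow_const _)
  refine (ENNReal.rpow_le_rpow (dens_liminf h t) hs.le).trans (le_of_eq ?_)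
  have := OrderIso.liminf_apply (f := atTop) (u := fun N => dens (e' N) t) (ENNReal.orderIsoRpow s hs) (by isBoundedDefault) (by isBoundedDefault) (by isBoundedDefault) (by isBoundedDefault)
  simpa using this

section
variable {E : Type*} [NormedAddCommGroup E] [InnerProductSpace ℂ E]

/-- the energies of the pair (value at zero, derivative) -/
def eA (c : E) (F' : ℂ → E) (n : ℕ) : ℝ≥0∞ := if n = 0 then ‖c‖ₑ ^ (2:ℝ) else en F' n

theorem en_zero (F' : ℂ → E) : en F' 0 = 0 := by unfold en; rw [box_zero]; simp

theorem dens_eA (c : E) (F' : ℂ → E) {t : ℝ} (ht : t ∈ I₀) : dens (eA c F') t = ‖c‖ₑ ^ (2:ℝ) + Sq F' t := by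
  unfold dens Sq
  rw [tsum_eq_zero_add' (f := fun n => (dyadJ n).indicator (fun _ => eA c F' n) t) ENNReal.summable, tsum_eq_zero_add' (f := fun n => (dyadJ n).indicator (fun _ => en F' n) t) ENNReal.summable]
  rw [dyadJ_zero, Set.indicator_of_mem ht, Set.indicator_of_mem ht, en_zero, zero_add]
  simp [eA]

theorem pt_mem {z : ℝ × ℝ} (hz : z ∈ QQ) : pt z ∈ Metric.ball (0:ℂ) 1 := by
  rw [mem_ball_zero_iff]; unfold pt
  rw [norm_mul, norm_ev, Complex.norm_real, Real.norm_eq_abs, abs_of_nonneg hz.1.1, mul_one]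
  exact hz.1.2

theorem eA_liminf {c : E} {F' : ℂ → E} {c' : ℕ → E} {H' : ℕ → ℂ → E} (hc : Tendsto c' atTop (𝓝 c))
    (hH : ∀ z ∈ Metric.ball (0:ℂ) 1, Tendsto (fun N => H' N z) atTop (𝓝 (F' z)))
    (hcont : ∀ N, ContinuousOn (H' N) (Metric.ball 0 1)) (n : ℕ) :
    eA c F' n ≤ liminf (fun N => eA (c' N) (H' N) n) atTop := by
  unfold eA
  split_ifs with hn
  · apply le_of_eq
    symm
    apply Tendsto.liminf_eq
    exact (ENNReal.continuous_rpow_const.tendsto _).comp ((continuous_enorm.tendsto _).comp hc)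
  · unfold en
    refine le_trans (lintegral_mono_ae ?_) (lintegral_liminf_le' fun N => ?_)
    · rw [ae_restrict_iff' (measurableSet_box n)]
      refine Eventually.of_forall fun z hz => le_of_eq (Eq.symm (Tendsto.liminf_eq ?_))
      apply ENNReal.Tendsto.const_mul _ (Or.inr ENNReal.ofReal_ne_top)
      exact (ENNReal.continuous_rpow_const.tendsto _).comp ((continuous_enorm.tendsto _).comp (hH _ (pt_mem (box_subset n hz))))
    · apply AEMeasurable.mul
      · exact (measurable_fst.ennreal_ofReal).aemeasurable
      · apply AEMeasurable.pow_const
        have : ContinuousOn (fun z => ‖H' N (pt z)‖) (box n) :=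
          ((hcont N).comp continuous_pt.continuousOn fun z hz => pt_mem (box_subset n hz)).norm
        have := (this.aemeasurable (measurableSet_box n) (μ := volume)).ennreal_ofReal
        simpa only [ofReal_norm_eq_enorm] using this

end

section
variable {E : Type*} [NormedAddCommGroup E] [InnerProductSpace ℂ E] [CompleteSpace E]

/-- Taylor coefficient -/
def tc (F : ℂ → E) (j : ℕ) : E := ((j.factorial : ℂ)⁻¹) • iteratedDeriv j F 0

theorem tc_hasSum {F : ℂ → E} (hF : DifferentiableOn ℂ F (Metric.ball 0 1)) {z : ℂ} (hz : z ∈ Metric.ball (0:ℂ) 1) :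
    HasSum (fun j => z ^ j • tc F j) (F z) := by
  have := Complex.hasSum_taylorSeries_on_ball hF hz
  simp only [sub_zero] at this
  convert this using 2 with j
  unfold tc; rw [smul_comm]

theorem tc_zero (F : ℂ → E) : tc F 0 = F 0 := by simp [tc]

theorem tc_deriv (F : ℂ → E) (j : ℕ) : tc (deriv F) j = ((j:ℂ) + 1) • tc F (j+1) := by
  unfold tc
  rw [← iteratedDeriv_succ', smul_smul, Nat.factorial_succ]
  congr 1
  have : ((j:ℂ)+1) ≠ 0 := Nat.cast_add_one_ne_zero j
  have : ((j.factorial:ℕ):ℂ) ≠ 0 := by exact_mod_cast j.factorial_ne_zero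
  push_cast
  field_simp

theorem tc_summable {F : ℂ → E} (hF : DifferentiableOn ℂ F (Metric.ball 0 1)) {r : ℝ} (hr0 : 0 ≤ r) (hr : r < 1) :
    Summable fun j => r ^ j * ‖tc F j‖ := by
  set r' := (1 + r) / 2 with hr'
  have h0 : 0 < r' := by rw [hr']; linarith
  have h1 : r' < 1 := by rw [hr']; linarith
  have hrr : r < r' := by rw [hr']; linarith
  have hz : (r' : ℂ) ∈ Metric.ball (0:ℂ) 1 := by
    rw [mem_ball_zero_iff, Complex.norm_real, Real.norm_eq_abs, abs_of_pos h0]; exact h1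
  have hs := (tc_hasSum hF hz).summable.tendsto_atTop_zero
  obtain ⟨C, hC⟩ := (hs.norm.bddAbove_range)
  have hg : Summable fun j : ℕ => C * (r / r') ^ j :=
    (summable_geometric_of_lt_one (by positivity) ((div_lt_one h0).2 hrr)).mul_left C
  refine Summable.of_nonneg_of_le (fun j => by positivity) (fun j => ?_) hg
  have := hC ⟨j, rfl⟩
  simp only [norm_smul, norm_pow, Complex.norm_real, Real.norm_eq_abs, abs_of_pos h0] at this
  calc r ^ j * ‖tc F j‖ = (r' ^ j * ‖tc F j‖) * (r / r') ^ j := by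
        have : r ^ j = r' ^ j * (r / r') ^ j := by rw [← mul_pow, mul_div_cancel₀ _ h0.ne']
        rw [this]; ring
    _ ≤ _ := mul_le_mul_of_nonneg_right this (by positivity)

theorem diff_deriv {F : ℂ → E} (hF : DifferentiableOn ℂ F (Metric.ball 0 1)) : DifferentiableOn ℂ (deriv F) (Metric.ball 0 1) :=
  hF.deriv Metric.isOpen_ball

theorem deriv_vpoly (N : ℕ) (a : ℕ → E) (z : ℂ) :
    deriv (vpoly (N+1) a) z = ∑ j ∈ Finset.range N, z ^ j • (((j:ℂ) + 1) • a (j+1)) := by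
  have : HasDerivAt (vpoly (N+1) a) (∑ j ∈ Finset.range (N+1), ((j:ℂ) * z ^ (j-1)) • a j) z := by
    unfold vpoly
    apply HasDerivAt.fun_sum
    intro j _
    exact (hasDerivAt_pow j z).smul_const (a j)
  rw [this.deriv, Finset.sum_range_succ']
  simp [smul_smul, mul_comm]

theorem A_general {p : ℝ} (hp : 0 < p) (hp1 : p ≤ 1) {F : ℂ → E} (hF : DifferentiableOn ℂ F (Metric.ball 0 1))
    {K : ℝ≥0∞} (hK : ∀ r : ℝ, 0 ≤ r → r < 1 → ∫⁻ t in I₀, ‖F (r * ev t)‖ₑ ^ p ≤ K) :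
    ∫⁻ t in I₀, dens (eA (F 0) (deriv F)) t ^ (p/2) ≤ 2 * CA p * K := by
  have hp2 : 0 < p / 2 := by positivity
  -- stage 1
  have st1 : ∀ R : ℝ, 0 ≤ R → R < 1 → ∫⁻ t in I₀, dens (eA (F 0) (fun z => (R:ℂ) • deriv F (R * z))) t ^ (p/2) ≤ 2 * CA p * K := by
    intro R hR0 hR1
    set b : ℕ → E := fun j => (R:ℂ) ^ j • tc F j with hb
    have hball : ∀ z : ℂ, ‖z‖ ≤ 1 → (R:ℂ) * z ∈ Metric.ball (0:ℂ) 1 := by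
      intro z hz
      rw [mem_ball_zero_iff, norm_mul, Complex.norm_real, Real.norm_eq_abs, abs_of_nonneg hR0]
      nlinarith [norm_nonneg z]
    have hv : ∀ N z, vpoly N b z = ∑ j ∈ Finset.range N, ((R:ℂ) * z) ^ j • tc F j := by
      intro N z
      unfold vpoly
      refine Finset.sum_congr rfl fun j _ => ?_
      rw [hb]; simp only
      rw [smul_smul, mul_pow, mul_comm]
    refine (lint_dens_liminf (e' := fun N => eA (vpoly (N+1) b 0) (deriv (vpoly (N+1) b))) ?_ hp2).trans ?_
    · intro n
      apply eA_liminf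
      · have : ∀ N, vpoly (N+1) b 0 = F 0 := by
          intro N
          rw [hv, Finset.sum_range_succ']; simp [tc_zero]
        simp_rw [this]; exact tendsto_const_nhds
      · intro z hz
        have h1 := (tc_hasSum (diff_deriv hF) (hball z (mem_ball_zero_iff.1 hz).le)).tendsto_sum_nat.const_smul (R:ℂ)
        refine h1.congr fun N => ?_
        rw [deriv_vpoly, Finset.smul_sum]
        refine Finset.sum_congr rfl fun j _ => ?_
        rw [hb, tc_deriv]
        simp only [smul_smul]
        congr 1
        rw [mul_pow]; ring
      · intro N
        have : (deriv (vpoly (N+1) b)) = fun z => ∑ j ∈ Finset.range N, z ^ j • (((j:ℂ) + 1) • b (j+1)) := by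
          ext z; exact deriv_vpoly N b z
        rw [this]
        exact (continuous_finset_sum _ fun j _ => (continuous_pow j).smul continuous_const).continuousOn
    · have hlim : Tendsto (fun N => ∫⁻ t in I₀, ‖vpoly (N+1) b (ev t)‖ₑ ^ p) atTop (𝓝 (∫⁻ t in I₀, ‖F (R * ev t)‖ₑ ^ p)) := by
        set C := ∑' j, R ^ j * ‖tc F j‖
        have hsum := tc_summable hF hR0 hR1
        refine tendsto_lintegral_of_dominated_convergence' (fun _ => ENNReal.ofReal C ^ p) (fun N => ?_) (fun N => ?_) ?_ ?_
        · have : Continuous fun t => ‖vpoly (N+1) b (ev t)‖ₑ ^ p :=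
            ENNReal.continuous_rpow_const.comp (continuous_enorm.comp ((cont_vpoly _ _).comp continuous_ev))
          exact this.measurable.aemeasurable
        · refine Eventually.of_forall fun t => ?_
          refine ENNReal.rpow_le_rpow ?_ hp.le
          rw [← ofReal_norm_eq_enorm]
          apply ENNReal.ofReal_le_ofReal
          rw [hv]
          refine (norm_sum_le _ _).trans ?_
          refine le_trans (le_of_eq ?_) (hsum.sum_le_tsum (Finset.range (N+1)) fun j _ => by positivity)
          refine Finset.sum_congr rfl fun j _ => ?_
          rw [norm_smul, norm_pow, norm_mul, norm_ev, mul_one, Complex.norm_real, Real.norm_eq_abs, abs_of_nonneg hR0]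
        · rw [setLIntegral_const, volume_I₀, mul_one]
          exact ENNReal.rpow_ne_top_of_nonneg hp.le ENNReal.ofReal_ne_top
        · refine Eventually.of_forall fun t => ?_
          refine (ENNReal.continuous_rpow_const.tendsto _).comp ((continuous_enorm.tendsto _).comp ?_)
          have := (tc_hasSum hF (hball (ev t) (norm_ev t).le)).tendsto_sum_nat
          refine ((tendsto_add_atTop_iff_nat 1).2 this).congr fun N => ?_
          rw [hv]
      have hbd : ∀ N, ∫⁻ t in I₀, dens (eA (vpoly (N+1) b 0) (deriv (vpoly (N+1) b))) t ^ (p/2)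
          ≤ 2 * CA p * ∫⁻ t in I₀, ‖vpoly (N+1) b (ev t)‖ₑ ^ p := by
        intro N
        refine le_trans (le_of_eq ?_) (A_poly hp hp1 (N+1) b)
        apply setLIntegral_congr_fun measurableSet_Ico
        intro t ht
        simp only
        rw [dens_eA _ _ ht]
      refine (liminf_le_liminf (Eventually.of_forall hbd)).trans ?_
      have h2 := ENNReal.Tendsto.const_mul (a := 2 * CA p) hlim (Or.inr (ENNReal.mul_ne_top (by norm_num) (CA_ne_top p)))
      rw [h2.liminf_eq]
      exact mul_le_mul_right (hK R hR0 hR1) _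
  -- stage 2
  set R : ℕ → ℝ := fun m => 1 - 1 / ((m:ℝ) + 1) with hR
  have hRt : Tendsto R atTop (𝓝 1) := by
    have := (tendsto_const_nhds (x := (1:ℝ))).sub (tendsto_one_div_add_atTop_nhds_zero_nat (𝕜 := ℝ))
    rw [sub_zero] at this
    exact this
  have hR0 : ∀ m, 0 ≤ R m := fun m => by
    rw [hR]; simp only [sub_nonneg]; rw [div_le_one (by positivity)]; linarith [(Nat.cast_nonneg m : (0:ℝ) ≤ m)]
  have hR1 : ∀ m, R m < 1 := fun m => by
    rw [hR]; simp only; linarith [show (0:ℝ) < 1 / ((m:ℝ)+1) by positivity]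
  have hcd := (diff_deriv hF).continuousOn
  have hmap : ∀ m, ∀ z ∈ Metric.ball (0:ℂ) 1, (R m : ℂ) * z ∈ Metric.ball (0:ℂ) 1 := by
    intro m z hz
    rw [mem_ball_zero_iff] at hz ⊢
    rw [norm_mul, Complex.norm_real, Real.norm_eq_abs, abs_of_nonneg (hR0 m)]
    nlinarith [norm_nonneg z, hR1 m, hR0 m]
  refine (lint_dens_liminf (e' := fun m => eA (F 0) (fun z => (R m:ℂ) • deriv F (R m * z))) ?_ hp2).trans ?_
  · intro n
    apply eA_liminf tendsto_const_nhds
    · intro z hz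
      have hRc : Tendsto (fun m => (R m : ℂ)) atTop (𝓝 1) := by
        have := (Complex.continuous_ofReal.tendsto 1).comp hRt
        rw [Complex.ofReal_one] at this
        exact this
      have h1 : Tendsto (fun m => (R m : ℂ) * z) atTop (𝓝 z) := by
        simpa using hRc.mul_const z
      have h2 := ((hcd.continuousAt (Metric.isOpen_ball.mem_nhds hz)).tendsto).comp h1
      simpa using hRc.smul h2
    · intro m
      exact (hcd.comp (continuous_const.mul continuous_id).continuousOn (hmap m)).const_smul _
  · refine liminf_le_of_frequently_le' (Frequently.of_forall fun m => st1 (R m) (hR0 m) (hR1 m))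

end
end HPTL
end

section
namespace HPTL
set_option linter.all false
set_option linter.unusedSectionVars false

theorem beta_int (M : ℕ) : ∀ j : ℕ, ∫ r in (0:ℝ)..1, 2 * r ^ (2*j+1) * (1 - r^2) ^ M = (j.factorial * M.factorial : ℝ) / ((j + M + 1).factorial : ℝ) := by
  induction M with
  | zero =>
    intro j
    simp only [pow_zero, mul_one, Nat.factorial_zero, Nat.cast_one, add_zero]
    rw [intervalIntegral.integral_const_mul, integral_pow, Nat.factorial_succ]
    have : (j.factorial : ℝ) ≠ 0 := by exact_mod_cast j.factorial_ne_zero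
    have : ((j:ℝ)+1) ≠ 0 := by positivity
    push_cast
    field_simp
    simp
    ring
  | succ M ih =>
    intro j
    have h1 := ih (j+1)
    have hd : ∀ r ∈ Set.uIcc (0:ℝ) 1, HasDerivAt (fun r : ℝ => r ^ (2*j+2) * (1 - r^2)^(M+1) / (j+1))
        (2 * r ^ (2*j+1) * (1 - r^2) ^ (M+1) - (M+1)/(j+1) * (2 * r ^ (2*(j+1)+1) * (1 - r^2) ^ M)) r := by
      intro r _
      have ha := hasDerivAt_pow (2*j+2) r
      have hb : HasDerivAt (fun r : ℝ => (1 - r^2)) (-(2*r)) r := by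
        simpa using (hasDerivAt_pow 2 r).const_sub 1
      have := (ha.mul (hb.pow (M+1))).div_const ((j:ℝ)+1)
      refine this.congr_deriv ?_
      simp only [Pi.pow_apply, Nat.add_sub_cancel]
      push_cast
      have : ((j:ℝ)+1) ≠ 0 := by positivity
      field_simp
      ring
    have hi := intervalIntegral.integral_eq_sub_of_hasDerivAt hd (by apply Continuous.intervalIntegrable; fun_prop)
    rw [intervalIntegral.integral_sub (by apply Continuous.intervalIntegrable; fun_prop) (by apply Continuous.intervalIntegrable; fun_prop),
      intervalIntegral.integral_const_mul, h1] at hi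
    norm_num at hi
    have hi' := sub_eq_zero.1 hi
    rw [hi']
    rw [show j + 1 + M + 1 = j + (M+1) + 1 by ring, Nat.factorial_succ j, Nat.factorial_succ M]
    have : ((j:ℝ)+1) ≠ 0 := by positivity
    have : ((j + (M+1) + 1).factorial : ℝ) ≠ 0 := by positivity
    push_cast
    field_simp

/-- binomial coefficient of the kernel -/
def Cj (M j : ℕ) : ℝ := ((j+1+M).choose M : ℕ)

theorem Cj_nonneg (M j : ℕ) : 0 ≤ Cj M j := by unfold Cj; positivity

/-- the constant of the L2 lemma -/
def CL (M : ℕ) : ℝ := 8 * ((M:ℝ)+2)^(2*M) * (2*M-1).factorial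

theorem CL_pos (M : ℕ) : 0 < CL M := by unfold CL; positivity

theorem cb {M : ℕ} (hM : 1 ≤ M) (j : ℕ) : Cj M j ^ 2 * (8 * ∫ r in (0:ℝ)..1, (1 - r^2)^(2*M-1) * r^(2*j)) ≤ CL M := by
  have hf1 : (1:ℝ) ≤ (2*M-1).factorial := by exact_mod_cast Nat.factorial_pos _
  have hsq : ∀ r ∈ Set.Icc (0:ℝ) 1, 0 ≤ 1 - r^2 ∧ 1 - r^2 ≤ 1 := fun r hr => ⟨by nlinarith [hr.1, hr.2], by nlinarith [hr.1]⟩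
  rcases Nat.eq_zero_or_pos j with rfl | hj
  · have h1 : ∫ r in (0:ℝ)..1, (1 - r^2)^(2*M-1) * r^(2*0) ≤ ∫ r in (0:ℝ)..1, (1:ℝ) := by
      apply intervalIntegral.integral_mono_on (by norm_num) (by apply Continuous.intervalIntegrable; fun_prop) (by simp)
      intro r hr
      simp only [mul_zero, pow_zero, mul_one]
      exact pow_le_one₀ (hsq r hr).1 (hsq r hr).2
    simp only [integral_one, sub_zero] at h1
    have h2 : Cj M 0 = M + 1 := by unfold Cj; rw [zero_add, add_comm]; simp
    rw [h2]
    have h3 : ((M:ℝ)+1)^2 ≤ ((M:ℝ)+2)^(2*M) := by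
      calc ((M:ℝ)+1)^2 ≤ ((M:ℝ)+2)^2 := by gcongr; linarith
        _ ≤ _ := pow_le_pow_right₀ (by linarith [(Nat.cast_nonneg M : (0:ℝ) ≤ M)]) (by omega)
    unfold CL
    calc ((M:ℝ)+1)^2 * (8 * _) ≤ ((M:ℝ)+2)^(2*M) * (8 * 1) := by
          refine mul_le_mul h3 (by linarith) (mul_nonneg (by norm_num) (intervalIntegral.integral_nonneg (by norm_num) fun r hr => mul_nonneg (pow_nonneg (hsq r hr).1 _) (pow_nonneg hr.1 _))) (by positivity)
      _ = 8 * ((M:ℝ)+2)^(2*M) * 1 := by ring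
      _ ≤ _ := by gcongr
  · obtain ⟨i, rfl⟩ : ∃ i, j = i + 1 := ⟨j - 1, by omega⟩
    have h1 : ∫ r in (0:ℝ)..1, (1 - r^2)^(2*M-1) * r^(2*(i+1)) ≤ ∫ r in (0:ℝ)..1, 2 * r^(2*i+1) * (1 - r^2)^(2*M-1) := by
      apply intervalIntegral.integral_mono_on (by norm_num) (by apply Continuous.intervalIntegrable; fun_prop) (by apply Continuous.intervalIntegrable; fun_prop)
      intro r hr
      rw [mul_comm]
      refine mul_le_mul_of_nonneg_right ?_ (pow_nonneg (hsq r hr).1 _)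
      have : r^(2*(i+1)) ≤ r^(2*i+1) := pow_le_pow_of_le_one hr.1 hr.2 (by omega)
      have : 0 ≤ r^(2*i+1) := pow_nonneg hr.1 _
      linarith
    rw [beta_int] at h1
    have hfac : ((i:ℝ)+1)^(2*M) * i.factorial ≤ ((i + (2*M-1) + 1).factorial : ℝ) := by
      have := Nat.factorial_mul_pow_le_factorial (n := 2*M) (m := i)
      have e : i + (2*M-1) + 1 = i + 2*M := by omega
      rw [e, mul_comm]
      exact_mod_cast this
    have hc : Cj M (i+1) ≤ (((M:ℝ)+2)*(i+1))^M := by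
      unfold Cj
      have h := Nat.choose_le_pow (n := i+1+1+M) (k := M)
      have h2 : (i+1+1+M)^M ≤ ((M+2)*(i+1))^M := Nat.pow_le_pow_left (by nlinarith) _
      exact_mod_cast h.trans h2
    have hc2 : Cj M (i+1) ^ 2 ≤ ((M:ℝ)+2)^(2*M) * ((i:ℝ)+1)^(2*M) := by
      calc Cj M (i+1)^2 ≤ ((((M:ℝ)+2)*(i+1))^M)^2 := by gcongr; exact Cj_nonneg _ _
        _ = _ := by rw [← pow_mul, mul_pow, mul_comm M 2]
    unfold CL
    have hfp : (0:ℝ) < ((i + (2*M-1) + 1).factorial : ℝ) := by positivity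
    calc Cj M (i+1) ^ 2 * (8 * _) ≤ (((M:ℝ)+2)^(2*M) * ((i:ℝ)+1)^(2*M)) * (8 * (i.factorial * (2*M-1).factorial / ((i + (2*M-1) + 1).factorial : ℝ))) := by
          apply mul_le_mul hc2 _ _ (by positivity)
          · linarith
          · apply mul_nonneg (by norm_num)
            apply intervalIntegral.integral_nonneg (by norm_num)
            intro r hr
            exact mul_nonneg (pow_nonneg (hsq r hr).1 _) (pow_nonneg hr.1 _)
      _ = 8 * ((M:ℝ)+2)^(2*M) * (2*M-1).factorial * ((((i:ℝ)+1)^(2*M) * i.factorial) / ((i + (2*M-1) + 1).factorial : ℝ)) := by ring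
      _ ≤ 8 * ((M:ℝ)+2)^(2*M) * (2*M-1).factorial * 1 := by
          gcongr
          exact (div_le_one hfp).2 hfac
      _ = _ := by ring

theorem int_ev (m : ℤ) : ∫ t in (-(1/2):ℝ)..(1/2), ev (m * t) = if m = 0 then 1 else 0 := by
  split_ifs with h
  · subst h; simp [ev]; norm_num
  · have hc : (2 * Real.pi * Complex.I * m : ℂ) ≠ 0 := by
      have : (m:ℂ) ≠ 0 := by exact_mod_cast h
      have := Complex.two_pi_I_ne_zero
      positivity
    have := integral_exp_mul_complex (a := -(1/2)) (b := 1/2) hc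
    have e : ∀ t : ℝ, ev (m * t) = Complex.exp (2 * Real.pi * Complex.I * m * t) := by
      intro t; unfold ev; congr 1; push_cast; ring
    simp_rw [e]
    rw [this]
    have e2 : Complex.exp (2 * Real.pi * Complex.I * m * ((1/2:ℝ):ℂ)) = Complex.exp (2 * Real.pi * Complex.I * m * ((-(1/2):ℝ):ℂ)) := by
      rw [Complex.exp_eq_exp_iff_exists_int]
      exact ⟨m, by push_cast; ring⟩
    rw [e2, sub_self, zero_div]

theorem conj_ev (x : ℝ) : (starRingEnd ℂ) (ev x) = ev (-x) := by
  unfold ev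
  rw [← Complex.exp_conj]
  congr 1
  have h2 : (starRingEnd ℂ) 2 = 2 := Complex.conj_ofNat 2
  simp [h2]

section
variable {E : Type*} [NormedAddCommGroup E] [InnerProductSpace ℂ E]

/-- character -/
def chi (m : ℤ) (t : ℝ) : ℂ := ev (m * t)
theorem cont_chi (m : ℤ) : Continuous (chi m) := continuous_ev.comp (continuous_const.mul continuous_id)
theorem int_chi (m : ℤ) : ∫ t in (-(1/2):ℝ)..(1/2), chi m t = if m = 0 then 1 else 0 := int_ev m

theorem parseval (N : ℕ) (v : ℕ → E) :
    ∫ t in (-(1/2):ℝ)..(1/2), ‖∑ j ∈ Finset.range N, ev (j * t) • v j‖ ^ 2 = ∑ j ∈ Finset.range N, ‖v j‖ ^ 2 := by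
  have h1 : ∀ t : ℝ, ((‖∑ j ∈ Finset.range N, ev (j * t) • v j‖ ^ 2 : ℝ) : ℂ) =
      ∑ j ∈ Finset.range N, ∑ k ∈ Finset.range N, chi ((k:ℤ) - (j:ℤ)) t * inner ℂ (v j) (v k) := by
    intro t
    have := inner_self_eq_norm_sq_to_K (𝕜 := ℂ) (∑ j ∈ Finset.range N, ev (j * t) • v j)
    rw [Complex.ofReal_pow]
    refine this.symm.trans ?_
    rw [sum_inner]
    refine Finset.sum_congr rfl fun j _ => ?_
    rw [inner_sum]
    refine Finset.sum_congr rfl fun k _ => ?_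
    rw [inner_smul_left, inner_smul_right, conj_ev, ← mul_assoc, ← ev_add]
    unfold chi
    congr 2; push_cast; ring
  have h2 : ((∫ t in (-(1/2):ℝ)..(1/2), ‖∑ j ∈ Finset.range N, ev (j * t) • v j‖ ^ 2 : ℝ) : ℂ) = ((∑ j ∈ Finset.range N, ‖v j‖ ^ 2 : ℝ) : ℂ) := by
    rw [← intervalIntegral.integral_ofReal]
    simp_rw [h1]
    have hii : ∀ j k : ℕ, IntervalIntegrable (fun t => chi ((k:ℤ) - (j:ℤ)) t * inner ℂ (v j) (v k)) volume (-(1/2)) (1/2) :=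
      fun j k => ((cont_chi _).mul continuous_const).intervalIntegrable _ _
    have hii2 : ∀ j : ℕ, IntervalIntegrable (fun t => ∑ k ∈ Finset.range N, chi ((k:ℤ) - (j:ℤ)) t * inner ℂ (v j) (v k)) volume (-(1/2)) (1/2) :=
      fun j => (continuous_finset_sum _ fun k _ => (cont_chi _).mul continuous_const).intervalIntegrable _ _
    rw [intervalIntegral.integral_finset_sum fun j _ => hii2 j, Complex.ofReal_sum]
    refine Finset.sum_congr rfl fun j hj => ?_
    rw [intervalIntegral.integral_finset_sum fun k _ => hii j k]
    rw [Finset.sum_eq_single j]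
    · rw [intervalIntegral.integral_mul_const, int_chi, if_pos (sub_self _), one_mul, Complex.ofReal_pow]
      exact inner_self_eq_norm_sq_to_K (𝕜 := ℂ) (v j)
    · intro k _ hk
      rw [intervalIntegral.integral_mul_const, int_chi, if_neg, zero_mul]
      omega
    · intro h; exact absurd hj h
  exact Complex.ofReal_injective h2

end
end HPTL
end

section
namespace HPTL
set_option linter.all false
set_option linter.unusedSectionVars false

/-- weights -/
def wt (M j : ℕ) (z : ℝ × ℝ) : ℂ := ((2 * (1 - z.1^2)^M * z.1^j : ℝ) : ℂ) * ev (-(j * z.2))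

theorem cont_wt (M j : ℕ) : Continuous (wt M j) := by
  unfold wt
  refine (Complex.continuous_ofReal.comp (by fun_prop)).mul (continuous_ev.comp (by fun_prop))

theorem norm_wt (M j : ℕ) {z : ℝ × ℝ} (hz : z ∈ QQ) : ‖wt M j z‖ = 2 * (1 - z.1^2)^M * z.1^j := by
  have h1 : 0 ≤ z.1 := hz.1.1
  have h2 : z.1 < 1 := hz.1.2
  have h3 : 0 ≤ 1 - z.1^2 := by nlinarith
  unfold wt
  rw [norm_mul, norm_ev, mul_one, Complex.norm_real, Real.norm_of_nonneg (by positivity)]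

theorem norm_wt_le (M j : ℕ) {z : ℝ × ℝ} (hz : z ∈ QQ) : ‖wt M j z‖ ≤ 2 * (1 - z.1^2)^M := by
  have h1 : 0 ≤ z.1 := hz.1.1
  have h2 : z.1 < 1 := hz.1.2
  have h3 : 0 ≤ 1 - z.1^2 := by nlinarith
  rw [norm_wt M j hz]
  exact mul_le_of_le_one_right (by positivity) (pow_le_one₀ h1 h2.le)

theorem norm_wt_le_two (M j : ℕ) {z : ℝ × ℝ} (hz : z ∈ QQ) : ‖wt M j z‖ ≤ 2 := by
  have h1 : 0 ≤ z.1 := hz.1.1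
  have h2 : z.1 < 1 := hz.1.2
  refine (norm_wt_le M j hz).trans ?_
  have : (1 - z.1^2)^M ≤ 1 := pow_le_one₀ (by nlinarith) (by nlinarith)
  linarith

theorem measurableSet_QQ : MeasurableSet QQ := measurableSet_Ico.prod measurableSet_Ico

theorem volume_QQ : volume QQ = 1 := by
  unfold QQ I₀
  rw [Measure.volume_eq_prod, Measure.prod_prod, Real.volume_Ico, Real.volume_Ico]
  norm_num

instance : IsFiniteMeasure (volume.restrict QQ) := ⟨by rw [Measure.restrict_apply_univ, volume_QQ]; exact one_lt_top⟩

section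
variable {E : Type*} [NormedAddCommGroup E] [InnerProductSpace ℂ E] [CompleteSpace E]

/-- moments -/
def mm (M : ℕ) (G : ℝ × ℝ → E) (j : ℕ) : E := ∫ z in QQ, wt M j z • G z

theorem wt_integrable (M j : ℕ) {G : ℝ × ℝ → E} (hG : IntegrableOn G QQ) : IntegrableOn (fun z => wt M j z • G z) QQ := by
  refine Integrable.bdd_smul hG 2 (cont_wt M j).aestronglyMeasurable ?_
  filter_upwards [ae_restrict_mem measurableSet_QQ] with z hz using norm_wt_le_two M j hz

theorem L2_intOn {G : ℝ × ℝ → E} (hG : MemLp G 2 (volume.restrict QQ)) : IntegrableOn G QQ :=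
  hG.integrable (by norm_num)

theorem cont_intOn {f : ℝ × ℝ → ℝ} (hf : Continuous f) : IntegrableOn f QQ := by
  have : QQ ⊆ Set.Icc 0 1 ×ˢ Set.Icc (-1/2:ℝ) (1/2) := Set.prod_mono Set.Ico_subset_Icc_self Set.Ico_subset_Icc_self
  exact (hf.continuousOn.integrableOn_compact (isCompact_Icc.prod isCompact_Icc)).mono_set this

theorem int_QQ {f : ℝ × ℝ → ℝ} (hf : Continuous f) :
    ∫ z in QQ, f z = ∫ r in (0:ℝ)..1, ∫ t in (-(1/2):ℝ)..(1/2), f (r, t) := by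
  have hi := cont_intOn hf
  unfold QQ at hi ⊢
  rw [Measure.volume_eq_prod] at hi ⊢
  rw [setIntegral_prod _ hi, intervalIntegral.integral_of_le (by norm_num), integral_Ico_eq_integral_Ioc]
  refine setIntegral_congr_fun measurableSet_Ioc fun r _ => ?_
  unfold I₀
  rw [intervalIntegral.integral_of_le (by norm_num), integral_Ico_eq_integral_Ioc, show (-(1/2):ℝ) = -1/2 by norm_num]

theorem L2_lemma {M : ℕ} (hM : 1 ≤ M) {G : ℝ × ℝ → E} (hG : MemLp G 2 (volume.restrict QQ)) (N : ℕ) :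
    ∑ j ∈ Finset.range N, Cj M j ^ 2 * ‖mm M G j‖ ^ 2 ≤ CL M * ∫ z in QQ, (1 - z.1) * ‖G z‖ ^ 2 := by
  have hGi := L2_intOn hG
  have hG2 : IntegrableOn (fun z => ‖G z‖^2) QQ := hG.integrable_norm_pow (by norm_num)
  have hG3 : IntegrableOn (fun z : ℝ × ℝ => (1 - z.1) * ‖G z‖^2) QQ := by
    refine Integrable.bdd_mul (c := 1) hG2 (by fun_prop) ?_
    filter_upwards [ae_restrict_mem measurableSet_QQ] with z hz
    have h1 : 0 ≤ z.1 := hz.1.1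
    have h2 : z.1 < 1 := hz.1.2
    rw [Real.norm_of_nonneg (by linarith)]; linarith
  set b : ℕ → E := fun j => (Cj M j : ℂ) • mm M G j with hb
  set X := ∑ j ∈ Finset.range N, ‖b j‖^2 with hX
  have hbn : ∀ j, ‖b j‖^2 = Cj M j ^ 2 * ‖mm M G j‖ ^ 2 := fun j => by
    rw [hb]; simp only [norm_smul, Complex.norm_real]; rw [mul_pow, Real.norm_eq_abs, sq_abs]
  simp_rw [← hbn]
  set S : ℝ × ℝ → E := fun z => ∑ j ∈ Finset.range N, ev (j * z.2) • ((Cj M j * z.1^j : ℝ) : ℂ) • b j with hS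
  have hScont : Continuous S := by
    refine continuous_finset_sum _ fun j _ => ?_
    exact (continuous_ev.comp (by fun_prop)).smul ((Complex.continuous_ofReal.comp (by fun_prop)).smul continuous_const)
  -- S energy
  have hSe : ∫ z in QQ, 8 * (1 - z.1^2)^(2*M-1) * ‖S z‖^2 ≤ CL M * X := by
    rw [int_QQ (by fun_prop)]
    have e1 : ∀ r : ℝ, ∫ t in (-(1/2):ℝ)..(1/2), 8 * (1 - r^2)^(2*M-1) * ‖S (r,t)‖^2 =
        ∑ j ∈ Finset.range N, ‖b j‖^2 * (Cj M j ^ 2 * (8 * ((1 - r^2)^(2*M-1) * r^(2*j)))) := by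
      intro r
      rw [intervalIntegral.integral_const_mul]
      simp only [hS]
      rw [parseval N (fun j => ((Cj M j * r^j : ℝ) : ℂ) • b j), Finset.mul_sum]
      refine Finset.sum_congr rfl fun j _ => ?_
      rw [norm_smul, Complex.norm_real, mul_pow, Real.norm_eq_abs, sq_abs]
      ring
    simp_rw [e1]
    rw [intervalIntegral.integral_finset_sum (fun j _ => by apply Continuous.intervalIntegrable; fun_prop), hX, Finset.mul_sum]
    refine Finset.sum_le_sum fun j _ => ?_
    rw [intervalIntegral.integral_const_mul, intervalIntegral.integral_const_mul, intervalIntegral.integral_const_mul, mul_comm (CL M)]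
    exact mul_le_mul_of_nonneg_left (cb hM j) (by positivity)
  -- duality
  have hdual : X ≤ ∫ z in QQ, (2⁻¹ * ((CL M)⁻¹ * (8 * (1 - z.1^2)^(2*M-1) * ‖S z‖^2) + CL M * ((1 - z.1) * ‖G z‖^2))) := by
    have e1 : X = ∫ z in QQ, ∑ j ∈ Finset.range N, (Cj M j) * RCLike.re (inner ℂ (b j) (wt M j z • G z)) := by
      have hint : ∀ j, IntegrableOn (fun z => inner ℂ (b j) (wt M j z • G z)) QQ := fun j => (wt_integrable M j hGi).const_inner _
      rw [integral_finset_sum _ fun j _ => ((hint j).re).const_mul _]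
      refine Finset.sum_congr rfl fun j _ => ?_
      rw [integral_const_mul, integral_re (hint j), integral_inner (wt_integrable M j hGi)]
      change _ = Cj M j * RCLike.re (inner ℂ (b j) (mm M G j))
      rw [hb]
      simp only [inner_smul_left, Complex.conj_ofReal]
      rw [norm_smul, mul_pow, Complex.norm_real, Real.norm_eq_abs, sq_abs]
      have := inner_self_eq_norm_sq (𝕜 := ℂ) (mm M G j)
      rw [← this]
      simp
      ring
    rw [e1]
    refine setIntegral_mono_on ?_ ?_ measurableSet_QQ ?_
    · exact integrable_finset_sum _ fun j _ => ((((wt_integrable M j hGi).const_inner (b j))).re).const_mul _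
    · refine Integrable.const_mul (Integrable.add (Integrable.const_mul (cont_intOn (by fun_prop)) _) (hG3.const_mul _)) _
    · intro z hz
      have h1 : 0 ≤ z.1 := hz.1.1
      have h2 : z.1 < 1 := hz.1.2
      have h3 : 0 < 1 - z.1^2 := by nlinarith
      have e2 : ∑ j ∈ Finset.range N, (Cj M j) * RCLike.re (inner ℂ (b j) (wt M j z • G z)) =
          2 * (1 - z.1^2)^M * RCLike.re (inner ℂ (S z) (G z)) := by
        simp only [hS]
        rw [sum_inner, map_sum, Finset.mul_sum]
        refine Finset.sum_congr rfl fun j _ => ?_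
        have a1 : inner ℂ (b j) (wt M j z • G z) = ((2 * (1 - z.1 ^ 2) ^ M * z.1 ^ j : ℝ) : ℂ) * (ev (-(j * z.2)) * inner ℂ (b j) (G z)) := by
          clear_value b
          rw [inner_smul_right]; unfold wt; ring
        have a2 : inner ℂ (ev (j * z.2) • ((Cj M j * z.1^j : ℝ) : ℂ) • b j) (G z) = ((Cj M j * z.1^j : ℝ) : ℂ) * (ev (-(j * z.2)) * inner ℂ (b j) (G z)) := by
          clear_value b
          rw [inner_smul_left, inner_smul_left, conj_ev, Complex.conj_ofReal]; ring
        rw [a1, a2]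
        rw [RCLike.re_eq_complex_re, Complex.re_ofReal_mul, Complex.re_ofReal_mul]
        ring
      rw [e2]
      have h4 : RCLike.re (inner ℂ (S z) (G z)) ≤ ‖S z‖ * ‖G z‖ := re_inner_le_norm _ _
      have h5 : 2 * (1 - z.1^2)^M * RCLike.re (inner ℂ (S z) (G z)) ≤ 2 * (1 - z.1^2)^M * (‖S z‖ * ‖G z‖) :=
        mul_le_mul_of_nonneg_left h4 (by positivity)
      refine h5.trans ?_
      have hC := CL_pos M
      set w := (1 - z.1^2)^M with hw
      have hw0 : 0 ≤ w := by positivity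
      have hw2 : w^2 ≤ 2 * (1 - z.1) * (1 - z.1^2)^(2*M-1) := by
        have : w^2 = (1 - z.1^2) * (1 - z.1^2)^(2*M-1) := by
          rw [hw, ← pow_mul, ← pow_succ']; congr 1; omega
        rw [this]
        apply mul_le_mul_of_nonneg_right _ (by positivity)
        nlinarith
      set s := ‖S z‖
      set g := ‖G z‖
      set u := (1 - z.1^2)^(2*M-1)
      have hu : 0 ≤ u := by positivity
      set c := CL M
      have hq : 0 < 1 - z.1 := by linarith
      -- 4 w s g ≤ c⁻¹ 8 u s² + c q g²
      have hd : 0 ≤ c * (1 - z.1) * (c * (1-z.1) * g - 2 * w * s)^2 := by positivity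
      have key : 4 * w * s * g ≤ c⁻¹ * (8 * u * s^2) + c * ((1 - z.1) * g^2) := by
        have : c⁻¹ * (4 * w^2 * s^2) / (1 - z.1) ≤ c⁻¹ * (8 * u * s^2) := by
          rw [div_le_iff₀ hq, mul_assoc c⁻¹ (8 * u * s^2)]
          apply mul_le_mul_of_nonneg_left _ (by positivity)
          nlinarith [mul_le_mul_of_nonneg_right hw2 (sq_nonneg s)]
        refine le_trans ?_ (add_le_add_left this _)
        rw [← sub_nonneg]
        have : c⁻¹ * (4 * w^2 * s^2) / (1 - z.1) + c * ((1 - z.1) * g^2) - 4 * w * s * g = (c * (1-z.1) * g - 2 * w * s)^2 / (c * (1 - z.1)) := by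
          field_simp; ring
        rw [this]; positivity
      linarith
  rw [integral_const_mul, integral_add (Integrable.const_mul (cont_intOn (by fun_prop)) _) (hG3.const_mul _), integral_const_mul, integral_const_mul] at hdual
  have hC := CL_pos M
  have h6 : (CL M)⁻¹ * ∫ z in QQ, 8 * (1 - z.1^2)^(2*M-1) * ‖S z‖^2 ≤ X := by
    rw [inv_mul_le_iff₀ hC]; exact hSe
  linarith

end
end HPTL
end

section
namespace HPTL
set_option linter.all false
set_option linter.unusedSectionVars false

theorem ev_nat (j : ℕ) (x : ℝ) : ev (j * x) = ev x ^ j := by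
  unfold ev; rw [← Complex.exp_nat_mul]; congr 1; push_cast; ring

theorem ev_lip (u v : ℝ) : ‖ev u - ev v‖ ≤ 2 * Real.pi * |u - v| := by
  have h : ev u - ev v = ev v * (Complex.exp (Complex.I * ((2 * Real.pi * (u - v) : ℝ) : ℂ)) - 1) := by
    rw [mul_sub, mul_one]
    congr 1
    unfold ev; rw [← Complex.exp_add]; congr 1; push_cast; ring
  rw [h, norm_mul, norm_ev, one_mul]
  refine (Real.norm_exp_I_mul_ofReal_sub_one_le).trans ?_
  rw [Real.norm_eq_abs, abs_mul, abs_of_pos (by positivity)]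

theorem Mx_one (t : ℝ) : Mx (fun _ => 1) t ≤ 2 := by
  refine iSup₂_le fun ρ hρ => ?_
  rw [lintegral_one, Measure.restrict_apply_univ, Real.volume_closedBall]
  rw [ENNReal.div_le_iff (by simpa using hρ) ENNReal.ofReal_ne_top]
  rw [ENNReal.ofReal_mul (by norm_num)]; simp

theorem ev_lower (y : ℝ) (hy : |y| ≤ 1) : (|y| ≤ ‖1 - ev y‖) ∨ (|y - 1| ≤ ‖1 - ev y‖) ∨ (|y + 1| ≤ ‖1 - ev y‖) := by
  have key : ∀ x : ℝ, |x| ≤ 1/2 → |x| ≤ ‖1 - ev x‖ := by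
    intro x hx
    have := (le_max_right _ _).trans (ev_dist (r := 1) (by norm_num) le_rfl hx)
    simpa using this
  rw [abs_le] at hy
  by_cases h1 : |y| ≤ 1/2
  · left; exact key y h1
  · rcases lt_or_ge 0 y with h | h
    · right; left
      have : |y - 1| ≤ 1/2 := by
        rw [abs_of_pos h] at h1; rw [abs_le]; constructor <;> linarith
      have h2 := key _ this
      have h3 := ev_one_periodic (y - 1)
      rw [sub_add_cancel] at h3
      rwa [← h3] at h2
    · right; right
      have : |y + 1| ≤ 1/2 := by
        rw [abs_of_nonpos h] at h1; rw [abs_le]; constructor <;> linarith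
      have h2 := key _ this
      rwa [ev_one_periodic] at h2

theorem ev_kernel {t0 δ : ℝ} (ht0 : t0 ∈ I₀) (hδ : 0 < δ) :
    ∫⁻ t in I₀, ENNReal.ofReal (δ / max (δ^2) (‖ev t - ev t0‖^2)) ≤ 96 := by
  have hk : ∀ s : ℝ, ∫⁻ t, ENNReal.ofReal (δ / max (δ^2) ((t - s)^2)) ≤ 32 := by
    intro s
    have := kernel_max (fun _ => 1) measurable_const (t := s) (t' := s) hδ (by simpa using hδ.le)
    simp only [mul_one] at this
    refine this.trans ((mul_le_mul_right (Mx_one s) _).trans (by norm_num))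
  have hm : ∀ s : ℝ, Measurable fun t : ℝ => ENNReal.ofReal (δ / max (δ^2) ((t - s)^2)) := by
    intro s; fun_prop
  calc ∫⁻ t in I₀, ENNReal.ofReal (δ / max (δ^2) (‖ev t - ev t0‖^2)) 
      ≤ ∫⁻ t in I₀, (ENNReal.ofReal (δ / max (δ^2) ((t - t0)^2)) + (ENNReal.ofReal (δ / max (δ^2) ((t - (t0+1))^2)) + ENNReal.ofReal (δ / max (δ^2) ((t - (t0-1))^2)))) := by
        refine setLIntegral_mono' measurableSet_Ico fun t ht => ?_
        have hn : ‖ev t - ev t0‖ = ‖1 - ev (t - t0)‖ := by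
          rw [norm_sub_rev]; simpa using norm_ev_sub (r := 1) (t := t) (τ := t0)
        have hy : |t - t0| ≤ 1 := by
          have h1 := ht.1; have h2 := ht.2; have h3 := ht0.1; have h4 := ht0.2
          rw [abs_le]; constructor <;> linarith
        have mono : ∀ x : ℝ, |x| ≤ ‖1 - ev (t - t0)‖ → ENNReal.ofReal (δ / max (δ^2) (‖ev t - ev t0‖^2)) ≤ ENNReal.ofReal (δ / max (δ^2) (x^2)) := by
          intro x hx
          rw [hn]
          apply ENNReal.ofReal_le_ofReal
          apply div_le_div_of_nonneg_left hδ.le (by positivity)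
          apply max_le_max le_rfl
          rw [← sq_abs x]; gcongr
        rcases ev_lower _ hy with h | h | h
        · exact (mono _ h).trans le_self_add
        · refine (mono _ h).trans ?_
          rw [show t - t0 - 1 = t - (t0+1) by ring]
          exact le_self_add.trans le_add_self
        · refine (mono _ h).trans ?_
          rw [show t - t0 + 1 = t - (t0-1) by ring]
          exact le_add_self.trans le_add_self
    _ ≤ ∫⁻ t, (ENNReal.ofReal (δ / max (δ^2) ((t - t0)^2)) + (ENNReal.ofReal (δ / max (δ^2) ((t - (t0+1))^2)) + ENNReal.ofReal (δ / max (δ^2) ((t - (t0-1))^2)))) := setLIntegral_le_lintegral _ _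
    _ ≤ 32 + (32 + 32) := by
        rw [lintegral_add_left (hm _), lintegral_add_left (hm _)]
        exact add_le_add (hk _) (add_le_add (hk _) (hk _))
    _ = 96 := by norm_num

theorem Cj_summable (M : ℕ) {x : ℝ} (hx0 : 0 ≤ x) (hx : x < 1) : Summable fun j => Cj M j * x^(j+1) := by
  have h := summable_choose_mul_geometric_of_norm_lt_one (R := ℝ) M (r := x) (by rwa [Real.norm_of_nonneg hx0])
  exact (summable_nat_add_iff 1).2 h

theorem Cj_summable' (M : ℕ) {x : ℝ} (hx0 : 0 ≤ x) (hx : x < 1) : Summable fun j => Cj M j * x^j := by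
  rcases hx0.eq_or_lt with rfl | h0
  · apply summable_of_ne_finset_zero (s := {0})
    intro j hj
    have : j ≠ 0 := by simpa using hj
    simp [this]
  · have := (Cj_summable M hx0 hx).mul_right x⁻¹
    refine this.congr fun j => ?_
    rw [pow_succ]; field_simp

/-- kernel -/
def kk (M : ℕ) (x : ℂ) : ℂ := ∑' j, (Cj M j : ℂ) * x^j

theorem kk_mul (M : ℕ) {x : ℂ} (hx : ‖x‖ < 1) : x * kk M x = 1 / (1 - x)^(M+1) - 1 := by
  have h := hasSum_choose_mul_geometric_of_norm_lt_one (𝕜 := ℂ) M hx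
  have h2 := (hasSum_nat_add_iff' 1).2 h
  simp only [Finset.range_one, Finset.sum_singleton, zero_add, pow_zero, mul_one, Nat.choose_self, Nat.cast_one] at h2
  rw [← h2.tsum_eq]
  unfold kk
  rw [← tsum_mul_left]
  refine tsum_congr fun j => ?_
  unfold Cj; rw [pow_succ]; push_cast; ring

/-- kernel constant -/
def Ck (M : ℕ) : ℝ := (∑' j, Cj M j * (1/2:ℝ)^j) * 2^(M+1) + 2 * (1 + 2^(M+1))

theorem Ck_pos (M : ℕ) : 0 < Ck M := by
  unfold Ck
  have : 0 ≤ ∑' j, Cj M j * (1/2:ℝ)^j := tsum_nonneg fun j => mul_nonneg (Cj_nonneg _ _) (by positivity)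
  positivity

theorem kk_bound (M : ℕ) {x : ℂ} (hx : ‖x‖ < 1) : ‖kk M x‖ ≤ Ck M / ‖1 - x‖^(M+1) := by
  have h0 : 0 < ‖1 - x‖ := by
    rw [norm_pos_iff, sub_ne_zero]
    rintro rfl
    simp at hx
  have h2 : ‖1 - x‖ ≤ 2 := by
    refine (norm_sub_le _ _).trans ?_
    rw [norm_one]; linarith
  have h3 : ‖1 - x‖^(M+1) ≤ 2^(M+1) := by gcongr
  have hS : 0 ≤ ∑' j, Cj M j * (1/2:ℝ)^j := tsum_nonneg fun j => mul_nonneg (Cj_nonneg _ _) (by positivity)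
  rw [le_div_iff₀ (by positivity)]
  unfold Ck
  by_cases hx2 : ‖x‖ ≤ 1/2
  · have : ‖kk M x‖ ≤ ∑' j, Cj M j * (1/2:ℝ)^j := by
      refine tsum_of_norm_bounded (Cj_summable' M (by norm_num) (by norm_num)).hasSum fun j => ?_
      rw [norm_mul, norm_pow, Complex.norm_real, Real.norm_of_nonneg (Cj_nonneg _ _)]
      have := Cj_nonneg M j
      gcongr
    have : ‖kk M x‖ * ‖1 - x‖^(M+1) ≤ (∑' j, Cj M j * (1/2:ℝ)^j) * 2^(M+1) := by gcongr
    have : (0:ℝ) ≤ 2 * (1 + 2^(M+1)) := by positivity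
    linarith
  · push Not at hx2
    have h4 : ‖x‖ * ‖kk M x‖ ≤ 1 / ‖1 - x‖^(M+1) + 1 := by
      rw [← norm_mul, kk_mul M hx]
      refine (norm_sub_le _ _).trans ?_
      rw [norm_div, norm_one, norm_pow]
    have h5 : ‖kk M x‖ ≤ 2 * (1 / ‖1 - x‖^(M+1) + 1) := by nlinarith [norm_nonneg (kk M x)]
    have h6 : ‖kk M x‖ * ‖1 - x‖^(M+1) ≤ 2 * (1 / ‖1 - x‖^(M+1) + 1) * ‖1 - x‖^(M+1) := by gcongr
    have h7 : 2 * (1 / ‖1 - x‖^(M+1) + 1) * ‖1 - x‖^(M+1) = 2 * (1 + ‖1-x‖^(M+1)) := by field_simp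
    have : 0 ≤ (∑' j, Cj M j * (1/2:ℝ)^j) * 2^(M+1) := by positivity
    linarith

section
variable {E : Type*} [NormedAddCommGroup E] [InnerProductSpace ℂ E] [CompleteSpace E]

/-- synthesis from moments -/
def FS (M : ℕ) (m : ℕ → E) (z : ℂ) : E := ∑' j, ((Cj M j : ℂ) * z^(j+1)) • m j

theorem norm_FS_term (M : ℕ) (m : ℕ → E) {K : ℝ} (hm : ∀ j, ‖m j‖ ≤ K) (z : ℂ) (j : ℕ) :
    ‖((Cj M j : ℂ) * z^(j+1)) • m j‖ ≤ Cj M j * ‖z‖^(j+1) * K := by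
  rw [norm_smul, norm_mul, norm_pow, Complex.norm_real, Real.norm_of_nonneg (Cj_nonneg _ _)]
  have := Cj_nonneg M j
  gcongr; exact hm j

theorem FS_hasSum (M : ℕ) {m : ℕ → E} {K : ℝ} (hm : ∀ j, ‖m j‖ ≤ K) {z : ℂ} (hz : ‖z‖ < 1) :
    HasSum (fun j => ((Cj M j : ℂ) * z^(j+1)) • m j) (FS M m z) :=
  (Summable.of_norm_bounded ((Cj_summable M (norm_nonneg z) hz).mul_right K) (norm_FS_term M m hm z)).hasSum

theorem mm_bound {M : ℕ} {G : ℝ × ℝ → E} (hG : IntegrableOn G QQ) (j : ℕ) : ‖mm M G j‖ ≤ ∫ z in QQ, 2 * ‖G z‖ := by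
  refine norm_integral_le_of_norm_le (hG.norm.const_mul 2) ?_
  filter_upwards [ae_restrict_mem measurableSet_QQ] with z hz
  rw [norm_smul]; exact mul_le_mul_of_nonneg_right (norm_wt_le_two M j hz) (norm_nonneg _)

/-- weighted energy -/
def Lam (G : ℝ × ℝ → E) : ℝ≥0∞ := ∫⁻ z in QQ, ENNReal.ofReal (1 - z.1) * ‖G z‖ₑ ^ (2:ℝ)

theorem Lam_eq {G : ℝ × ℝ → E} (hG : MemLp G 2 (volume.restrict QQ)) : Lam G = ENNReal.ofReal (∫ z in QQ, (1 - z.1) * ‖G z‖ ^ 2) := by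
  have hG2 : IntegrableOn (fun z => ‖G z‖^2) QQ := hG.integrable_norm_pow (by norm_num)
  have hG3 : IntegrableOn (fun z : ℝ × ℝ => (1 - z.1) * ‖G z‖^2) QQ := by
    refine Integrable.bdd_mul (c := 1) hG2 (by fun_prop) ?_
    filter_upwards [ae_restrict_mem measurableSet_QQ] with z hz
    have h1 : 0 ≤ z.1 := hz.1.1
    have h2 : z.1 < 1 := hz.1.2
    rw [Real.norm_of_nonneg (by linarith)]; linarith
  rw [ofReal_integral_eq_lintegral_ofReal hG3]
  · refine setLIntegral_congr_fun measurableSet_QQ fun z hz => ?_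
    have h2 : z.1 < 1 := hz.1.2
    rw [ENNReal.ofReal_mul (by linarith), ← ofReal_norm_eq_enorm, ENNReal.ofReal_rpow_of_nonneg (norm_nonneg _) (by norm_num)]
    norm_num
  · filter_upwards [ae_restrict_mem measurableSet_QQ] with z hz
    have h2 : z.1 < 1 := hz.1.2
    exact mul_nonneg (by linarith) (by positivity)

theorem FS_L2 {M : ℕ} (hM : 1 ≤ M) {G : ℝ × ℝ → E} (hG : MemLp G 2 (volume.restrict QQ)) {R : ℝ} (hR0 : 0 ≤ R) (hR : R < 1) :
    ∫⁻ t in I₀, ‖FS M (mm M G) (R * ev t)‖ₑ ^ (2:ℝ) ≤ ENNReal.ofReal (CL M) * Lam G := by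
  have hz : ∀ t, ‖(R * ev t : ℂ)‖ = R := fun t => by rw [norm_mul, norm_ev, mul_one, Complex.norm_real, Real.norm_of_nonneg hR0]
  have hlim : ∀ t : ℝ, Tendsto (fun N => ‖∑ j ∈ Finset.range N, ((Cj M j : ℂ) * (R * ev t)^(j+1)) • mm M G j‖ₑ ^ (2:ℝ)) atTop (𝓝 (‖FS M (mm M G) (R * ev t)‖ₑ ^ (2:ℝ))) := by
    intro t
    have h := (FS_hasSum M (mm_bound (M := M) (L2_intOn hG)) (z := R * ev t) (by rw [hz]; exact hR)).tendsto_sum_nat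
    exact (ENNReal.continuous_rpow_const.tendsto _).comp (continuous_enorm.tendsto _ |>.comp h)
  calc ∫⁻ t in I₀, ‖FS M (mm M G) (R * ev t)‖ₑ ^ (2:ℝ) 
      = ∫⁻ t in I₀, liminf (fun N => ‖∑ j ∈ Finset.range N, ((Cj M j : ℂ) * (R * ev t)^(j+1)) • mm M G j‖ₑ ^ (2:ℝ)) atTop :=
        lintegral_congr fun t => ((hlim t).liminf_eq).symm
    _ ≤ liminf (fun N => ∫⁻ t in I₀, ‖∑ j ∈ Finset.range N, ((Cj M j : ℂ) * (R * ev t)^(j+1)) • mm M G j‖ₑ ^ (2:ℝ)) atTop := by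
        apply lintegral_liminf_le
        intro N
        have : Continuous fun t => ∑ j ∈ Finset.range N, ((Cj M j : ℂ) * (R * ev t)^(j+1)) • mm M G j :=
          continuous_finset_sum _ fun j _ => (continuous_const.mul ((continuous_const.mul continuous_ev).pow _)).smul continuous_const
        exact (ENNReal.continuous_rpow_const.comp (continuous_enorm.comp this)).measurable
    _ ≤ ENNReal.ofReal (CL M) * Lam G := by
        refine (liminf_le_liminf (v := fun _ => ENNReal.ofReal (CL M) * Lam G) (Eventually.of_forall fun N => ?_)).trans (le_of_eq (by simp))
        have e1 : ∀ t : ℝ, ‖∑ j ∈ Finset.range N, ((Cj M j : ℂ) * (R * ev t)^(j+1)) • mm M G j‖ₑ ^ (2:ℝ) = ENNReal.ofReal (‖∑ j ∈ Finset.range N, ev (j * t) • ((Cj M j * R^(j+1) : ℝ) : ℂ) • mm M G j‖ ^ 2) := by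
          intro t
          have : ∑ j ∈ Finset.range N, ((Cj M j : ℂ) * (R * ev t)^(j+1)) • mm M G j = ev t • ∑ j ∈ Finset.range N, ev (j * t) • ((Cj M j * R^(j+1) : ℝ) : ℂ) • mm M G j := by
            rw [Finset.smul_sum]
            refine Finset.sum_congr rfl fun j _ => ?_
            rw [ev_nat, smul_smul, smul_smul]
            congr 1
            push_cast; ring
          rw [this, enorm_smul, ← ofReal_norm_eq_enorm (ev t), norm_ev, ENNReal.ofReal_one, one_mul, ← ofReal_norm_eq_enorm, ENNReal.ofReal_rpow_of_nonneg (norm_nonneg _) (by norm_num)]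
          norm_num
        simp_rw [e1]
        have hc : Continuous fun t : ℝ => ‖∑ j ∈ Finset.range N, ev (j * t) • ((Cj M j * R^(j+1) : ℝ) : ℂ) • mm M G j‖ ^ 2 := by
          have : Continuous fun t : ℝ => ∑ j ∈ Finset.range N, ev (j * t) • ((Cj M j * R^(j+1) : ℝ) : ℂ) • mm M G j :=
            continuous_finset_sum _ fun j _ => (continuous_ev.comp (by fun_prop)).smul continuous_const
          exact this.norm.pow 2
        rw [lint_I₀ hc (fun t => by positivity),
          parseval N (fun j => ((Cj M j * R^(j+1) : ℝ) : ℂ) • mm M G j), Lam_eq hG, ← ENNReal.ofReal_mul (CL_pos M).le]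
        apply ENNReal.ofReal_le_ofReal
        refine le_trans (Finset.sum_le_sum fun j _ => ?_) (L2_lemma hM hG N)
        rw [norm_smul, mul_pow, Complex.norm_real, Real.norm_eq_abs, sq_abs, mul_pow]
        have : (R^(j+1))^2 ≤ 1 := pow_le_one₀ (by positivity) (pow_le_one₀ hR0 hR.le)
        apply mul_le_mul_of_nonneg_right _ (by positivity)
        exact mul_le_of_le_one_right (by positivity) this

end
end HPTL
end

section
namespace HPTL
set_option linter.all false
set_option linter.unusedSectionVars false

theorem wt_eq (M j : ℕ) (w : ℝ × ℝ) : wt M j w = ((2 * (1 - w.1^2)^M : ℝ) : ℂ) * (w.1 * ev (-w.2))^j := by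
  unfold wt
  rw [show -((j:ℝ) * w.2) = j * (-w.2) by ring, ev_nat, mul_pow]
  push_cast; ring

section
variable {E : Type*} [NormedAddCommGroup E] [InnerProductSpace ℂ E] [CompleteSpace E]

theorem FS_kernel (M : ℕ) {G : ℝ × ℝ → E} (hG : IntegrableOn G QQ) {z : ℂ} (hz : ‖z‖ < 1) :
    FS M (mm M G) z = ∫ w in QQ, (z * ((2 * (1 - w.1^2)^M : ℝ) : ℂ) * kk M (z * (w.1 * ev (-w.2)))) • G w := by
  have h := hasSum_integral_of_summable_integral_norm (μ := volume.restrict QQ) (F := fun j w => ((Cj M j : ℂ) * z^(j+1)) • (wt M j w • G w))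
    (fun j => (wt_integrable M j hG).smul _) ?_
  · unfold FS
    have e : ∀ j, ((Cj M j : ℂ) * z^(j+1)) • mm M G j = ∫ w in QQ, ((Cj M j : ℂ) * z^(j+1)) • (wt M j w • G w) := by
      intro j; rw [integral_smul]; rfl
    simp_rw [e]
    rw [h.tsum_eq]
    refine setIntegral_congr_fun measurableSet_QQ fun w hw => ?_
    have h1 : 0 ≤ w.1 := hw.1.1
    have h2 : w.1 < 1 := hw.1.2
    have hx : ‖z * (w.1 * ev (-w.2))‖ < 1 := by
      rw [norm_mul, norm_mul, norm_ev, mul_one, Complex.norm_real, Real.norm_of_nonneg h1]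
      nlinarith [norm_nonneg z]
    have hs : Summable fun j => (Cj M j : ℂ) * (z * (w.1 * ev (-w.2)))^j := by
      refine Summable.of_norm ?_
      refine (Cj_summable' M (norm_nonneg _) hx).congr fun j => ?_
      rw [norm_mul (Cj M j : ℂ), norm_pow, Complex.norm_real, Real.norm_of_nonneg (Cj_nonneg _ _)]
    have hs2 := (hs.hasSum.mul_left (z * ((2 * (1 - w.1^2)^M : ℝ) : ℂ))).smul_const (G w)
    refine Eq.trans ?_ hs2.tsum_eq
    refine tsum_congr fun j => ?_
    rw [smul_smul, wt_eq]
    congr 1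
    rw [mul_pow, pow_succ]; ring
  · refine Summable.of_nonneg_of_le (fun j => integral_nonneg fun _ => norm_nonneg _) (fun j => ?_) ((Cj_summable M (norm_nonneg z) hz).mul_right (∫ w in QQ, 2 * ‖G w‖))
    rw [← integral_const_mul]
    refine setIntegral_mono_on ((wt_integrable M j hG).smul _).norm ((hG.norm.const_mul 2).const_mul _) measurableSet_QQ fun w hw => ?_
    rw [norm_smul, norm_smul, norm_mul, norm_pow, Complex.norm_real, Real.norm_of_nonneg (Cj_nonneg _ _)]
    have := Cj_nonneg M j
    have := norm_wt_le_two M j hw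
    gcongr

/-- far constant -/
def Cf (M : ℕ) : ℝ := Ck M * 4^(M+1) * 2^(M+1)

theorem Cf_pos (M : ℕ) : 0 < Cf M := by unfold Cf; have := Ck_pos M; positivity

theorem dist_far {R s t u t0 ℓ : ℝ} (hR0 : 0 ≤ R) (hR : R < 1) (hs0 : 0 ≤ s) (hs : s < 1) (hu : |u - t0| ≤ ℓ)
    (hfar : 4 * Real.pi * ℓ ≤ ‖ev t - ev t0‖) : ‖ev t - ev t0‖ / 4 ≤ ‖1 - (R * ev t) * (s * ev (-u))‖ := by
  have h1 : (R * ev t) * (s * ev (-u)) = ((R * s : ℝ) : ℂ) * ev (t - u) := by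
    rw [sub_eq_add_neg, ev_add]; push_cast; ring
  have hρ0 : 0 ≤ R * s := by positivity
  have hρ1 : R * s ≤ 1 := by nlinarith
  rw [h1]
  set ρ := R * s
  have h2 : 1 - ρ ≤ ‖1 - (ρ:ℂ) * ev (t - u)‖ := by
    have := norm_sub_norm_le (1:ℂ) (ρ * ev (t-u))
    rw [norm_mul, norm_ev, mul_one, Complex.norm_real, Real.norm_eq_abs, abs_of_nonneg hρ0, norm_one] at this
    exact this
  have h3 : ‖1 - ev (t - u)‖ ≤ ‖1 - (ρ:ℂ) * ev (t - u)‖ + (1 - ρ) := by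
    have e : 1 - ev (t - u) = (1 - (ρ:ℂ) * ev (t - u)) + ((ρ - 1 : ℝ) : ℂ) * ev (t - u) := by push_cast; ring
    rw [e]
    refine (norm_add_le _ _).trans ?_
    rw [norm_mul, norm_ev, mul_one, Complex.norm_real, Real.norm_eq_abs, abs_of_nonpos (by linarith)]
    linarith
  have h4 : ‖1 - ev (t - u)‖ = ‖ev t - ev u‖ := by
    rw [norm_sub_rev (ev t)]; simpa using (norm_ev_sub (r := 1) (t := t) (τ := u)).symm
  have h5 : ‖ev t - ev t0‖ ≤ ‖ev t - ev u‖ + ‖ev u - ev t0‖ := by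
    have := norm_add_le (ev t - ev u) (ev u - ev t0); simpa using this
  have h6 := ev_lip u t0
  have h7 : 2 * Real.pi * |u - t0| ≤ 2 * Real.pi * ℓ := by have := Real.pi_pos; gcongr
  linarith

theorem FS_far {M : ℕ} (hM : 1 ≤ M) {G : ℝ × ℝ → E} (hG : MemLp G 2 (volume.restrict QQ)) {m : ℕ} {t0 : ℝ} (ht0 : t0 ∈ dyadJ m)
    (hsupp : ∀ w ∈ QQ, G w ≠ 0 → 1 - len m ≤ w.1 ∧ w.2 ∈ dyadJ m)
    {R t : ℝ} (hR0 : 0 ≤ R) (hR : R < 1) (hfar : 4 * Real.pi * len m ≤ ‖ev t - ev t0‖) :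
    ‖FS M (mm M G) (R * ev t)‖ₑ ≤ ENNReal.ofReal (Cf M / ‖ev t - ev t0‖^(M+1) * len m ^ ((M:ℝ) + 1/2)) * Lam G ^ (1/2:ℝ) := by
  set ℓ := len m with hℓ
  have hℓ0 : 0 < ℓ := len_pos m
  set φ := ‖ev t - ev t0‖ with hφ
  have hφ0 : 0 < φ := lt_of_lt_of_le (by have := Real.pi_pos; positivity) hfar
  have hCf := Cf_pos M
  have hz : ‖(R * ev t : ℂ)‖ < 1 := by rw [norm_mul, norm_ev, mul_one, Complex.norm_real, Real.norm_of_nonneg hR0]; exact hR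
  rw [FS_kernel M (L2_intOn hG) hz]
  refine (enorm_integral_le_lintegral_enorm _).trans ?_
  set S : Set (ℝ × ℝ) := Set.Ico (1 - ℓ) 1 ×ˢ dyadJ m with hS
  have hSm : MeasurableSet S := measurableSet_Ico.prod (measurableSet_dyadJ m)
  set A : ℝ := Cf M / φ^(M+1) * ℓ^((M:ℝ) - 1/2) with hA
  have hA0 : 0 ≤ A := by positivity
  have hpt : ∀ w ∈ QQ, ‖((R * ev t : ℂ) * ((2 * (1 - w.1^2)^M : ℝ) : ℂ) * kk M ((R * ev t) * (w.1 * ev (-w.2)))) • G w‖ₑ ≤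
      ENNReal.ofReal A * ((ENNReal.ofReal (1 - w.1) ^ (1/2:ℝ) * ‖G w‖ₑ) * S.indicator (fun _ => 1) w) := by
    intro w hw
    by_cases h0 : G w = 0
    · rw [h0, smul_zero, enorm_zero]; exact zero_le
    obtain ⟨h1, h2⟩ := hsupp w hw h0
    have hw0 : 0 ≤ w.1 := hw.1.1
    have hw1 : w.1 < 1 := hw.1.2
    have hwS : w ∈ S := ⟨⟨h1, hw1⟩, h2⟩
    rw [Set.indicator_of_mem hwS, mul_one, enorm_smul, ← mul_assoc (ENNReal.ofReal A)]
    refine mul_le_mul' ?_ le_rfl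
    rw [← ofReal_norm_eq_enorm, ENNReal.ofReal_rpow_of_nonneg (by linarith) (by norm_num), ← ENNReal.ofReal_mul hA0]
    apply ENNReal.ofReal_le_ofReal
    have hd := dist_far (t := t) (u := w.2) (t0 := t0) (ℓ := ℓ) hR0 hR hw0 hw1 (abs_sub_le_len h2 ht0) hfar
    set x : ℂ := (R * ev t) * (w.1 * ev (-w.2)) with hx
    have hx1 : ‖x‖ < 1 := by
      rw [hx, norm_mul (R * ev t : ℂ), norm_mul (w.1:ℂ), norm_ev, mul_one, Complex.norm_real, Real.norm_of_nonneg hw0]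
      nlinarith [norm_nonneg (R * ev t : ℂ)]
    have hk := kk_bound M hx1
    have hk2 : ‖kk M x‖ ≤ Ck M / (φ/4)^(M+1) := by
      refine hk.trans ?_
      apply div_le_div_of_nonneg_left (Ck_pos M).le (by positivity)
      gcongr
    have hsq0 : 0 ≤ 1 - w.1^2 := by nlinarith
    have hw2 : 2 * (1 - w.1^2)^M ≤ 2^(M+1) * (1 - w.1)^M := by
      rw [pow_succ (2:ℝ) M, mul_comm (2^M) 2, mul_assoc, ← mul_pow]
      gcongr; nlinarith
    have hsp : (1 - w.1)^M ≤ ℓ^((M:ℝ) - 1/2) * (1 - w.1)^(1/2:ℝ) := by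
      have hq : 0 < 1 - w.1 := by linarith
      have : (1 - w.1)^M = (1 - w.1)^((M:ℝ) - 1/2) * (1 - w.1)^(1/2:ℝ) := by
        rw [← Real.rpow_add hq, ← Real.rpow_natCast]; congr 1; ring
      rw [this]
      have hM' : (1:ℝ) ≤ M := by exact_mod_cast hM
      apply mul_le_mul_of_nonneg_right _ (by positivity)
      exact Real.rpow_le_rpow hq.le (by linarith) (by linarith)
    rw [norm_mul, norm_mul, Complex.norm_real, Real.norm_of_nonneg (by positivity)]
    have hCk := Ck_pos M
    calc ‖(R * ev t : ℂ)‖ * (2 * (1 - w.1^2)^M) * ‖kk M x‖ ≤ 1 * (2^(M+1) * (ℓ^((M:ℝ) - 1/2) * (1 - w.1)^(1/2:ℝ))) * (Ck M / (φ/4)^(M+1)) := by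
          refine mul_le_mul (mul_le_mul hz.le (hw2.trans (by gcongr)) (by positivity) (by norm_num)) hk2 (norm_nonneg _) ?_
          have : 0 ≤ (1 - w.1)^(1/2:ℝ) := Real.rpow_nonneg (by linarith) _
          positivity
      _ = A * (1 - w.1)^(1/2:ℝ) := by
          rw [hA]; unfold Cf; rw [div_pow]; field_simp
  have hfm : AEMeasurable (fun w : ℝ × ℝ => ENNReal.ofReal (1 - w.1) ^ (1/2:ℝ) * ‖G w‖ₑ) (volume.restrict QQ) :=
    (Measurable.aemeasurable (by fun_prop)).mul hG.1.enorm
  have hgm : AEMeasurable (S.indicator (fun _ => (1:ℝ≥0∞))) (volume.restrict QQ) := (measurable_const.indicator hSm).aemeasurable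
  calc ∫⁻ w in QQ, ‖((R * ev t : ℂ) * ((2 * (1 - w.1^2)^M : ℝ) : ℂ) * kk M ((R * ev t) * (w.1 * ev (-w.2)))) • G w‖ₑ 
      ≤ ∫⁻ w in QQ, ENNReal.ofReal A * ((ENNReal.ofReal (1 - w.1) ^ (1/2:ℝ) * ‖G w‖ₑ) * S.indicator (fun _ => 1) w) :=
        setLIntegral_mono' measurableSet_QQ hpt
    _ = ENNReal.ofReal A * ∫⁻ w in QQ, ((ENNReal.ofReal (1 - w.1) ^ (1/2:ℝ) * ‖G w‖ₑ) * S.indicator (fun _ => 1) w) :=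
        lintegral_const_mul'' _ (hfm.mul hgm)
    _ ≤ ENNReal.ofReal A * (Lam G ^ (1/2:ℝ) * ENNReal.ofReal ℓ) := by
        refine mul_le_mul_right ?_ _
        refine (ENNReal.lintegral_mul_le_Lp_mul_Lq _ Real.HolderConjugate.two_two hfm hgm).trans ?_
        refine mul_le_mul' (ENNReal.rpow_le_rpow (le_of_eq ?_) (by norm_num)) ?_
        · unfold Lam
          refine lintegral_congr fun w => ?_
          rw [ENNReal.mul_rpow_of_nonneg _ _ (by norm_num), ← ENNReal.rpow_mul]; norm_num
        · have : ∫⁻ w in QQ, S.indicator (fun _ => (1:ℝ≥0∞)) w ^ (2:ℝ) ≤ ENNReal.ofReal ℓ ^ (2:ℝ) := by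
            refine (setLIntegral_le_lintegral _ _).trans ?_
            have e : ∀ w, S.indicator (fun _ => (1:ℝ≥0∞)) w ^ (2:ℝ) = S.indicator (fun _ => (1:ℝ≥0∞)) w := by
              intro w; by_cases hw : w ∈ S <;> simp [hw]
            simp_rw [e]
            rw [lintegral_indicator hSm, setLIntegral_one, hS, Measure.volume_eq_prod, Measure.prod_prod, Real.volume_Ico, volume_dyadJ]
            rw [show (2:ℝ) = ((2:ℕ):ℝ) by norm_num, ENNReal.rpow_natCast, sq]
            simp [hℓ]
          refine (ENNReal.rpow_le_rpow this (by norm_num)).trans ?_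
          rw [← ENNReal.rpow_mul]; norm_num
    _ = _ := by
        rw [mul_comm (Lam G ^ (1/2:ℝ)), ← mul_assoc, ← ENNReal.ofReal_mul hA0, hA]
        congr 2
        rw [mul_assoc]
        congr 1
        nth_rewrite 2 [← Real.rpow_one ℓ]
        rw [← Real.rpow_add hℓ0]; congr 1; ring

theorem continuous_FS_circle {M : ℕ} {m : ℕ → E} {K : ℝ} (hm : ∀ j, ‖m j‖ ≤ K) {R : ℝ} (hR0 : 0 ≤ R) (hR : R < 1) :
    Continuous fun t : ℝ => FS M m (R * ev t) := by
  unfold FS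
  refine continuous_tsum (u := fun j => Cj M j * R^(j+1) * K) (fun j => ?_) ((Cj_summable M hR0 hR).mul_right K) (fun j t => ?_)
  · exact (continuous_const.mul ((continuous_const.mul continuous_ev).pow _)).smul continuous_const
  · have := norm_FS_term M m hm (R * ev t) j
    rwa [norm_mul (R:ℂ), norm_ev, mul_one, Complex.norm_real, Real.norm_of_nonneg hR0] at this

/-- atom constant -/
def CAt (M : ℕ) (p : ℝ) : ℝ≥0∞ := ENNReal.ofReal (CL M) ^ (p/2) * (96 * ENNReal.ofReal (4 * Real.pi)) ^ (1 - p/2) + ENNReal.ofReal (Cf M ^ p) * 96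

theorem CAt_ne_top (M : ℕ) {p : ℝ} (hp : 0 < p) (hp1 : p ≤ 1) : CAt M p ≠ ⊤ := by
  unfold CAt
  refine ENNReal.add_ne_top.2 ⟨ENNReal.mul_ne_top ?_ ?_, ENNReal.mul_ne_top ENNReal.ofReal_ne_top (by norm_num)⟩
  · exact ENNReal.rpow_ne_top_of_nonneg (by linarith) ENNReal.ofReal_ne_top
  · exact ENNReal.rpow_ne_top_of_nonneg (by linarith) (ENNReal.mul_ne_top (by norm_num) ENNReal.ofReal_ne_top)

theorem atom {p : ℝ} (hp : 0 < p) (hp1 : p ≤ 1) {M : ℕ} (hM : 1 ≤ M) (hMp : 2 ≤ ((M:ℝ)+1)*p) {G : ℝ × ℝ → E}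
    (hG : MemLp G 2 (volume.restrict QQ)) {m : ℕ}
    (hsupp : ∀ w ∈ QQ, G w ≠ 0 → 1 - len m ≤ w.1 ∧ w.2 ∈ dyadJ m)
    {R : ℝ} (hR0 : 0 ≤ R) (hR : R < 1) :
    ∫⁻ t in I₀, ‖FS M (mm M G) (R * ev t)‖ₑ ^ p ≤ CAt M p * Lam G ^ (p/2) * ENNReal.ofReal (len m) ^ (1 - p/2) := by
  set ℓ := len m with hℓ
  have hℓ0 : 0 < ℓ := len_pos m
  have hℓ1 : ℓ ≤ 1 := len_le_one m
  have hpi := Real.pi_pos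
  have hpi3 := Real.pi_gt_three
  obtain ⟨t0, ht0⟩ : (dyadJ m).Nonempty := by
    refine nonempty_of_measure_ne_zero (μ := volume) ?_
    rw [volume_dyadJ]; simpa using hℓ0
  set δ := 4 * Real.pi * ℓ with hδ
  have hδ0 : 0 < δ := by positivity
  have hker := ev_kernel (dyadJ_subset m ht0) hδ0
  set near : Set ℝ := {t | ‖ev t - ev t0‖ < δ} with hnear
  have hnm : MeasurableSet near := (isOpen_lt ((continuous_ev.sub continuous_const).norm) continuous_const).measurableSet
  have hFc := continuous_FS_circle (M := M) (mm_bound (M := M) (L2_intOn hG)) hR0 hR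
  have hFm : Measurable fun t : ℝ => ‖FS M (mm M G) (R * ev t)‖ₑ := hFc.enorm.measurable
  -- near
  have hvol : volume (near ∩ I₀) ≤ 96 * ENNReal.ofReal δ := by
    calc volume (near ∩ I₀) = ∫⁻ t in near ∩ I₀, 1 := by rw [setLIntegral_one]
      _ ≤ ∫⁻ t in near ∩ I₀, ENNReal.ofReal (δ / max (δ^2) (‖ev t - ev t0‖^2)) * ENNReal.ofReal δ := by
          refine setLIntegral_mono' (hnm.inter measurableSet_Ico) fun t ht => ?_
          have h1 : ‖ev t - ev t0‖^2 ≤ δ^2 := by have h := ht.1; have : ‖ev t - ev t0‖ < δ := h; gcongr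
          rw [max_eq_left h1, ← ENNReal.ofReal_mul (by positivity), ← ENNReal.ofReal_one]
          apply ENNReal.ofReal_le_ofReal
          apply le_of_eq; field_simp
      _ ≤ ∫⁻ t in I₀, ENNReal.ofReal (δ / max (δ^2) (‖ev t - ev t0‖^2)) * ENNReal.ofReal δ :=
          lintegral_mono_set Set.inter_subset_right
      _ ≤ 96 * ENNReal.ofReal δ := by
          rw [lintegral_mul_const' _ _ ENNReal.ofReal_ne_top]
          exact mul_le_mul' hker le_rfl
  have hN : ∫⁻ t in near ∩ I₀, ‖FS M (mm M G) (R * ev t)‖ₑ ^ p ≤ (ENNReal.ofReal (CL M) * Lam G)^(p/2) * (96 * ENNReal.ofReal δ)^(1 - p/2) := by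
    have hc : (2/p).HolderConjugate (2/(2-p)) := by
      rw [Real.holderConjugate_iff]
      refine ⟨by rw [lt_div_iff₀ hp]; linarith, ?_⟩
      have : 2 - p ≠ 0 := by linarith
      field_simp; ring
    have h := ENNReal.lintegral_mul_le_Lp_mul_Lq (volume.restrict (near ∩ I₀)) hc (f := fun t => ‖FS M (mm M G) (R * ev t)‖ₑ ^ p) (g := fun _ => 1) (hFm.pow_const p).aemeasurable aemeasurable_const
    simp only [Pi.mul_apply, mul_one, ENNReal.one_rpow, lintegral_one, Measure.restrict_apply_univ] at h
    refine h.trans (mul_le_mul' ?_ ?_)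
    · rw [show 1 / (2/p) = p/2 by field_simp]
      refine ENNReal.rpow_le_rpow ?_ (by linarith)
      refine le_trans ?_ (FS_L2 hM hG hR0 hR)
      refine (lintegral_mono_set Set.inter_subset_right).trans (le_of_eq (lintegral_congr fun t => ?_))
      rw [← ENNReal.rpow_mul]; congr 1; field_simp
    · rw [show 1 / (2/(2-p)) = 1 - p/2 by have : 2 - p ≠ 0 := by linarith
                                          field_simp]
      exact ENNReal.rpow_le_rpow hvol (by linarith)
  have hCf := Cf_pos M
  -- far
  have hF : ∫⁻ t in I₀ \ near, ‖FS M (mm M G) (R * ev t)‖ₑ ^ p ≤ (ENNReal.ofReal (Cf M ^ p) * 96) * Lam G ^ (p/2) * ENNReal.ofReal ℓ ^ (1 - p/2) := by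
    have hpt : ∀ t ∈ I₀ \ near, ‖FS M (mm M G) (R * ev t)‖ₑ ^ p ≤ ENNReal.ofReal (δ / max (δ^2) (‖ev t - ev t0‖^2)) * (ENNReal.ofReal (Cf M ^ p) * Lam G ^ (p/2) * ENNReal.ofReal ℓ ^ (1 - p/2)) := by
      intro t ht
      have hfar : δ ≤ ‖ev t - ev t0‖ := not_lt.1 ht.2
      have h := FS_far hM hG ht0 hsupp hR0 hR (t := t) hfar
      set φ := ‖ev t - ev t0‖ with hφ
      have hφ0 : 0 < φ := hδ0.trans_le hfar
      refine (ENNReal.rpow_le_rpow h hp.le).trans ?_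
      rw [ENNReal.mul_rpow_of_nonneg _ _ hp.le, ← ENNReal.rpow_mul, show 1/2*p = p/2 by ring, max_eq_right (by gcongr)]
      rw [mul_assoc (ENNReal.ofReal (Cf M ^ p)), mul_comm (Lam G ^ (p/2)) (ENNReal.ofReal _ ^ _), ← mul_assoc (ENNReal.ofReal (Cf M ^ p)), ← mul_assoc]
      refine mul_le_mul' ?_ le_rfl
      rw [ENNReal.ofReal_rpow_of_pos (by positivity), ENNReal.ofReal_rpow_of_pos hℓ0, ← ENNReal.ofReal_mul (by positivity), ← ENNReal.ofReal_mul (by positivity)]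
      apply ENNReal.ofReal_le_ofReal
      rw [Real.mul_rpow (by positivity) (by positivity), Real.div_rpow hCf.le (by positivity), ← Real.rpow_natCast, ← Real.rpow_mul hφ0.le, ← Real.rpow_mul hℓ0.le]
      push_cast
      set q := ((M:ℝ)+1)*p with hq
      have e1 : φ^q = φ^(2:ℕ) * φ^(q - 2) := by
        rw [← Real.rpow_natCast, ← Real.rpow_add hφ0]; congr 1; push_cast; ring
      have e2 : ℓ^(((M:ℝ)+1/2)*p) = ℓ^(q-2) * (ℓ * ℓ^(1-p/2)) := by
        nth_rewrite 3 [← Real.rpow_one ℓ]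
        rw [← Real.rpow_add hℓ0, ← Real.rpow_add hℓ0]; congr 1; rw [hq]; ring
      have e3 : ℓ^(q-2) ≤ φ^(q-2) := by
        apply Real.rpow_le_rpow hℓ0.le _ (by linarith)
        refine le_trans ?_ hfar
        rw [hδ]; nlinarith
      have e4 : ℓ ≤ δ := by rw [hδ]; nlinarith
      rw [e1, e2]
      have hq1 : 0 < φ^(q-2) := by positivity
      have hq2 : 0 < ℓ^(q-2) := by positivity
      have hq3 : 0 < ℓ^(1-p/2) := by positivity
      have hq4 : 0 < Cf M ^ p := by positivity
      calc Cf M ^ p / (φ^2 * φ^(q-2)) * (ℓ^(q-2) * (ℓ * ℓ^(1-p/2))) = (ℓ^(q-2) / φ^(q-2)) * (ℓ / φ^2 * (Cf M ^ p * ℓ^(1-p/2))) := by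
            field_simp
        _ ≤ 1 * (δ / φ^2 * (Cf M ^ p * ℓ^(1-p/2))) := by
            refine mul_le_mul ((div_le_one hq1).2 e3) ?_ (by positivity) (by norm_num)
            gcongr
        _ = _ := by rw [one_mul]
    calc ∫⁻ t in I₀ \ near, ‖FS M (mm M G) (R * ev t)‖ₑ ^ p ≤ ∫⁻ t in I₀ \ near, ENNReal.ofReal (δ / max (δ^2) (‖ev t - ev t0‖^2)) * (ENNReal.ofReal (Cf M ^ p) * Lam G ^ (p/2) * ENNReal.ofReal ℓ ^ (1 - p/2)) :=
          setLIntegral_mono' (measurableSet_Ico.diff hnm) hpt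
      _ ≤ ∫⁻ t in I₀, ENNReal.ofReal (δ / max (δ^2) (‖ev t - ev t0‖^2)) * (ENNReal.ofReal (Cf M ^ p) * Lam G ^ (p/2) * ENNReal.ofReal ℓ ^ (1 - p/2)) :=
          lintegral_mono_set Set.diff_subset
      _ = (∫⁻ t in I₀, ENNReal.ofReal (δ / max (δ^2) (‖ev t - ev t0‖^2))) * (ENNReal.ofReal (Cf M ^ p) * Lam G ^ (p/2) * ENNReal.ofReal ℓ ^ (1 - p/2)) := by
          refine lintegral_mul_const _ ?_
          have : Continuous fun t : ℝ => ‖ev t - ev t0‖ := (continuous_ev.sub continuous_const).norm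
          have := this.measurable
          fun_prop
      _ ≤ 96 * (ENNReal.ofReal (Cf M ^ p) * Lam G ^ (p/2) * ENNReal.ofReal ℓ ^ (1 - p/2)) := mul_le_mul' hker le_rfl
      _ = _ := by ring
  have hsplit : ∫⁻ t in I₀, ‖FS M (mm M G) (R * ev t)‖ₑ ^ p = (∫⁻ t in near ∩ I₀, ‖FS M (mm M G) (R * ev t)‖ₑ ^ p) + ∫⁻ t in I₀ \ near, ‖FS M (mm M G) (R * ev t)‖ₑ ^ p := by
    rw [Set.inter_comm, lintegral_inter_add_diff _ _ hnm]
  rw [hsplit]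
  refine (add_le_add hN hF).trans (le_of_eq ?_)
  unfold CAt
  rw [ENNReal.mul_rpow_of_nonneg _ _ (by linarith), hδ, ENNReal.ofReal_mul (by positivity), ← mul_assoc 96, ENNReal.mul_rpow_of_nonneg _ _ (by linarith : 0 ≤ 1 - p/2)]
  ring

end
end HPTL
end

section
namespace HPTL
set_option linter.all false
set_option linter.unusedSectionVars false

/-- geometric constant -/
def Cst (p : ℝ) : ℝ := (4:ℝ)^(p/2) * (1 - ((4:ℝ)^(p/2))⁻¹)⁻¹

theorem q_gt {p : ℝ} (hp : 0 < p) : 1 < (4:ℝ)^(p/2) := Real.one_lt_rpow (by norm_num) (by linarith)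

theorem Cst_nonneg {p : ℝ} (hp : 0 < p) : 0 ≤ Cst p := by
  have := q_gt hp
  unfold Cst
  have : ((4:ℝ)^(p/2))⁻¹ < 1 := inv_lt_one_of_one_lt₀ this
  have : 0 < 1 - ((4:ℝ)^(p/2))⁻¹ := by linarith
  positivity

theorem geom_int {q : ℝ} (hq : 1 < q) (K : Finset ℤ) (L : ℤ) (hK : ∀ k ∈ K, k ≤ L) :
    ∑ k ∈ K, q^(k+1) ≤ q^L * (q * (1 - q⁻¹)⁻¹) := by
  have hq0 : 0 < q := by linarith
  have hi : Set.InjOn (fun k : ℤ => (L - k).toNat) K := by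
    intro a ha b hb h
    have h1 := hK a ha; have h2 := hK b hb
    simp only at h
    omega
  have e : ∀ k ∈ K, q^(k+1) = q^L * (q * (q⁻¹)^((L-k).toNat)) := by
    intro k hk
    have h1 := hK k hk
    have h2 : (((L-k).toNat : ℕ) : ℤ) = L - k := Int.toNat_of_nonneg (by omega)
    rw [← zpow_natCast, h2, inv_zpow, ← zpow_neg]
    rw [← zpow_one_add₀ hq0.ne', ← zpow_add₀ hq0.ne']
    congr 1; ring
  rw [Finset.sum_congr rfl e, ← Finset.mul_sum, ← Finset.mul_sum]
  have hg : q⁻¹ < 1 := inv_lt_one_of_one_lt₀ hq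
  have hs := summable_geometric_of_lt_one (r := q⁻¹) (by positivity) hg
  have : ∑ k ∈ K, (q⁻¹)^((L-k).toNat) ≤ (1 - q⁻¹)⁻¹ := by
    rw [← tsum_geometric_of_lt_one (by positivity) hg, ← Finset.sum_image (f := fun i => (q⁻¹)^i) hi]
    exact hs.sum_le_tsum _ (fun i _ => by positivity)
  gcongr

open Classical in
theorem stopping {p : ℝ} (hp : 0 < p) (e : ℕ → ℝ) (he : ∀ n, 0 ≤ e n) (N : ℕ) :
    ∃ (st : ℕ → ℕ) (a : ℕ → ℝ), (∀ m, 0 ≤ a m) ∧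
      (∀ n ∈ Finset.Ico 1 N, e n ≠ 0 → st n ∈ Finset.Ico 1 N ∧ dyadJ n ⊆ dyadJ (st n)) ∧
      (∀ m t, ∑ n ∈ (Finset.Ico 1 N).filter (fun n => (e n ≠ 0 ∧ st n = m) ∧ t ∈ dyadJ n), e n ≤ a m) ∧
      (∀ t, ∑ m ∈ (((Finset.Ico 1 N).filter (fun n => e n ≠ 0)).image st).filter (fun m => t ∈ dyadJ m), a m ^ (p/2) ≤
        Cst p * (∑ n ∈ (Finset.Ico 1 N).filter (fun n => t ∈ dyadJ n), e n) ^ (p/2)) := by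
  set s : ℕ → ℝ := fun n => ∑ m ∈ (Finset.Ico 1 N).filter (fun m => dyadJ n ⊆ dyadJ m), e m with hs
  set κ : ℕ → ℤ := fun n => Int.log 4 (s n) with hκ
  set rel : ℕ → ℕ → Prop := fun m n => m ∈ Finset.Ico 1 N ∧ dyadJ n ⊆ dyadJ m ∧ 0 < s m ∧ κ m = κ n with hrel
  set st : ℕ → ℕ := fun n => sInf {m | rel m n} with hst
  have hspos : ∀ n ∈ Finset.Ico 1 N, e n ≠ 0 → 0 < s n := by
    intro n hn h0
    have h1 : 0 < e n := lt_of_le_of_ne (he n) (Ne.symm h0)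
    refine h1.trans_le (Finset.single_le_sum (f := e) (fun i _ => he i) ?_)
    exact Finset.mem_filter.2 ⟨hn, subset_rfl⟩
  have hself : ∀ n ∈ Finset.Ico 1 N, 0 < s n → rel n n := fun n hn h => ⟨hn, subset_rfl, h, rfl⟩
  have hstm : ∀ n ∈ Finset.Ico 1 N, 0 < s n → rel (st n) n := fun n hn h =>
    Nat.sInf_mem (s := {m | rel m n}) ⟨n, hself n hn h⟩
  have hstle : ∀ m n, rel m n → st n ≤ m := fun m n h => Nat.sInf_le h
  have hidem : ∀ n ∈ Finset.Ico 1 N, 0 < s n → ∀ m, rel m (st n) → st n ≤ m := by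
    intro n hn h m hm
    obtain ⟨a1, a2, a3, a4⟩ := hstm n hn h
    obtain ⟨b1, b2, b3, b4⟩ := hm
    exact hstle m n ⟨b1, a2.trans b2, b3, b4.trans a4⟩
  refine ⟨st, fun m => (4:ℝ)^(κ m + 1), fun m => by positivity, ?_, ?_, ?_⟩
  · intro n hn h0
    obtain ⟨a1, a2, a3, a4⟩ := hstm n hn (hspos n hn h0)
    exact ⟨a1, a2⟩
  · intro m t
    set T := (Finset.Ico 1 N).filter (fun n => (e n ≠ 0 ∧ st n = m) ∧ t ∈ dyadJ n) with hT
    rcases T.eq_empty_or_nonempty with h | h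
    · rw [h, Finset.sum_empty]; positivity
    · set n0 := T.max' h with hn0
      have hm0 : n0 ∈ T := Finset.max'_mem _ _
      obtain ⟨c1, ⟨c2, c3⟩, c4⟩ := Finset.mem_filter.1 hm0
      have h1 : ∑ n ∈ T, e n ≤ s n0 := by
        refine Finset.sum_le_sum_of_subset_of_nonneg ?_ (fun i _ _ => he i)
        intro k hk
        obtain ⟨d1, ⟨d2, d3⟩, d4⟩ := Finset.mem_filter.1 hk
        refine Finset.mem_filter.2 ⟨d1, ?_⟩
        exact dyadJ_nested (by have := (Finset.mem_Ico.1 d1).1; omega) (Finset.le_max' _ _ hk) d4 c4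
      have h2 : s n0 < (4:ℝ)^(κ n0 + 1) := by
        have := Int.lt_zpow_succ_log_self (b := 4) (by norm_num) (s n0)
        exact_mod_cast this
      have h3 : κ n0 = κ m := by
        rw [← c3]; exact (hstm n0 c1 (hspos n0 c1 c2)).2.2.2.symm
      show _ ≤ (4:ℝ)^(κ m + 1)
      rw [← h3]
      exact h1.trans h2.le
  · intro t
    set D := ∑ n ∈ (Finset.Ico 1 N).filter (fun n => t ∈ dyadJ n), e n with hD
    set T := (((Finset.Ico 1 N).filter (fun n => e n ≠ 0)).image st).filter (fun m => t ∈ dyadJ m) with hT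
    have hD0 : 0 ≤ D := Finset.sum_nonneg fun i _ => he i
    rcases T.eq_empty_or_nonempty with h | ⟨m1, hm1⟩
    · rw [h, Finset.sum_empty]
      have := Cst_nonneg hp
      positivity
    have hTm : ∀ m ∈ T, m ∈ Finset.Ico 1 N ∧ 0 < s m ∧ t ∈ dyadJ m ∧ ∀ m', rel m' m → m ≤ m' := by
      intro m hm
      obtain ⟨c1, c2⟩ := Finset.mem_filter.1 hm
      obtain ⟨n, hn, rfl⟩ := Finset.mem_image.1 c1
      obtain ⟨d1, d2⟩ := Finset.mem_filter.1 hn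
      have hr := hstm n d1 (hspos n d1 d2)
      exact ⟨hr.1, hr.2.2.1, c2, hidem n d1 (hspos n d1 d2)⟩
    have hsD : ∀ m ∈ T, s m ≤ D := by
      intro m hm
      obtain ⟨a1, a2, a3, a4⟩ := hTm m hm
      refine Finset.sum_le_sum_of_subset_of_nonneg ?_ (fun i _ _ => he i)
      intro k hk
      obtain ⟨d1, d2⟩ := Finset.mem_filter.1 hk
      exact Finset.mem_filter.2 ⟨d1, d2 a3⟩
    have hDpos : 0 < D := (hTm m1 hm1).2.1.trans_le (hsD m1 hm1)
    have hinj : Set.InjOn κ T := by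
      have key : ∀ a ∈ T, ∀ b ∈ T, κ a = κ b → a ≤ b → b ≤ a := by
        intro a ha b hb hab hle
        obtain ⟨a1, a2, a3, a4⟩ := hTm a ha
        obtain ⟨b1, b2, b3, b4⟩ := hTm b hb
        exact b4 a ⟨a1, dyadJ_nested (by have := (Finset.mem_Ico.1 a1).1; omega) hle a3 b3, a2, hab⟩
      intro a ha b hb hab
      rcases le_total a b with h | h
      · exact le_antisymm h (key a ha b hb hab h)
      · exact le_antisymm (key b hb a ha hab.symm h) h
    have hL : ∀ k ∈ T.image κ, k ≤ Int.log 4 D := by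
      intro k hk
      obtain ⟨m, hm, rfl⟩ := Finset.mem_image.1 hk
      exact Int.log_mono_right (hTm m hm).2.1 (hsD m hm)
    have hg := geom_int (q_gt hp) (T.image κ) (Int.log 4 D) hL
    rw [Finset.sum_image hinj] at hg
    have e1 : ∀ k : ℤ, ((4:ℝ)^k)^(p/2) = ((4:ℝ)^(p/2))^k := by
      intro k
      rw [← Real.rpow_intCast, ← Real.rpow_intCast, ← Real.rpow_mul (by norm_num), ← Real.rpow_mul (by norm_num), mul_comm]
    simp_rw [e1]
    refine hg.trans ?_
    rw [mul_comm]
    unfold Cst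
    have := Cst_nonneg hp
    unfold Cst at this
    refine mul_le_mul_of_nonneg_left ?_ this
    rw [← e1]
    apply Real.rpow_le_rpow (by positivity) _ (by linarith)
    have := Int.zpow_log_le_self (b := 4) (by norm_num) hDpos
    exact_mod_cast this

end HPTL
end

section
namespace HPTL
set_option linter.all false
set_option linter.unusedSectionVars false

theorem rpow_sum_le {ι : Type*} {p : ℝ} (hp : 0 < p) (hp1 : p ≤ 1) (S : Finset ι) (f : ι → ℝ≥0∞) :
    (∑ i ∈ S, f i) ^ p ≤ ∑ i ∈ S, f i ^ p := by
  classical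
  induction S using Finset.induction_on with
  | empty => simp [hp]
  | insert a S ha ih =>
    rw [Finset.sum_insert ha, Finset.sum_insert ha]
    exact (ENNReal.rpow_add_le_add_rpow _ _ hp.le hp1).trans (add_le_add le_rfl ih)

theorem enorm_sum_rpow_le {E : Type*} [NormedAddCommGroup E] {ι : Type*} {p : ℝ} (hp : 0 < p) (hp1 : p ≤ 1) (S : Finset ι) (f : ι → E) :
    ‖∑ i ∈ S, f i‖ₑ ^ p ≤ ∑ i ∈ S, ‖f i‖ₑ ^ p :=
  (ENNReal.rpow_le_rpow (enorm_sum_le _ _) hp.le).trans (rpow_sum_le hp hp1 S _)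

theorem lint_ind_dyadJ (n : ℕ) (c : ℝ≥0∞) : ∫⁻ t in I₀, (dyadJ n).indicator (fun _ => c) t = c * ENNReal.ofReal (len n) := by
  rw [lintegral_indicator (measurableSet_dyadJ n), Measure.restrict_restrict (measurableSet_dyadJ n),
    Set.inter_eq_left.2 (dyadJ_subset n), setLIntegral_const, volume_dyadJ]

variable {E : Type*} [NormedAddCommGroup E] [InnerProductSpace ℂ E] [CompleteSpace E]

theorem mm_zero_of_ae {M : ℕ} {G : ℝ × ℝ → E} (h : G =ᵐ[volume.restrict QQ] 0) (j : ℕ) : mm M G j = 0 := by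
  unfold mm
  rw [integral_congr_ae (g := fun _ => (0:E)), integral_zero]
  filter_upwards [h] with z hz
  rw [hz]; simp

theorem mm_sum {M : ℕ} {ι : Type*} (S : Finset ι) {G : ι → ℝ × ℝ → E} (hG : ∀ i ∈ S, IntegrableOn (G i) QQ) (j : ℕ) :
    mm M (fun z => ∑ i ∈ S, G i z) j = ∑ i ∈ S, mm M (G i) j := by
  unfold mm
  simp_rw [Finset.smul_sum]
  exact integral_finset_sum S fun i hi => wt_integrable M j (hG i hi)

theorem FS_sum {M : ℕ} {ι : Type*} (S : Finset ι) {m : ι → ℕ → E} {K : ι → ℝ} (hm : ∀ i ∈ S, ∀ j, ‖m i j‖ ≤ K i) {z : ℂ} (hz : ‖z‖ < 1) :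
    FS M (fun j => ∑ i ∈ S, m i j) z = ∑ i ∈ S, FS M (m i) z := by
  have := hasSum_sum (s := S) fun i hi => FS_hasSum M (hm i hi) hz
  rw [← this.tsum_eq]
  unfold FS
  simp_rw [Finset.smul_sum]

/-- box energy -/
def eg (g : ℕ → ℝ × ℝ → E) (n : ℕ) : ℝ≥0∞ := ∫⁻ z in box n, ‖g n z‖ₑ ^ (2:ℝ)

/-- localised -/
def Hb (g : ℕ → ℝ × ℝ → E) (n : ℕ) : ℝ × ℝ → E := (box n).indicator (g n)

theorem Hb_memLp {g : ℕ → ℝ × ℝ → E} (hg : ∀ n, MemLp (g n) 2 (volume.restrict QQ)) (n : ℕ) :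
    MemLp (Hb g n) 2 (volume.restrict QQ) := (hg n).indicator (measurableSet_box n)

theorem lint_box (n : ℕ) (f : ℝ × ℝ → ℝ≥0∞) : ∫⁻ z in QQ, (box n).indicator f z = ∫⁻ z in box n, f z := by
  rw [lintegral_indicator (measurableSet_box n), Measure.restrict_restrict (measurableSet_box n),
    Set.inter_eq_left.2 (box_subset n)]

theorem eg_lt_top {g : ℕ → ℝ × ℝ → E} (hg : ∀ n, MemLp (g n) 2 (volume.restrict QQ)) (n : ℕ) : eg g n < ⊤ := by
  unfold eg
  refine (lintegral_mono_set (box_subset n)).trans_lt ?_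
  have := lintegral_rpow_enorm_lt_top_of_eLpNorm_lt_top (by norm_num) (by norm_num) (hg n).2
  simpa using this

theorem Hb_ae {g : ℕ → ℝ × ℝ → E} (hg : ∀ n, MemLp (g n) 2 (volume.restrict QQ)) {n : ℕ} (h : eg g n = 0) :
    Hb g n =ᵐ[volume.restrict QQ] 0 := by
  unfold eg at h
  rw [← lint_box, lintegral_eq_zero_iff' (((hg n).1.enorm.pow_const _).indicator (measurableSet_box n))] at h
  filter_upwards [h] with z hz
  unfold Hb
  by_cases hb : z ∈ box n
  · rw [Set.indicator_of_mem hb] at hz ⊢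
    simpa using hz
  · rw [Set.indicator_of_notMem hb]; rfl

theorem sum_Hb_eq (g : ℕ → ℝ × ℝ → E) (S : Finset ℕ) {n : ℕ} (hn : n ∈ S) {z : ℝ × ℝ} (hz : z ∈ box n) :
    ∑ i ∈ S, Hb g i z = g n z := by
  rw [Finset.sum_eq_single_of_mem n hn]
  · unfold Hb; rw [Set.indicator_of_mem hz]
  · intro k _ hk
    unfold Hb
    rw [Set.indicator_of_notMem]
    exact Set.disjoint_left.1 (box_disj hk.symm) hz

theorem sum_Hb_ne (g : ℕ → ℝ × ℝ → E) (S : Finset ℕ) {z : ℝ × ℝ} (h : ∑ i ∈ S, Hb g i z ≠ 0) : ∃ n ∈ S, z ∈ box n := by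
  by_contra hc
  push Not at hc
  exact h (Finset.sum_eq_zero fun i hi => by unfold Hb; rw [Set.indicator_of_notMem (hc i hi)])

theorem Lam_sum {g : ℕ → ℝ × ℝ → E} (hg : ∀ n, MemLp (g n) 2 (volume.restrict QQ)) (S : Finset ℕ) :
    Lam (fun z => ∑ i ∈ S, Hb g i z) ≤ ∑ n ∈ S, eg g n * ENNReal.ofReal (len n) := by
  unfold Lam
  have h1 : ∀ z ∈ QQ, ENNReal.ofReal (1 - z.1) * ‖∑ i ∈ S, Hb g i z‖ₑ ^ (2:ℝ) ≤
      ∑ n ∈ S, (box n).indicator (fun z => ENNReal.ofReal (len n) * ‖g n z‖ₑ ^ (2:ℝ)) z := by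
    intro z hz
    by_cases h0 : ∑ i ∈ S, Hb g i z = 0
    · rw [h0]; simp
    obtain ⟨n, hn, hb⟩ := sum_Hb_ne g S h0
    rw [sum_Hb_eq g S hn hb]
    refine le_trans ?_ (Finset.single_le_sum (f := fun n => (box n).indicator (fun z => ENNReal.ofReal (len n) * ‖g n z‖ₑ ^ (2:ℝ)) z) (fun i _ => zero_le) hn)
    rw [Set.indicator_of_mem hb]
    obtain ⟨_, hr, _⟩ := mem_box hb
    exact mul_le_mul' (ENNReal.ofReal_le_ofReal (Rad_bounds hr).2.2.2) le_rfl
  refine (setLIntegral_mono' measurableSet_QQ h1).trans ?_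
  rw [lintegral_finset_sum']
  · refine Finset.sum_le_sum fun n _ => ?_
    rw [lint_box, lintegral_const_mul' _ _ ENNReal.ofReal_ne_top, mul_comm]
    exact le_rfl
  · intro n _
    exact (((hg n).1.enorm.pow_const _).const_mul _).indicator (measurableSet_box n)

theorem Rad_ge {n : ℕ} {r : ℝ} (h : r ∈ Rad n) : 1 - len n ≤ r := h.1

open Classical in
theorem finite_synth {p : ℝ} (hp : 0 < p) (hp1 : p ≤ 1) {M : ℕ} (hM : 1 ≤ M) (hMp : 2 ≤ ((M:ℝ)+1)*p)
    {g : ℕ → ℝ × ℝ → E} (hg : ∀ n, MemLp (g n) 2 (volume.restrict QQ)) (N : ℕ) {R : ℝ} (hR0 : 0 ≤ R) (hR : R < 1) :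
    ∫⁻ t in I₀, ‖∑ n ∈ Finset.Ico 1 N, FS M (mm M (Hb g n)) (R * ev t)‖ₑ ^ p ≤
      CAt M p * ENNReal.ofReal (Cst p) * ∫⁻ t in I₀, (∑ n ∈ Finset.Ico 1 N, (dyadJ n).indicator (fun _ => eg g n) t) ^ (p/2) := by
  have hp2 : 0 < p / 2 := by positivity
  set e : ℕ → ℝ := fun n => (eg g n).toReal with he
  have hef : ∀ n, eg g n = ENNReal.ofReal (e n) := fun n => (ENNReal.ofReal_toReal (eg_lt_top hg n).ne).symm
  have he0 : ∀ n, 0 ≤ e n := fun n => ENNReal.toReal_nonneg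
  obtain ⟨st, a, ha, h1, h2, h3⟩ := stopping hp e he0 N
  set A := (Finset.Ico 1 N).filter (fun n => e n ≠ 0) with hA
  set T := A.image st with hT
  set S : ℕ → Finset ℕ := fun m => A.filter (fun n => st n = m) with hS
  set G : ℕ → ℝ × ℝ → E := fun m z => ∑ i ∈ S m, Hb g i z with hGd
  have hHi : ∀ n, IntegrableOn (Hb g n) QQ := fun n => L2_intOn (Hb_memLp hg n)
  have hGL : ∀ m, MemLp (G m) 2 (volume.restrict QQ) := fun m => memLp_finset_sum _ fun i _ => Hb_memLp hg i
  have hnz : ∀ t : ℝ, ‖(R:ℂ) * ev t‖ < 1 := by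
    intro t; rw [norm_mul, norm_ev, Complex.norm_real, Real.norm_of_nonneg hR0, mul_one]; exact hR
  -- regrouping
  have hre : ∀ t : ℝ, ∑ n ∈ Finset.Ico 1 N, FS M (mm M (Hb g n)) (R * ev t) = ∑ m ∈ T, FS M (mm M (G m)) (R * ev t) := by
    intro t
    have r1 : ∑ n ∈ Finset.Ico 1 N, FS M (mm M (Hb g n)) (R * ev t) = ∑ n ∈ A, FS M (mm M (Hb g n)) (R * ev t) := by
      rw [hA, Finset.sum_filter_of_ne]
      intro n hn hne h0
      apply hne
      have : eg g n = 0 := by rw [hef, h0]; simp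
      have hz := mm_zero_of_ae (M := M) (Hb_ae hg this)
      unfold FS
      simp_rw [hz]; simp
    rw [r1, ← Finset.sum_fiberwise_of_maps_to (g := st) (t := T) (fun n hn => Finset.mem_image_of_mem st hn)]
    refine Finset.sum_congr rfl fun m _ => ?_
    have r2 : mm M (G m) = fun j => ∑ i ∈ S m, mm M (Hb g i) j := by
      funext j; exact mm_sum (S m) (fun i _ => hHi i) j
    rw [r2, FS_sum (S m) (fun i _ j => mm_bound (hHi i) j) (hnz t)]
  simp_rw [hre]
  have hTm : ∀ m ∈ T, m ∈ Finset.Ico 1 N := by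
    intro m hm
    obtain ⟨n, hn, rfl⟩ := Finset.mem_image.1 hm
    obtain ⟨d1, d2⟩ := Finset.mem_filter.1 hn
    exact (h1 n d1 d2).1
  have hLam : ∀ m, Lam (G m) ≤ ENNReal.ofReal (a m) * ENNReal.ofReal (len m) := by
    intro m
    refine (Lam_sum hg (S m)).trans ?_
    rw [← lint_ind_dyadJ]
    simp_rw [← lint_ind_dyadJ]
    rw [← lintegral_finset_sum _ fun n _ => measurable_const.indicator (measurableSet_dyadJ n)]
    refine lintegral_mono fun t => ?_
    have hsub : ∀ n ∈ S m, dyadJ n ⊆ dyadJ m := by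
      intro n hn
      obtain ⟨d1, d2⟩ := Finset.mem_filter.1 hn
      obtain ⟨d3, d4⟩ := Finset.mem_filter.1 d1
      rw [← d2]; exact (h1 n d3 d4).2
    by_cases ht : t ∈ dyadJ m
    · rw [Set.indicator_of_mem ht]
      have h2' := h2 m t
      have : ∑ n ∈ S m, (dyadJ n).indicator (fun _ => eg g n) t = ENNReal.ofReal (∑ n ∈ (Finset.Ico 1 N).filter (fun n => (e n ≠ 0 ∧ st n = m) ∧ t ∈ dyadJ n), e n) := by
        rw [ENNReal.ofReal_sum_of_nonneg fun i _ => he0 i]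
        have e1 : (Finset.Ico 1 N).filter (fun n => (e n ≠ 0 ∧ st n = m) ∧ t ∈ dyadJ n) = (S m).filter (fun n => t ∈ dyadJ n) := by
          ext n; simp only [hS, hA, Finset.mem_filter]; tauto
        rw [e1, Finset.sum_filter (s := S m) (p := fun n => t ∈ dyadJ n)]
        refine Finset.sum_congr rfl fun n _ => ?_
        rw [Set.indicator_apply, hef]
      rw [this]
      exact ENNReal.ofReal_le_ofReal h2'
    · rw [Finset.sum_eq_zero]
      · exact zero_le
      · intro n hn
        rw [Set.indicator_of_notMem fun h => ht (hsub n hn h)]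
  have hAt : ∀ m ∈ T, ∫⁻ t in I₀, ‖FS M (mm M (G m)) (R * ev t)‖ₑ ^ p ≤ CAt M p * (ENNReal.ofReal (a m ^ (p/2)) * ENNReal.ofReal (len m)) := by
    intro m hm
    have hs : ∀ w ∈ QQ, G m w ≠ 0 → 1 - len m ≤ w.1 ∧ w.2 ∈ dyadJ m := by
      intro w _ hw
      obtain ⟨n, hn, hb⟩ := sum_Hb_ne g (S m) hw
      obtain ⟨d1, d2⟩ := Finset.mem_filter.1 hn
      obtain ⟨d3, d4⟩ := Finset.mem_filter.1 d1
      obtain ⟨b1, b2, b3⟩ := mem_box hb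
      have hsub := (h1 n d3 d4).2
      rw [d2] at hsub
      refine ⟨le_trans ?_ (Rad_ge b2), hsub b3⟩
      have hv := measure_mono (μ := volume) hsub
      rw [volume_dyadJ, volume_dyadJ, ENNReal.ofReal_le_ofReal_iff (len_pos m).le] at hv
      linarith
    refine (atom hp hp1 hM hMp (hGL m) hs hR0 hR).trans ?_
    rw [mul_assoc]
    refine mul_le_mul' le_rfl ?_
    have hl : ENNReal.ofReal (len m) ≠ 0 := by simpa using len_pos m
    calc Lam (G m) ^ (p/2) * ENNReal.ofReal (len m) ^ (1 - p/2) ≤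
        (ENNReal.ofReal (a m) * ENNReal.ofReal (len m)) ^ (p/2) * ENNReal.ofReal (len m) ^ (1 - p/2) :=
          mul_le_mul' (ENNReal.rpow_le_rpow (hLam m) hp2.le) le_rfl
      _ = _ := by
          rw [ENNReal.mul_rpow_of_nonneg _ _ hp2.le, mul_assoc, ← ENNReal.rpow_add _ _ hl ENNReal.ofReal_ne_top,
            ENNReal.ofReal_rpow_of_nonneg (ha m) hp2.le]
          congr 1
          rw [show p/2 + (1 - p/2) = 1 by ring, ENNReal.rpow_one]
  calc ∫⁻ t in I₀, ‖∑ m ∈ T, FS M (mm M (G m)) (R * ev t)‖ₑ ^ p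
      ≤ ∫⁻ t in I₀, ∑ m ∈ T, ‖FS M (mm M (G m)) (R * ev t)‖ₑ ^ p := lintegral_mono fun t => enorm_sum_rpow_le hp hp1 _ _
    _ = ∑ m ∈ T, ∫⁻ t in I₀, ‖FS M (mm M (G m)) (R * ev t)‖ₑ ^ p := by
        refine lintegral_finset_sum' _ fun m _ => ?_
        exact ((continuous_FS_circle (fun j => mm_bound (L2_intOn (hGL m)) j) hR0 hR).enorm.measurable.pow_const _).aemeasurable
    _ ≤ ∑ m ∈ T, CAt M p * (ENNReal.ofReal (a m ^ (p/2)) * ENNReal.ofReal (len m)) := Finset.sum_le_sum hAt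
    _ = CAt M p * ∫⁻ t in I₀, ∑ m ∈ T, (dyadJ m).indicator (fun _ => ENNReal.ofReal (a m ^ (p/2))) t := by
        rw [← Finset.mul_sum, lintegral_finset_sum _ fun n _ => measurable_const.indicator (measurableSet_dyadJ n)]
        simp_rw [lint_ind_dyadJ]
    _ ≤ CAt M p * ∫⁻ t in I₀, ENNReal.ofReal (Cst p) * (∑ n ∈ Finset.Ico 1 N, (dyadJ n).indicator (fun _ => eg g n) t) ^ (p/2) := by
        refine mul_le_mul' le_rfl (lintegral_mono fun t => ?_)
        have e1 : ∑ m ∈ T, (dyadJ m).indicator (fun _ => ENNReal.ofReal (a m ^ (p/2))) t =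
            ENNReal.ofReal (∑ m ∈ T.filter (fun m => t ∈ dyadJ m), a m ^ (p/2)) := by
          rw [ENNReal.ofReal_sum_of_nonneg fun i _ => Real.rpow_nonneg (ha i) _, Finset.sum_filter]
          refine Finset.sum_congr rfl fun n _ => ?_
          rw [Set.indicator_apply]
        have e2 : ∑ n ∈ Finset.Ico 1 N, (dyadJ n).indicator (fun _ => eg g n) t =
            ENNReal.ofReal (∑ n ∈ (Finset.Ico 1 N).filter (fun n => t ∈ dyadJ n), e n) := by
          rw [ENNReal.ofReal_sum_of_nonneg fun i _ => he0 i, Finset.sum_filter]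
          refine Finset.sum_congr rfl fun n _ => ?_
          rw [Set.indicator_apply, hef]
        rw [e1, e2, ENNReal.ofReal_rpow_of_nonneg (Finset.sum_nonneg fun i _ => he0 i) hp2.le, ← ENNReal.ofReal_mul (Cst_nonneg hp)]
        exact ENNReal.ofReal_le_ofReal (h3 t)
    _ = _ := by
        rw [lintegral_const_mul' _ _ ENNReal.ofReal_ne_top, mul_assoc]

end HPTL
end

section
namespace HPTL
set_option linter.all false
set_option linter.unusedSectionVars false

theorem len_le_div (n : ℕ) : len n ≤ 2 / ((n:ℝ)+1) := by
  have hl := len_pos n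
  have h : n + 1 ≤ 2 ^ (lev n + 1) := by have := lt_two_pow_lev n; omega
  have h' : ((n:ℝ)+1) ≤ 2 * 2 ^ lev n := by
    have : ((n+1 : ℕ):ℝ) ≤ ((2 ^ (lev n + 1) : ℕ) : ℝ) := Nat.cast_le.2 h
    push_cast at this; rw [pow_succ] at this; linarith
  rw [le_div_iff₀ (by positivity)]
  unfold len
  have : (0:ℝ) < 2 ^ lev n := by positivity
  rw [inv_mul_le_iff₀ this]; linarith

theorem len_sq_summable : Summable fun n => len n ^ 2 := by
  have h : Summable fun n : ℕ => 4 * (1 / ((n:ℝ)+1)^2) := by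
    have := (summable_nat_add_iff 1).2 (Real.summable_one_div_nat_pow (p := 2) |>.2 (by norm_num))
    refine Summable.mul_left 4 ?_
    refine this.congr fun n => ?_
    push_cast; rfl
  refine Summable.of_nonneg_of_le (fun n => by positivity) (fun n => ?_) h
  have h1 := len_le_div n
  have h0 := (len_pos n).le
  calc len n ^ 2 ≤ (2 / ((n:ℝ)+1))^2 := by gcongr
    _ = _ := by rw [div_pow]; ring

theorem volume_box_le (n : ℕ) : volume (box n) ≤ ENNReal.ofReal (len n ^ 2) := by
  unfold box
  split_ifs
  · simp
  · rw [Measure.volume_eq_prod, Measure.prod_prod, volume_dyadJ]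
    unfold Rad
    rw [Real.volume_Ico, ← ENNReal.ofReal_mul' (len_pos n).le]
    apply ENNReal.ofReal_le_ofReal
    have := len_pos n
    nlinarith

variable {E : Type*} [NormedAddCommGroup E] [InnerProductSpace ℂ E] [CompleteSpace E]

theorem int_box_le {g : ℕ → ℝ × ℝ → E} (hg : ∀ n, MemLp (g n) 2 (volume.restrict QQ)) (n : ℕ) :
    ∫ z in QQ, ‖Hb g n z‖ ≤ len n * Real.sqrt (eg g n).toReal := by
  have hi : IntegrableOn (Hb g n) QQ := L2_intOn (Hb_memLp hg n)
  rw [integral_norm_eq_lintegral_enorm hi.1]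
  have e1 : ∫⁻ z in QQ, ‖Hb g n z‖ₑ = ∫⁻ z in box n, ‖g n z‖ₑ := by
    rw [← lint_box]
    refine lintegral_congr fun z => ?_
    unfold Hb; rw [enorm_indicator_eq_indicator_enorm]
  rw [e1]
  have hm : AEMeasurable (fun z => ‖g n z‖ₑ) (volume.restrict (box n)) :=
    ((hg n).1.mono_measure (Measure.restrict_mono (box_subset n) le_rfl)).enorm
  have hcs := ENNReal.lintegral_mul_le_Lp_mul_Lq (volume.restrict (box n)) (p := 2) (q := 2) (by constructor <;> norm_num) hm (g := fun _ => 1) aemeasurable_const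
  simp only [Pi.mul_apply, mul_one, ENNReal.one_rpow, lintegral_const, Measure.restrict_apply MeasurableSet.univ, Set.univ_inter, one_mul] at hcs
  have h2 : ∫⁻ z in box n, ‖g n z‖ₑ ≤ ENNReal.ofReal (len n * Real.sqrt (eg g n).toReal) := by
    refine hcs.trans ?_
    rw [mul_comm, ENNReal.ofReal_mul (len_pos n).le]
    refine mul_le_mul' ?_ ?_
    · refine (ENNReal.rpow_le_rpow (volume_box_le n) (by norm_num)).trans (le_of_eq ?_)
      rw [ENNReal.ofReal_rpow_of_nonneg (by positivity) (by norm_num), ← Real.sqrt_eq_rpow, Real.sqrt_sq (len_pos n).le]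
    · rw [Real.sqrt_eq_rpow, ← ENNReal.ofReal_rpow_of_nonneg ENNReal.toReal_nonneg (by norm_num), ENNReal.ofReal_toReal (eg_lt_top hg n).ne]
      exact le_rfl
  exact ENNReal.toReal_le_of_le_ofReal (by have := len_pos n; positivity) h2

theorem mm_Hb_bound {g : ℕ → ℝ × ℝ → E} (hg : ∀ n, MemLp (g n) 2 (volume.restrict QQ)) (M n j : ℕ) :
    ‖mm M (Hb g n) j‖ ≤ 2 ^ (M+1) * len n ^ (M+1) * Real.sqrt (eg g n).toReal := by
  have hi : IntegrableOn (Hb g n) QQ := L2_intOn (Hb_memLp hg n)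
  have hl := len_pos n
  have : ‖mm M (Hb g n) j‖ ≤ ∫ z in QQ, (2 * (2 * len n)^M) * ‖Hb g n z‖ := by
    refine norm_integral_le_of_norm_le (hi.norm.const_mul _) ?_
    filter_upwards [ae_restrict_mem measurableSet_QQ] with z hz
    rw [norm_smul]
    by_cases hb : z ∈ box n
    · refine mul_le_mul_of_nonneg_right ((norm_wt_le M j hz).trans ?_) (norm_nonneg _)
      obtain ⟨_, h2, _⟩ := mem_box hb
      have hR := Rad_bounds h2
      have a1 : 0 ≤ 1 - z.1^2 := by nlinarith [hz.1.1, hz.1.2]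
      have a2 : 1 - z.1^2 ≤ 2 * len n := by nlinarith [hz.1.1, hz.1.2]
      have := pow_le_pow_left₀ a1 a2 M
      linarith
    · unfold Hb; rw [Set.indicator_of_notMem hb]; simp
  refine this.trans ?_
  rw [integral_const_mul]
  calc 2 * (2 * len n)^M * ∫ z in QQ, ‖Hb g n z‖ ≤ 2 * (2 * len n)^M * (len n * Real.sqrt (eg g n).toReal) := by
        refine mul_le_mul_of_nonneg_left (int_box_le hg n) (by positivity)
    _ = _ := by rw [mul_pow, pow_succ, pow_succ]; ring

theorem eg_le_X {p : ℝ} (hp : 0 < p) {e : ℕ → ℝ≥0∞} {X : ℝ≥0∞} (hX : ∫⁻ t in I₀, dens e t ^ (p/2) ≤ X) (n : ℕ) :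
    e n ^ (p/2) * ENNReal.ofReal (len n) ≤ X := by
  rw [← lint_ind_dyadJ]
  refine le_trans (lintegral_mono fun t => ?_) hX
  by_cases ht : t ∈ dyadJ n
  · rw [Set.indicator_of_mem ht]
    refine ENNReal.rpow_le_rpow ?_ (by positivity)
    unfold dens
    refine le_trans ?_ (ENNReal.le_tsum n)
    rw [Set.indicator_of_mem ht]
  · rw [Set.indicator_of_notMem ht]; exact zero_le

theorem sqrt_eg_le {p : ℝ} (hp : 0 < p) {e : ℕ → ℝ≥0∞} {X : ℝ≥0∞} (hXt : X ≠ ⊤) (hX : ∫⁻ t in I₀, dens e t ^ (p/2) ≤ X) (n : ℕ) :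
    Real.sqrt (e n).toReal ≤ X.toReal ^ (1/p) * len n ^ (-(1/p)) := by
  have h := ENNReal.toReal_mono hXt (eg_le_X hp hX n)
  have hl := len_pos n
  rw [ENNReal.toReal_mul, ← ENNReal.toReal_rpow, ENNReal.toReal_ofReal hl.le] at h
  set x := (e n).toReal with hx
  have hx0 : 0 ≤ x := ENNReal.toReal_nonneg
  have h2 : x ^ (p/2) ≤ X.toReal * (len n)⁻¹ := by
    rw [← div_eq_mul_inv, le_div_iff₀ hl]; exact h
  have h3 := Real.rpow_le_rpow (by positivity) h2 (z := 1/p) (by positivity)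
  rw [← Real.rpow_mul hx0, show p/2*(1/p) = 1/2 by field_simp, ← Real.sqrt_eq_rpow,
    Real.mul_rpow ENNReal.toReal_nonneg (by positivity), Real.inv_rpow hl.le, ← Real.rpow_neg hl.le] at h3
  exact h3

theorem mm_Hb_bound2 {p : ℝ} (hp : 0 < p) {M : ℕ} (hM2 : 2 ≤ (M:ℝ) + 1 - 1/p) {g : ℕ → ℝ × ℝ → E}
    (hg : ∀ n, MemLp (g n) 2 (volume.restrict QQ)) {X : ℝ≥0∞} (hXt : X ≠ ⊤) (hX : ∫⁻ t in I₀, dens (eg g) t ^ (p/2) ≤ X) (n j : ℕ) :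
    ‖mm M (Hb g n) j‖ ≤ 2 ^ (M+1) * X.toReal ^ (1/p) * len n ^ 2 := by
  refine (mm_Hb_bound hg M n j).trans ?_
  have hl := len_pos n
  have hX0 : 0 ≤ X.toReal := ENNReal.toReal_nonneg
  calc 2 ^ (M+1) * len n ^ (M+1) * Real.sqrt (eg g n).toReal
      ≤ 2 ^ (M+1) * len n ^ (M+1) * (X.toReal ^ (1/p) * len n ^ (-(1/p))) :=
        mul_le_mul_of_nonneg_left (sqrt_eg_le hp hXt hX n) (by positivity)
    _ = 2 ^ (M+1) * X.toReal ^ (1/p) * (len n ^ ((M:ℝ)+1-1/p)) := by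
        rw [sub_eq_add_neg, Real.rpow_add hl, ← Nat.cast_add_one, Real.rpow_natCast]; ring
    _ ≤ 2 ^ (M+1) * X.toReal ^ (1/p) * len n ^ 2 := by
        refine mul_le_mul_of_nonneg_left ?_ (by positivity)
        rw [← Real.rpow_natCast (len n) 2]
        exact Real.rpow_le_rpow_of_exponent_ge hl (len_le_one n) (by push_cast; linarith)

/-- synthesised coefficients -/
def mc (M : ℕ) (g : ℕ → ℝ × ℝ → E) (j : ℕ) : E := ∑' n, mm M (Hb g n) j

theorem FS_double {M : ℕ} {m : ℕ → ℕ → E} {K : ℕ → ℝ} (hK : Summable K) (hm : ∀ n j, ‖m n j‖ ≤ K n) {z : ℂ} (hz : ‖z‖ < 1) :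
    HasSum (fun n => FS M (m n) z) (FS M (fun j => ∑' n, m n j) z) := by
  have hC := Cj_summable M (norm_nonneg z) hz
  have hs : Summable fun q : ℕ × ℕ => ((Cj M q.2 : ℂ) * z^(q.2+1)) • m q.1 q.2 := by
    refine Summable.of_norm_bounded (g := fun q : ℕ × ℕ => K q.1 * (Cj M q.2 * ‖z‖^(q.2+1))) ?_ ?_
    · exact hK.mul_of_nonneg hC (fun n => (norm_nonneg _).trans (hm n 0)) (fun j => mul_nonneg (Cj_nonneg _ _) (by positivity))
    · intro q
      exact (norm_FS_term M (m q.1) (hm q.1) z q.2).trans_eq (mul_comm _ _)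
  have h1 := hs.hasSum.prod_fiberwise (fun n => FS_hasSum M (hm n) hz)
  have h2 : ∀ j, HasSum (fun n => ((Cj M j : ℂ) * z^(j+1)) • m n j) (((Cj M j : ℂ) * z^(j+1)) • ∑' n, m n j) := by
    intro j
    exact (Summable.of_norm_bounded hK (fun n => hm n j)).hasSum.const_smul _
  have h3 := ((Equiv.prodComm ℕ ℕ).hasSum_iff.2 hs.hasSum).prod_fiberwise (fun j => h2 j)
  have h4 : FS M (fun j => ∑' n, m n j) z = ∑' q : ℕ × ℕ, ((Cj M q.2 : ℂ) * z^(q.2+1)) • m q.1 q.2 := h3.tsum_eq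
  rw [h4]; exact h1

section
variable {p : ℝ} {M : ℕ} {g : ℕ → ℝ × ℝ → E} {X : ℝ≥0∞}

/-- the dominating sequence -/
def KK (p : ℝ) (M : ℕ) (X : ℝ≥0∞) (n : ℕ) : ℝ := 2 ^ (M+1) * X.toReal ^ (1/p) * len n ^ 2

theorem KK_summable (p : ℝ) (M : ℕ) (X : ℝ≥0∞) : Summable (KK p M X) := len_sq_summable.mul_left _

theorem mc_hasSum (hp : 0 < p) (hM2 : 2 ≤ (M:ℝ) + 1 - 1/p)
    (hg : ∀ n, MemLp (g n) 2 (volume.restrict QQ)) (hXt : X ≠ ⊤) (hX : ∫⁻ t in I₀, dens (eg g) t ^ (p/2) ≤ X) (j : ℕ) :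
    HasSum (fun n => mm M (Hb g n) j) (mc M g j) :=
  (Summable.of_norm_bounded (KK_summable p M X) (fun n => mm_Hb_bound2 hp hM2 hg hXt hX n j)).hasSum

theorem mc_bound (hp : 0 < p) (hM2 : 2 ≤ (M:ℝ) + 1 - 1/p)
    (hg : ∀ n, MemLp (g n) 2 (volume.restrict QQ)) (hXt : X ≠ ⊤) (hX : ∫⁻ t in I₀, dens (eg g) t ^ (p/2) ≤ X) (j : ℕ) :
    ‖mc M g j‖ ≤ ∑' n, KK p M X n :=
  tsum_of_norm_bounded (KK_summable p M X).hasSum (fun n => mm_Hb_bound2 hp hM2 hg hXt hX n j)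

theorem synth_bound (hp : 0 < p) (hp1 : p ≤ 1) (hM : 1 ≤ M) (hMp : 2 ≤ ((M:ℝ)+1)*p) (hM2 : 2 ≤ (M:ℝ) + 1 - 1/p)
    (hg : ∀ n, MemLp (g n) 2 (volume.restrict QQ)) (hXt : X ≠ ⊤) (hX : ∫⁻ t in I₀, dens (eg g) t ^ (p/2) ≤ X)
    {R : ℝ} (hR0 : 0 ≤ R) (hR : R < 1) :
    ∫⁻ t in I₀, ‖FS M (mc M g) (R * ev t)‖ₑ ^ p ≤ CAt M p * ENNReal.ofReal (Cst p) * X := by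
  have hnz : ∀ t : ℝ, ‖(R:ℂ) * ev t‖ < 1 := by
    intro t; rw [norm_mul, norm_ev, Complex.norm_real, Real.norm_of_nonneg hR0, mul_one]; exact hR
  set S : ℕ → ℝ → E := fun N t => ∑ n ∈ Finset.Ico 1 N, FS M (mm M (Hb g n)) (R * ev t) with hS
  have hlim : ∀ t, Tendsto (fun N => S N t) atTop (𝓝 (FS M (mc M g) (R * ev t))) := by
    intro t
    have h := (FS_double (M := M) (KK_summable p M X) (mm_Hb_bound2 hp hM2 hg hXt hX) (hnz t)).tendsto_sum_nat
    have h0 : FS M (mm M (Hb g 0)) (R * ev t) = 0 := by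
      have : ∀ j, mm M (Hb g 0) j = 0 := fun j => mm_zero_of_ae (by
        have : Hb g 0 = 0 := by unfold Hb; rw [box_zero, Set.indicator_empty]; rfl
        rw [this]) j
      unfold FS; simp_rw [this]; simp
    refine h.congr' ?_
    filter_upwards [eventually_ge_atTop 1] with N hN
    rw [Finset.range_eq_Ico, Finset.sum_eq_sum_Ico_succ_bot (by omega), h0, zero_add]
  have hf : ∀ t, ‖FS M (mc M g) (R * ev t)‖ₑ ^ p ≤ liminf (fun N => ‖S N t‖ₑ ^ p) atTop := by
    intro t
    exact (((ENNReal.continuous_rpow_const (y := p)).tendsto _).comp ((continuous_enorm.tendsto _).comp (hlim t))).liminf_eq.ge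
  refine (lintegral_mono hf).trans ((lintegral_liminf_le fun N => ?_).trans ?_)
  · have : Continuous (S N) := continuous_finset_sum _ fun n _ =>
      continuous_FS_circle (fun j => mm_bound (L2_intOn (Hb_memLp hg n)) j) hR0 hR
    exact this.enorm.measurable.pow_const _
  · refine liminf_le_of_le (by isBoundedDefault) fun b hb => ?_
    obtain ⟨N, hN⟩ := hb.exists
    refine hN.trans ((finite_synth hp hp1 hM hMp hg N hR0 hR).trans ?_)
    refine mul_le_mul' le_rfl (le_trans (lintegral_mono fun t => ?_) hX)
    exact ENNReal.rpow_le_rpow (ENNReal.sum_le_tsum _) (by positivity)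

/-- derivative series -/
def FD (M : ℕ) (m : ℕ → E) (z : ℂ) : E := ∑' j, ((Cj M j : ℂ) * (((j:ℂ)+1) * z^j)) • m j

theorem Cj_succ_le (M j : ℕ) : Cj M j * ((j:ℝ)+1) = ((M:ℝ)+1) * ((j+(M+1)).choose (M+1) : ℕ) := by
  unfold Cj
  have h2 : (j+1+M).choose M * (j+1) = (j + (M+1)).choose (M+1) * (M+1) := by
    have := Nat.choose_succ_right_eq (j+1+M) M
    rw [show j+1+M-M = j+1 by omega] at this
    rw [← this]; congr 2; ring
  have h3 : (((j+1+M).choose M * (j+1) : ℕ):ℝ) = (((j + (M+1)).choose (M+1) * (M+1) : ℕ):ℝ) := by rw [h2]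
  push_cast at h3 ⊢
  linarith

theorem FD_summable (M : ℕ) {x : ℝ} (hx0 : 0 ≤ x) (hx : x < 1) : Summable fun j : ℕ => Cj M j * (((j:ℝ)+1) * x^j) := by
  have := (summable_choose_mul_geometric_of_norm_lt_one (M+1) (r := x) (by rwa [Real.norm_of_nonneg hx0])).mul_left ((M:ℝ)+1)
  refine this.congr fun j => ?_
  rw [← mul_assoc, ← mul_assoc, Cj_succ_le]

theorem norm_FD_term (M : ℕ) {m : ℕ → E} {K : ℝ} (hm : ∀ j, ‖m j‖ ≤ K) (z : ℂ) {x : ℝ} (hz : ‖z‖ ≤ x) (j : ℕ) :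
    ‖((Cj M j : ℂ) * (((j:ℂ)+1) * z^j)) • m j‖ ≤ Cj M j * (((j:ℝ)+1) * x^j) * K := by
  have h1 : ‖((j:ℂ)+1)‖ = (j:ℝ)+1 := by
    rw [← Nat.cast_succ, Complex.norm_natCast]; push_cast; rfl
  have := Cj_nonneg M j
  have hK : 0 ≤ K := (norm_nonneg _).trans (hm j)
  rw [norm_smul, norm_mul, norm_mul, norm_pow, Complex.norm_real, Real.norm_of_nonneg this, h1]
  have h2 := pow_le_pow_left₀ (norm_nonneg z) hz j
  have hm' := hm j
  have hx : 0 ≤ x := (norm_nonneg z).trans hz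
  have h3 : 0 ≤ Cj M j * (((j:ℝ)+1) * x^j) := by positivity
  gcongr

theorem FD_hasSum (M : ℕ) {m : ℕ → E} {K : ℝ} (hm : ∀ j, ‖m j‖ ≤ K) {z : ℂ} (hz : ‖z‖ < 1) :
    HasSum (fun j => ((Cj M j : ℂ) * (((j:ℂ)+1) * z^j)) • m j) (FD M m z) :=
  (Summable.of_norm_bounded ((FD_summable M (norm_nonneg z) hz).mul_right K) (norm_FD_term M hm z le_rfl)).hasSum

theorem FS_hasDerivAt (M : ℕ) {m : ℕ → E} {K : ℝ} (hm : ∀ j, ‖m j‖ ≤ K) {z : ℂ} (hz : ‖z‖ < 1) :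
    HasDerivAt (FS M m) (FD M m z) z := by
  obtain ⟨x, hx1, hx2⟩ := exists_between hz
  have hx0 : 0 ≤ x := (norm_nonneg z).trans hx1.le
  unfold FS FD
  refine hasDerivAt_tsum_of_isPreconnected (t := Metric.ball (0:ℂ) x) ((FD_summable M hx0 hx2).mul_right K) Metric.isOpen_ball
    (convex_ball _ _).isPreconnected (g := fun j z => ((Cj M j : ℂ) * z^(j+1)) • m j) (g' := fun j z => ((Cj M j : ℂ) * (((j:ℂ)+1) * z^j)) • m j) ?_ ?_ (y₀ := z) ?_ (FS_hasSum M hm hz).summable ?_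
  · intro j y _
    refine HasDerivAt.smul_const ?_ _
    refine HasDerivAt.const_mul _ ?_
    refine (hasDerivAt_pow (j+1) y).congr_deriv ?_
    push_cast; simp
  · intro j y hy
    rw [mem_ball_zero_iff] at hy
    exact norm_FD_term M hm y hy.le j
  · rwa [mem_ball_zero_iff]
  · rwa [mem_ball_zero_iff]

end
end HPTL
end

section
namespace HPTL
set_option linter.all false
set_option linter.unusedSectionVars false

theorem BIso_double {X : Type*} [AddCommGroup X] [Module ℂ X] {q : X → ℝ≥0∞} (PE PO QE QO : X →ₗ[ℂ] X)
    (h1 : ∀ x, PE (QE x) = x) (h2 : ∀ x, PO (QO x) = x) (h3 : ∀ x, PE (QO x) = 0) (h4 : ∀ x, PO (QE x) = 0)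
    (h5 : ∀ x, QE (PE x) + QO (PO x) = x) (b1 : ∀ x, q (PE x) ≤ q x) (b2 : ∀ x, q (PO x) ≤ q x)
    (b3 : ∀ x, q (QE x) ≤ q x) (b4 : ∀ x, q (QO x) ≤ q x) (hadd : ∀ x y, q (x + y) ≤ 2 * (q x + q y)) :
    BIso q (qProd q q) := by
  refine ⟨LinearEquiv.ofLinear (PE.prod PO) (QE.coprod QO) ?_ ?_, 2, by norm_num, ?_, ?_⟩
  · refine LinearMap.ext fun x => ?_
    simp [h1, h2, h3, h4]
  · refine LinearMap.ext fun x => ?_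
    simp [h5]
  · intro x
    simp only [LinearEquiv.ofLinear_apply, LinearMap.prod_apply, qProd, Pi.prod]
    rw [two_mul]
    exact add_le_add (b1 x) (b2 x)
  · intro x
    simp only [LinearEquiv.ofLinear_symm_apply, LinearMap.coprod_apply, qProd]
    exact (hadd _ _).trans (mul_le_mul' le_rfl (add_le_add (b3 _) (b4 _)))

section Y
variable {H : Type*} [NormedAddCommGroup H] [NormedSpace ℂ H]

/-- energies -/
def ga (p : ℝ) (γ : ℕ → H) (n : ℕ) : ℝ≥0∞ := ‖γ n‖ₑ ^ (2:ℝ) * ENNReal.ofReal (len n) ^ (-(2/p))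
/-- modular of T -/
def qT (p : ℝ) (γ : ℕ → H) : ℝ≥0∞ := ∫⁻ t in I₀, dens (ga p γ) t ^ (p/2)

theorem dens_mono {e e' : ℕ → ℝ≥0∞} (h : ∀ n, e n ≤ e' n) (t : ℝ) : dens e t ≤ dens e' t :=
  ENNReal.tsum_le_tsum fun n => Set.indicator_le_indicator (h n)

theorem dens_const_mul (c : ℝ≥0∞) (e : ℕ → ℝ≥0∞) (t : ℝ) : dens (fun n => c * e n) t = c * dens e t := by
  unfold dens
  rw [← ENNReal.tsum_mul_left]
  congr 1; funext n
  by_cases h : t ∈ dyadJ n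
  · simp [h]
  · simp [h]

theorem dens_add (e e' : ℕ → ℝ≥0∞) (t : ℝ) : dens (fun n => e n + e' n) t = dens e t + dens e' t := by
  unfold dens
  rw [← ENNReal.tsum_add]
  congr 1; funext n
  by_cases h : t ∈ dyadJ n
  · simp [h]
  · simp [h]

theorem lint_dens_mono {p : ℝ} (hp : 0 < p) {c : ℝ≥0∞} (hc : c ≠ ⊤) {e e' : ℕ → ℝ≥0∞} (h : ∀ n, e n ≤ c * e' n) :
    ∫⁻ t in I₀, dens e t ^ (p/2) ≤ c ^ (p/2) * ∫⁻ t in I₀, dens e' t ^ (p/2) := by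
  rw [← lintegral_const_mul' _ _ (ENNReal.rpow_ne_top_of_nonneg (by positivity) hc)]
  refine lintegral_mono fun t => ?_
  show _ ≤ c ^ (p/2) * dens e' t ^ (p/2)
  rw [← ENNReal.mul_rpow_of_nonneg _ _ (by positivity), ← dens_const_mul]
  exact ENNReal.rpow_le_rpow (dens_mono h t) (by positivity)

theorem lint_dens_mono' {p : ℝ} (hp : 0 < p) {e e' : ℕ → ℝ≥0∞} (h : ∀ n, e n ≤ e' n) :
    ∫⁻ t in I₀, dens e t ^ (p/2) ≤ ∫⁻ t in I₀, dens e' t ^ (p/2) :=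
  lintegral_mono fun t => ENNReal.rpow_le_rpow (dens_mono h t) (by positivity)

theorem qT_mono {p : ℝ} (hp : 0 < p) {H' : Type*} [NormedAddCommGroup H'] {γ : ℕ → H} {γ' : ℕ → H'} (h : ∀ n, ‖γ n‖ ≤ ‖γ' n‖) : qT p γ ≤ qT p γ' := by
  refine lint_dens_mono' hp fun n => ?_
  unfold ga
  refine mul_le_mul' (ENNReal.rpow_le_rpow ?_ (by norm_num)) le_rfl
  rw [← ofReal_norm, ← ofReal_norm]; exact ENNReal.ofReal_le_ofReal (h n)

theorem ennreal_add_sq (a b : ℝ≥0∞) : (a + b) ^ (2:ℝ) ≤ 2 * (a ^ (2:ℝ) + b ^ (2:ℝ)) := by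
  have := ENNReal.rpow_add_le_mul_rpow_add_rpow a b (p := 2) (by norm_num)
  norm_num at this ⊢
  exact this

theorem qT_add {p : ℝ} (hp : 0 < p) (hp1 : p ≤ 1) (γ γ' : ℕ → H) : qT p (γ + γ') ≤ 2 * (qT p γ + qT p γ') := by
  have h1 : qT p (γ + γ') ≤ 2 ^ (p/2) * ∫⁻ t in I₀, dens (fun n => ga p γ n + ga p γ' n) t ^ (p/2) := by
    refine lint_dens_mono hp (by norm_num) fun n => ?_
    unfold ga
    rw [← add_mul, ← mul_assoc]
    refine mul_le_mul' ?_ le_rfl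
    exact (ENNReal.rpow_le_rpow (enorm_add_le _ _) (by norm_num)).trans (ennreal_add_sq _ _)
  refine h1.trans (mul_le_mul' ?_ ?_)
  · calc (2:ℝ≥0∞) ^ (p/2) ≤ 2 ^ (1:ℝ) := ENNReal.rpow_le_rpow_of_exponent_le (by norm_num) (by linarith)
      _ = 2 := ENNReal.rpow_one 2
  · unfold qT
    rw [← lintegral_add_left ((measurable_dens _).pow_const _)]
    refine lintegral_mono fun t => ?_
    show _ ^ _ ≤ _
    rw [dens_add]
    exact ENNReal.rpow_add_le_add_rpow _ _ (by positivity) (by linarith)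

theorem qT_neg (p : ℝ) (γ : ℕ → H) : qT p (-γ) = qT p γ := by
  unfold qT ga; simp

theorem qT_zero {p : ℝ} (hp : 0 < p) : qT p (0 : ℕ → H) = 0 := by
  have : dens (ga p (0 : ℕ → H)) = fun _ => 0 := by
    funext t; unfold dens ga; simp
  unfold qT
  rw [this]; simp [hp]

theorem qT_smul_lt {p : ℝ} (hp : 0 < p) (c : ℂ) {γ : ℕ → H} (h : qT p γ < ⊤) : qT p (c • γ) < ⊤ := by
  have : qT p (c • γ) ≤ (‖c‖ₑ ^ (2:ℝ)) ^ (p/2) * qT p γ := by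
    refine lint_dens_mono hp (by simp) fun n => ?_
    unfold ga
    rw [← mul_assoc, Pi.smul_apply, enorm_smul, ENNReal.mul_rpow_of_nonneg _ _ (by norm_num)]
  refine this.trans_lt (ENNReal.mul_lt_top ?_ h)
  exact ENNReal.rpow_lt_top_of_nonneg (by positivity) (by simp)

theorem norm_le_qT {p : ℝ} (hp : 0 < p) (γ : ℕ → H) : ‖γ 0‖ₑ ^ p ≤ qT p γ := by
  have := eg_le_X hp (e := ga p γ) (X := qT p γ) le_rfl 0
  have hl : len 0 = 1 := by simp [len, lev]
  unfold ga at this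
  rw [hl, ENNReal.ofReal_one, ENNReal.one_rpow, mul_one, mul_one, ← ENNReal.rpow_mul] at this
  rwa [show 2 * (p/2) = p by ring] at this

end Y

theorem tlDensity_eq (p : ℝ) (γ : ℕ → ELL2) (t : ℝ) : tlDensity p γ t = dens (ga p γ) t := by
  unfold tlDensity dens ga
  congr 1; funext n
  rw [volume_dyadJ]
  by_cases h : t ∈ dyadJ n
  · simp [h, enorm_eq_nnnorm]
  · simp [h]

theorem tlNorm_eq (p : ℝ) (γ : ℕ → ELL2) : tlNorm p γ = qT p γ ^ (1/p) := by
  unfold tlNorm qT; simp_rw [tlDensity_eq]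

/-- sequence space -/
def YY (p : ℝ) (hp : 0 < p) (hp1 : p ≤ 1) : Submodule ℂ (ℕ → ELL2) where
  carrier := {γ | qT p γ < ⊤}
  add_mem' := fun {a b} ha hb => (qT_add hp hp1 a b).trans_lt (ENNReal.mul_lt_top (by norm_num) (ENNReal.add_lt_top.2 ⟨ha, hb⟩))
  zero_mem' := by show qT p 0 < ⊤; rw [qT_zero hp]; simp
  smul_mem' := fun c x hx => qT_smul_lt hp c hx

theorem hpInt_eq (p : ℝ) (F : ℂ → ELL2) (r : ℝ) : hpIntegral p F r = ∫⁻ t in I₀, ‖F (r * ev t)‖ₑ ^ p := rfl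

theorem norm_rev {r : ℝ} (h0 : 0 ≤ r) (t : ℝ) : ‖(r:ℂ) * ev t‖ = r := by
  rw [norm_mul, norm_ev, Complex.norm_real, Real.norm_of_nonneg h0, mul_one]

theorem cont_circle {E : Type*} [NormedAddCommGroup E] {F : ℂ → E} (hF : ContinuousOn F (Metric.ball 0 1)) {r : ℝ} (h0 : 0 ≤ r) (h1 : r < 1) :
    Continuous fun t => F (r * ev t) := by
  refine hF.comp_continuous (continuous_const.mul continuous_ev) fun t => ?_
  rw [mem_ball_zero_iff, norm_rev h0]; exact h1

/-- modular of H_p -/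
def qH (p : ℝ) (F : ℂ → ELL2) : ℝ≥0∞ := ⨆ r : Set.Ico (0:ℝ) 1, hpIntegral p F r.1

theorem le_qH (p : ℝ) (F : ℂ → ELL2) {r : ℝ} (h0 : 0 ≤ r) (h1 : r < 1) : ∫⁻ t in I₀, ‖F (r * ev t)‖ₑ ^ p ≤ qH p F :=
  le_iSup (fun r : Set.Ico (0:ℝ) 1 => hpIntegral p F r.1) ⟨r, h0, h1⟩

theorem qHpD_eq {p : ℝ} (hp : 0 < p) (F : ℂ → ELL2) : qHpD p F = qH p F ^ (1/p) := by
  unfold qHpD qH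
  exact ((ENNReal.orderIsoRpow (1/p) (by positivity)).map_iSup _).symm

theorem memHpD_iff (p : ℝ) (F : ℂ → ELL2) : memHpD p F ↔ DifferentiableOn ℂ F (Metric.ball 0 1) ∧ qH p F < ⊤ := by
  unfold memHpD
  refine and_congr_right fun _ => ⟨?_, ?_⟩
  · rintro ⟨B, hB, h⟩
    have : qH p F ≤ B := iSup_le fun r => h r.1 r.2.1 r.2.2
    exact this.trans_lt hB
  · intro h
    refine ⟨qH p F, h, fun r h0 h1 => ?_⟩
    rw [hpInt_eq]; exact le_qH p F h0 h1

theorem qH_add {p : ℝ} (hp : 0 < p) (hp1 : p ≤ 1) {F G : ℂ → ELL2} (hF : DifferentiableOn ℂ F (Metric.ball 0 1)) :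
    qH p (F + G) ≤ qH p F + qH p G := by
  refine iSup_le fun r => ?_
  rw [hpInt_eq]
  calc ∫⁻ t in I₀, ‖(F+G) (r.1 * ev t)‖ₑ ^ p ≤ ∫⁻ t in I₀, (‖F (r.1 * ev t)‖ₑ ^ p + ‖G (r.1 * ev t)‖ₑ ^ p) := by
        refine lintegral_mono fun t => ?_
        exact (ENNReal.rpow_le_rpow (enorm_add_le _ _) hp.le).trans (ENNReal.rpow_add_le_add_rpow _ _ hp.le hp1)
    _ = (∫⁻ t in I₀, ‖F (r.1 * ev t)‖ₑ ^ p) + ∫⁻ t in I₀, ‖G (r.1 * ev t)‖ₑ ^ p :=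
        lintegral_add_left ((cont_circle hF.continuousOn r.2.1 r.2.2).enorm.measurable.pow_const _) _
    _ ≤ _ := add_le_add (le_qH p F r.2.1 r.2.2) (le_qH p G r.2.1 r.2.2)

theorem qH_mono {p : ℝ} (hp : 0 < p) {F G : ℂ → ELL2} (h : ∀ z, ‖F z‖ ≤ ‖G z‖) : qH p F ≤ qH p G := by
  refine iSup_mono fun r => lintegral_mono fun t => ENNReal.rpow_le_rpow ?_ hp.le
  exact_mod_cast h _

theorem qH_smul {p : ℝ} (hp : 0 < p) (c : ℂ) (F : ℂ → ELL2) : qH p (c • F) ≤ ‖c‖ₑ ^ p * qH p F := by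
  refine iSup_le fun r => ?_
  rw [hpInt_eq]
  calc ∫⁻ t in I₀, ‖(c • F) (r.1 * ev t)‖ₑ ^ p = ‖c‖ₑ ^ p * ∫⁻ t in I₀, ‖F (r.1 * ev t)‖ₑ ^ p := by
        rw [← lintegral_const_mul' _ _ (ENNReal.rpow_ne_top_of_nonneg hp.le (by simp))]
        simp_rw [Pi.smul_apply, enorm_smul, ENNReal.mul_rpow_of_nonneg _ _ hp.le]
    _ ≤ _ := mul_le_mul' le_rfl (le_qH p F r.2.1 r.2.2)

/-- Hardy space supported on the disc -/
def XX (p : ℝ) (hp : 0 < p) (hp1 : p ≤ 1) : Submodule ℂ (ℂ → ELL2) where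
  carrier := {F | (DifferentiableOn ℂ F (Metric.ball 0 1) ∧ qH p F < ⊤) ∧ ∀ z, z ∉ Metric.ball (0:ℂ) 1 → F z = 0}
  add_mem' := by
    rintro F G ⟨⟨h1, h2⟩, h3⟩ ⟨⟨h4, h5⟩, h6⟩
    exact ⟨⟨h1.add h4, (qH_add hp hp1 h1).trans_lt (ENNReal.add_lt_top.2 ⟨h2, h5⟩)⟩, fun z hz => by simp [h3 z hz, h6 z hz]⟩
  zero_mem' := by
    refine ⟨⟨differentiableOn_const 0, ?_⟩, fun z _ => rfl⟩
    unfold qH; simp_rw [hpInt_eq]; simp [hp]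
  smul_mem' := by
    rintro c F ⟨⟨h1, h2⟩, h3⟩
    exact ⟨⟨h1.const_smul c, (qH_smul hp c F).trans_lt (ENNReal.mul_lt_top (ENNReal.rpow_lt_top_of_nonneg hp.le (by simp)) h2)⟩, fun z hz => by simp [h3 z hz]⟩

section maps
variable {p : ℝ} {hp : 0 < p} {hp1 : p ≤ 1}

/-- pointwise contraction on X -/
def mapX (hp : 0 < p) (hp1 : p ≤ 1) (L : ELL2 →L[ℂ] ELL2) (hL : ∀ x, ‖L x‖ ≤ ‖x‖) : XX p hp hp1 →ₗ[ℂ] XX p hp hp1 where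
  toFun F := ⟨fun z => L (F.1 z), ⟨L.differentiable.comp_differentiableOn F.2.1.1, (qH_mono hp fun z => hL _).trans_lt F.2.1.2⟩,
    fun z hz => by show L (F.1 z) = 0; rw [F.2.2 z hz, map_zero]⟩
  map_add' F G := by ext1; funext z; exact map_add L _ _
  map_smul' c F := by ext1; funext z; exact map_smul L _ _

/-- pointwise contraction on Y -/
def mapY (hp : 0 < p) (hp1 : p ≤ 1) (L : ELL2 →L[ℂ] ELL2) (hL : ∀ x, ‖L x‖ ≤ ‖x‖) : YY p hp hp1 →ₗ[ℂ] YY p hp hp1 where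
  toFun F := ⟨fun z => L (F.1 z), (qT_mono hp fun z => hL _).trans_lt F.2⟩
  map_add' F G := by ext1; funext z; exact map_add L _ _
  map_smul' c F := by ext1; funext z; exact map_smul L _ _

theorem X_double (hp : 0 < p) (hp1 : p ≤ 1) : BIso (fun F : XX p hp hp1 => qH p F.1) (qProd (fun F : XX p hp hp1 => qH p F.1) (fun F : XX p hp hp1 => qH p F.1)) := by
  refine BIso_double (mapX hp hp1 (pull fE fE_inj) (norm_pull_le _ _)) (mapX hp hp1 (pull fO fO_inj) (norm_pull_le _ _))
    (mapX hp hp1 (push fE fE_inj) fun x => (norm_push _ _ x).le) (mapX hp hp1 (push fO fO_inj) fun x => (norm_push _ _ x).le) ?_ ?_ ?_ ?_ ?_ ?_ ?_ ?_ ?_ ?_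
  · intro x; ext1; funext z; exact pull_push _ _ _
  · intro x; ext1; funext z; exact pull_push _ _ _
  · intro x; ext1; funext z; exact pull_push_disj _ _ _ _ (fun i j => fE_ne_fO i j) _
  · intro x; ext1; funext z; exact pull_push_disj _ _ _ _ (fun i j => (fE_ne_fO j i).symm) _
  · intro x; ext1; funext z; exact push_pull_even_odd _
  · intro x; exact qH_mono hp fun z => norm_pull_le _ _ _
  · intro x; exact qH_mono hp fun z => norm_pull_le _ _ _
  · intro x; exact qH_mono hp fun z => (norm_push _ _ _).le
  · intro x; exact qH_mono hp fun z => (norm_push _ _ _).le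
  · intro x y
    refine (qH_add hp hp1 x.2.1.1).trans ?_
    exact le_mul_of_one_le_left' (by norm_num)

theorem Y_double (hp : 0 < p) (hp1 : p ≤ 1) : BIso (fun F : YY p hp hp1 => qT p F.1) (qProd (fun F : YY p hp hp1 => qT p F.1) (fun F : YY p hp hp1 => qT p F.1)) := by
  refine BIso_double (mapY hp hp1 (pull fE fE_inj) (norm_pull_le _ _)) (mapY hp hp1 (pull fO fO_inj) (norm_pull_le _ _))
    (mapY hp hp1 (push fE fE_inj) fun x => (norm_push _ _ x).le) (mapY hp hp1 (push fO fO_inj) fun x => (norm_push _ _ x).le) ?_ ?_ ?_ ?_ ?_ ?_ ?_ ?_ ?_ ?_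
  · intro x; ext1; funext z; exact pull_push _ _ _
  · intro x; ext1; funext z; exact pull_push _ _ _
  · intro x; ext1; funext z; exact pull_push_disj _ _ _ _ (fun i j => fE_ne_fO i j) _
  · intro x; ext1; funext z; exact pull_push_disj _ _ _ _ (fun i j => (fE_ne_fO j i).symm) _
  · intro x; ext1; funext z; exact push_pull_even_odd _
  · intro x; exact qT_mono hp fun z => norm_pull_le _ _ _
  · intro x; exact qT_mono hp fun z => norm_pull_le _ _ _
  · intro x; exact qT_mono hp fun z => (norm_push _ _ _).le
  · intro x; exact qT_mono hp fun z => (norm_push _ _ _).le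
  · intro x y
    exact qT_add hp hp1 _ _

end maps

/-- final step from the isomorphism of modulars -/
theorem finish (p : ℝ) (hp : 0 < p) (hp1 : p ≤ 1)
    (h : BIso (fun F : XX p hp hp1 => qH p F.1) (fun F : YY p hp hp1 => qT p F.1)) :
    ∃ (T : (ℂ → ELL2) →ₗ[ℂ] (ℕ → ELL2)) (c C : ℝ≥0∞), 0 < c ∧ C < ⊤ ∧
      (∀ F, memHpD p F → memTL p (T F) ∧
        c * qHpD p F ≤ tlNorm p (T F) ∧ tlNorm p (T F) ≤ C * qHpD p F) ∧
      (∀ γ, memTL p γ → ∃ F, memHpD p F ∧ T F = γ) := by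
  obtain ⟨e, C, hC, h1, h2⟩ := h
  have hp' : 0 < 1/p := by positivity
  obtain ⟨T₀, hT₀⟩ := LinearMap.exists_extend ((YY p hp hp1).subtype ∘ₗ e.toLinearMap)
  classical
  set res : (ℂ → ELL2) →ₗ[ℂ] (ℂ → ELL2) :=
    { toFun := fun F => (Metric.ball (0:ℂ) 1).indicator F
      map_add' := fun F G => Set.indicator_add _ _ _
      map_smul' := fun c F => Set.indicator_const_smul (Metric.ball (0:ℂ) 1) c F } with hres
  have hr1 : ∀ F, ∀ z ∈ Metric.ball (0:ℂ) 1, res F z = F z := fun F z hz => Set.indicator_of_mem hz _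
  have hr2 : ∀ F, qH p (res F) = qH p F := by
    intro F
    refine iSup_congr fun r => ?_
    rw [hpInt_eq, hpInt_eq]
    refine lintegral_congr fun t => ?_
    rw [hr1]
    rw [mem_ball_zero_iff, norm_rev r.2.1]; exact r.2.2
  have hr3 : ∀ F, memHpD p F → res F ∈ XX p hp hp1 := by
    intro F hF
    rw [memHpD_iff] at hF
    exact ⟨⟨hF.1.congr fun z hz => hr1 F z hz, by rw [hr2]; exact hF.2⟩, fun z hz => Set.indicator_of_notMem hz _⟩
  have hT : ∀ F : XX p hp hp1, T₀ F.1 = (e F).1 := fun F => LinearMap.congr_fun hT₀ F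
  have hCt : (C+1) ≠ ⊤ := by simpa using hC.ne
  have hC0 : (C+1) ≠ 0 := by simp
  refine ⟨T₀ ∘ₗ res, ((C+1)^(1/p))⁻¹, (C+1)^(1/p), ?_, ?_, ?_, ?_⟩
  · exact ENNReal.inv_pos.2 (ENNReal.rpow_ne_top_of_nonneg hp'.le hCt)
  · exact ENNReal.rpow_lt_top_of_nonneg hp'.le hCt
  · intro F hF
    have hm := hr3 F hF
    have e1 : (T₀ ∘ₗ res) F = (e ⟨res F, hm⟩).1 := hT ⟨res F, hm⟩
    have b1 := h1 ⟨res F, hm⟩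
    have b2 := h2 (e ⟨res F, hm⟩)
    simp only [LinearEquiv.symm_apply_apply, hr2] at b1 b2
    rw [e1]
    unfold memTL
    rw [tlNorm_eq, qHpD_eq hp]
    refine ⟨ENNReal.rpow_lt_top_of_nonneg hp'.le (e ⟨res F, hm⟩).2.ne, ?_, ?_⟩
    · rw [mul_comm, ← div_eq_mul_inv]
      refine ENNReal.div_le_of_le_mul ?_
      rw [← ENNReal.mul_rpow_of_nonneg _ _ hp'.le]
      refine ENNReal.rpow_le_rpow (b2.trans ?_) hp'.le
      rw [mul_comm]; exact mul_le_mul' le_rfl le_self_add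
    · rw [← ENNReal.mul_rpow_of_nonneg _ _ hp'.le]
      exact ENNReal.rpow_le_rpow (b1.trans (mul_le_mul' le_self_add le_rfl)) hp'.le
  · intro γ hγ
    have hγ' : γ ∈ YY p hp hp1 := by
      unfold memTL at hγ
      rw [tlNorm_eq] at hγ
      show qT p γ < ⊤
      exact (ENNReal.rpow_lt_top_iff_of_pos hp').1 hγ
    set F := e.symm ⟨γ, hγ'⟩ with hF
    refine ⟨F.1, (memHpD_iff _ _).2 F.2.1, ?_⟩
    have : res F.1 = F.1 := by
      funext z
      by_cases hz : z ∈ Metric.ball (0:ℂ) 1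
      · exact hr1 _ z hz
      · rw [F.2.2 z hz]; exact Set.indicator_of_notMem hz _
    show T₀ (res F.1) = γ
    rw [this, hT F, hF, LinearEquiv.apply_symm_apply]

end HPTL
end

section
namespace HPTL
set_option linter.all false
set_option linter.unusedSectionVars false

/-- L2 on the square -/
abbrev HH := Lp ELL2 2 (volume.restrict QQ)

theorem HH_sq (g : HH) : ‖g‖ₑ ^ (2:ℝ) = ∫⁻ z in QQ, ‖g z‖ₑ ^ (2:ℝ) := by
  rw [Lp.enorm_def, eLpNorm_eq_lintegral_rpow_enorm_toReal (by norm_num) (by norm_num)]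
  rw [← ENNReal.rpow_mul]
  norm_num

/-- weighted representatives -/
def gw (p : ℝ) (g : ℕ → HH) (n : ℕ) (z : ℝ × ℝ) : ELL2 := ((len n ^ (-(1/p)) : ℝ) : ℂ) • g n z

theorem gw_memLp (p : ℝ) (g : ℕ → HH) (n : ℕ) : MemLp (gw p g n) 2 (volume.restrict QQ) :=
  (Lp.memLp (g n)).const_smul ((len n ^ (-(1/p)) : ℝ) : ℂ)

theorem enorm_real_smul {E : Type*} [NormedAddCommGroup E] [NormedSpace ℂ E] {c : ℝ} (hc : 0 ≤ c) (x : E) : ‖(c:ℂ) • x‖ₑ = ENNReal.ofReal c * ‖x‖ₑ := by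
  rw [enorm_smul]; congr 1
  rw [← ofReal_norm, Complex.norm_real, Real.norm_of_nonneg hc]

theorem len_rpow_sq (p : ℝ) (n : ℕ) : ENNReal.ofReal (len n ^ (-(1/p))) ^ (2:ℝ) = ENNReal.ofReal (len n) ^ (-(2/p)) := by
  rw [← ENNReal.ofReal_rpow_of_pos (len_pos n), ← ENNReal.rpow_mul]
  congr 1; ring

theorem eg_gw_le (p : ℝ) (g : ℕ → HH) (n : ℕ) : eg (gw p g) n ≤ ga p g n := by
  unfold eg ga gw
  have hl : 0 ≤ len n ^ (-(1/p)) := Real.rpow_nonneg (len_pos n).le _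
  simp_rw [enorm_real_smul hl, ENNReal.mul_rpow_of_nonneg _ _ (show (0:ℝ) ≤ 2 by norm_num), len_rpow_sq]
  rw [lintegral_const_mul', mul_comm, HH_sq]
  · exact mul_le_mul' (lintegral_mono_set (box_subset n)) le_rfl
  · rw [← len_rpow_sq]; exact ENNReal.rpow_ne_top_of_nonneg (by norm_num) ENNReal.ofReal_ne_top

theorem gw_X {p : ℝ} (hp : 0 < p) (g : ℕ → HH) : ∫⁻ t in I₀, dens (eg (gw p g)) t ^ (p/2) ≤ qT p g :=
  lint_dens_mono' hp (eg_gw_le p g)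

theorem mm_congr {M : ℕ} {G G' : ℝ × ℝ → ELL2} (h : G =ᵐ[volume.restrict QQ] G') (j : ℕ) : mm M G j = mm M G' j := by
  unfold mm
  refine integral_congr_ae ?_
  filter_upwards [h] with z hz; rw [hz]

theorem mm_gw_add (p : ℝ) (M : ℕ) (g g' : ℕ → HH) (n j : ℕ) :
    mm M (Hb (gw p (g + g')) n) j = mm M (Hb (gw p g) n) j + mm M (Hb (gw p g') n) j := by
  have h1 : Hb (gw p (g + g')) n =ᵐ[volume.restrict QQ] fun z => Hb (gw p g) n z + Hb (gw p g') n z := by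
    filter_upwards [Lp.coeFn_add (g n) (g' n)] with z hz
    unfold Hb
    by_cases hb : z ∈ box n
    · simp only [Set.indicator_of_mem hb]
      unfold gw
      rw [Pi.add_apply, hz, Pi.add_apply, smul_add]
    · simp only [Set.indicator_of_notMem hb, add_zero]
  rw [mm_congr h1]
  unfold mm
  simp_rw [smul_add]
  exact integral_add (wt_integrable M j (L2_intOn (Hb_memLp (gw_memLp p g) n))) (wt_integrable M j (L2_intOn (Hb_memLp (gw_memLp p g') n)))

theorem mm_gw_smul (p : ℝ) (M : ℕ) (c : ℂ) (g : ℕ → HH) (n j : ℕ) :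
    mm M (Hb (gw p (c • g)) n) j = c • mm M (Hb (gw p g) n) j := by
  have h1 : Hb (gw p (c • g)) n =ᵐ[volume.restrict QQ] fun z => c • Hb (gw p g) n z := by
    filter_upwards [Lp.coeFn_smul c (g n)] with z hz
    unfold Hb
    by_cases hb : z ∈ box n
    · simp only [Set.indicator_of_mem hb]
      unfold gw
      rw [Pi.smul_apply, hz, Pi.smul_apply, smul_comm]
    · simp only [Set.indicator_of_notMem hb, smul_zero]
  rw [mm_congr h1]
  unfold mm
  simp_rw [smul_comm _ c]
  exact integral_smul c _

section
variable {p : ℝ} {M : ℕ}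

/-- admissibility of the kernel order -/
structure Adm (p : ℝ) (M : ℕ) : Prop where
  hp : 0 < p
  hp1 : p ≤ 1
  hM : 1 ≤ M
  hMp : 2 ≤ ((M:ℝ)+1)*p
  hM2 : 2 ≤ (M:ℝ) + 1 - 1/p

theorem exists_Adm (hp : 0 < p) (hp1 : p ≤ 1) : ∃ M, Adm p M := by
  refine ⟨⌈2/p⌉₊ + 1, hp, hp1, by omega, ?_, ?_⟩
  · have := Nat.le_ceil (2/p)
    push_cast
    have h2 : 2/p*p = 2 := by field_simp
    nlinarith
  · have := Nat.le_ceil (2/p)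
    push_cast
    have h2 : 2/p = 1/p + 1/p := by ring
    have h3 : 0 < 1/p := by positivity
    linarith

theorem mcg_add (A : Adm p M) {g g' : ℕ → HH} (h : qT p g < ⊤) (h' : qT p g' < ⊤) (j : ℕ) :
    mc M (gw p (g + g')) j = mc M (gw p g) j + mc M (gw p g') j := by
  have s1 := mc_hasSum A.hp A.hM2 (gw_memLp p g) h.ne (gw_X A.hp g) j
  have s2 := mc_hasSum A.hp A.hM2 (gw_memLp p g') h'.ne (gw_X A.hp g') j
  have := (s1.add s2).tsum_eq
  rw [← this]
  unfold mc; simp_rw [mm_gw_add]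

theorem mcg_smul (A : Adm p M) (c : ℂ) {g : ℕ → HH} (h : qT p g < ⊤) (j : ℕ) :
    mc M (gw p (c • g)) j = c • mc M (gw p g) j := by
  have s1 := mc_hasSum A.hp A.hM2 (gw_memLp p g) h.ne (gw_X A.hp g) j
  rw [← (s1.const_smul c).tsum_eq]
  unfold mc; simp_rw [mm_gw_smul]

theorem mcg_bound (A : Adm p M) {g : ℕ → HH} (h : qT p g < ⊤) (j : ℕ) :
    ‖mc M (gw p g) j‖ ≤ ∑' n, KK p M (qT p g) n := mc_bound A.hp A.hM2 (gw_memLp p g) h.ne (gw_X A.hp g) j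

/-- synthesis -/
def B0 (p : ℝ) (M : ℕ) (v : ELL2) (g : ℕ → HH) (z : ℂ) : ELL2 :=
  (Metric.ball (0:ℂ) 1).indicator (fun z => v + FS M (mc M (gw p g)) z) z

theorem B0_in {v : ELL2} {g : ℕ → HH} {z : ℂ} (hz : z ∈ Metric.ball (0:ℂ) 1) : B0 p M v g z = v + FS M (mc M (gw p g)) z :=
  Set.indicator_of_mem hz _
theorem B0_out {v : ELL2} {g : ℕ → HH} {z : ℂ} (hz : z ∉ Metric.ball (0:ℂ) 1) : B0 p M v g z = 0 :=
  Set.indicator_of_notMem hz _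

theorem B0_add (A : Adm p M) {v v' : ELL2} {g g' : ℕ → HH} (h : qT p g < ⊤) (h' : qT p g' < ⊤) :
    B0 p M (v + v') (g + g') = B0 p M v g + B0 p M v' g' := by
  funext z
  rw [Pi.add_apply]
  by_cases hz : z ∈ Metric.ball (0:ℂ) 1
  · rw [B0_in hz, B0_in hz, B0_in hz]
    rw [mem_ball_zero_iff] at hz
    have := ((FS_hasSum M (mcg_bound A h) hz).add (FS_hasSum M (mcg_bound A h') hz)).tsum_eq
    have e : FS M (mc M (gw p (g + g'))) z = FS M (mc M (gw p g)) z + FS M (mc M (gw p g')) z := by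
      rw [← this]; unfold FS; simp_rw [mcg_add A h h', smul_add]
    rw [e]; abel
  · rw [B0_out hz, B0_out hz, B0_out hz, add_zero]

theorem B0_smul (A : Adm p M) (c : ℂ) {v : ELL2} {g : ℕ → HH} (h : qT p g < ⊤) :
    B0 p M (c • v) (c • g) = c • B0 p M v g := by
  funext z
  rw [Pi.smul_apply]
  by_cases hz : z ∈ Metric.ball (0:ℂ) 1
  · rw [B0_in hz, B0_in hz]
    rw [mem_ball_zero_iff] at hz
    have := ((FS_hasSum M (mcg_bound A h) hz).const_smul c).tsum_eq
    have e : FS M (mc M (gw p (c • g))) z = c • FS M (mc M (gw p g)) z := by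
      rw [← this]; unfold FS; simp_rw [mcg_smul A c h, smul_comm _ c]
    rw [e, smul_add]
  · rw [B0_out hz, B0_out hz, smul_zero]

theorem B0_hasDerivAt (A : Adm p M) {v : ELL2} {g : ℕ → HH} (h : qT p g < ⊤) {z : ℂ} (hz : z ∈ Metric.ball (0:ℂ) 1) :
    HasDerivAt (B0 p M v g) (FD M (mc M (gw p g)) z) z := by
  have h1 : HasDerivAt (fun z => v + FS M (mc M (gw p g)) z) (FD M (mc M (gw p g)) z) z :=
    (FS_hasDerivAt M (mcg_bound A h) (by rwa [mem_ball_zero_iff] at hz)).const_add v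
  refine h1.congr_of_eventuallyEq ?_
  filter_upwards [Metric.isOpen_ball.mem_nhds hz] with w hw using B0_in hw

theorem B0_diff (A : Adm p M) {v : ELL2} {g : ℕ → HH} (h : qT p g < ⊤) : DifferentiableOn ℂ (B0 p M v g) (Metric.ball 0 1) :=
  fun z hz => (B0_hasDerivAt A h hz).differentiableAt.differentiableWithinAt

theorem B0_zero {v : ELL2} {g : ℕ → HH} : B0 p M v g 0 = v := by
  rw [B0_in (by simp)]; unfold FS; simp

theorem B0_qH (A : Adm p M) {v : ELL2} {g : ℕ → HH} (h : qT p g < ⊤) :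
    qH p (B0 p M v g) ≤ ‖v‖ₑ ^ p + CAt M p * ENNReal.ofReal (Cst p) * qT p g := by
  refine iSup_le fun r => ?_
  rw [hpInt_eq]
  have hm : ∀ t, (r.1:ℂ) * ev t ∈ Metric.ball (0:ℂ) 1 := fun t => by rw [mem_ball_zero_iff, norm_rev r.2.1]; exact r.2.2
  calc ∫⁻ t in I₀, ‖B0 p M v g (r.1 * ev t)‖ₑ ^ p ≤ ∫⁻ t in I₀, (‖v‖ₑ ^ p + ‖FS M (mc M (gw p g)) (r.1 * ev t)‖ₑ ^ p) := by
        refine lintegral_mono fun t => ?_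
        show _ ^ _ ≤ _
        rw [B0_in (hm t)]
        exact (ENNReal.rpow_le_rpow (enorm_add_le _ _) A.hp.le).trans (ENNReal.rpow_add_le_add_rpow _ _ A.hp.le A.hp1)
    _ = ‖v‖ₑ ^ p + ∫⁻ t in I₀, ‖FS M (mc M (gw p g)) (r.1 * ev t)‖ₑ ^ p := by
        rw [lintegral_add_left measurable_const, setLIntegral_const, volume_I₀, mul_one]
    _ ≤ _ := by
        refine add_le_add le_rfl ?_
        exact synth_bound A.hp A.hp1 A.hM A.hMp A.hM2 (gw_memLp p g) h.ne (gw_X A.hp g) r.2.1 r.2.2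

/-- synthesis operator -/
def SY (A : Adm p M) (L0 : ELL2 →ₗ[ℂ] ELL2) (L : ℕ → ELL2 →ₗ[ℂ] HH) (hL0 : ∀ x, ‖L0 x‖ ≤ ‖x‖) (hL : ∀ n x, ‖L n x‖ ≤ ‖x‖) :
    YY p A.hp A.hp1 →ₗ[ℂ] XX p A.hp A.hp1 where
  toFun γ := ⟨B0 p M (L0 (γ.1 0)) (fun n => L n (γ.1 n)), by
    have h : qT p (fun n => L n (γ.1 n)) < ⊤ := (qT_mono A.hp fun n => hL n _).trans_lt γ.2
    refine ⟨⟨B0_diff A h, (B0_qH A h).trans_lt ?_⟩, fun z hz => B0_out hz⟩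
    refine ENNReal.add_lt_top.2 ⟨ENNReal.rpow_lt_top_of_nonneg A.hp.le (by simp), ENNReal.mul_lt_top (ENNReal.mul_lt_top ?_ (by simp)) h⟩
    exact (CAt_ne_top M A.hp A.hp1).lt_top⟩
  map_add' γ γ' := by
    ext1
    have h : qT p (fun n => L n (γ.1 n)) < ⊤ := (qT_mono A.hp fun n => hL n _).trans_lt γ.2
    have h' : qT p (fun n => L n (γ'.1 n)) < ⊤ := (qT_mono A.hp fun n => hL n _).trans_lt γ'.2
    show B0 p M (L0 (γ.1 0 + γ'.1 0)) (fun n => L n (γ.1 n + γ'.1 n)) = _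
    simp_rw [map_add]
    exact B0_add A h h'
  map_smul' c γ := by
    ext1
    have h : qT p (fun n => L n (γ.1 n)) < ⊤ := (qT_mono A.hp fun n => hL n _).trans_lt γ.2
    show B0 p M (L0 (c • γ.1 0)) (fun n => L n (c • γ.1 n)) = _
    simp_rw [map_smul]
    exact B0_smul A c h

theorem SY_bound (A : Adm p M) (L0 : ELL2 →ₗ[ℂ] ELL2) (L : ℕ → ELL2 →ₗ[ℂ] HH) (hL0 : ∀ x, ‖L0 x‖ ≤ ‖x‖) (hL : ∀ n x, ‖L n x‖ ≤ ‖x‖)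
    (γ : YY p A.hp A.hp1) : qH p (SY A L0 L hL0 hL γ).1 ≤ (1 + CAt M p * ENNReal.ofReal (Cst p)) * qT p γ.1 := by
  have hle : qT p (fun n => L n (γ.1 n)) ≤ qT p γ.1 := qT_mono A.hp fun n => hL n _
  refine (B0_qH A (hle.trans_lt γ.2)).trans ?_
  rw [add_mul, one_mul]
  refine add_le_add ?_ (mul_le_mul' le_rfl hle)
  refine le_trans (ENNReal.rpow_le_rpow ?_ A.hp.le) (norm_le_qT A.hp γ.1)
  rw [← ofReal_norm, ← ofReal_norm]; exact ENNReal.ofReal_le_ofReal (hL0 _)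

end
end HPTL
end

section
namespace HPTL
set_option linter.all false
set_option linter.unusedSectionVars false

/-- analysis coefficient function -/
def a0f (p : ℝ) (F : ℂ → ELL2) (n : ℕ) : ℝ × ℝ → ELL2 :=
  (box n).indicator fun z => ((len n ^ (1/p) * z.1 : ℝ) : ℂ) • deriv F (pt z)

theorem a0f_memLp (p : ℝ) {F : ℂ → ELL2} (hF : DifferentiableOn ℂ F (Metric.ball 0 1)) (n : ℕ) :
    MemLp (a0f p F n) 2 (volume.restrict QQ) := by
  have hd := (diff_deriv hF).continuousOn
  have hl := len_pos n
  set K : Set (ℝ × ℝ) := Set.Icc 0 (1 - len n/2) ×ˢ Set.Icc (-(1:ℝ)/2) (1/2) with hK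
  have hKc : IsCompact K := isCompact_Icc.prod isCompact_Icc
  have hbK : box n ⊆ K := by
    intro z hz
    obtain ⟨_, h2, h3⟩ := mem_box hz
    have h4 := dyadJ_subset n h3
    exact ⟨⟨(Rad_bounds h2).1, h2.2.le⟩, h4.1, h4.2.le⟩
  have hcK : ContinuousOn (fun z : ℝ × ℝ => ((len n ^ (1/p) * z.1 : ℝ) : ℂ) • deriv F (pt z)) K := by
    have hs : ContinuousOn (fun z : ℝ × ℝ => ((len n ^ (1/p) * z.1 : ℝ) : ℂ)) K := (Complex.continuous_ofReal.comp (continuous_const.mul continuous_fst)).continuousOn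
    refine hs.smul (hd.comp continuous_pt.continuousOn ?_)
    intro z hz
    rw [mem_ball_zero_iff]; unfold pt
    rw [norm_mul, norm_ev, Complex.norm_real, Real.norm_eq_abs, abs_of_nonneg hz.1.1, mul_one]
    linarith [hz.1.2]
  obtain ⟨C, hC⟩ := hKc.exists_bound_of_continuousOn hcK
  refine MemLp.of_bound (C := max C 0) ?_ ?_
  · unfold a0f
    refine (aestronglyMeasurable_indicator_iff (measurableSet_box n)).2 ?_
    have h5 : AEStronglyMeasurable (fun z : ℝ × ℝ => ((len n ^ (1/p) * z.1 : ℝ) : ℂ) • deriv F (pt z)) (volume.restrict (box n)) := (hcK.mono hbK).aestronglyMeasurable (measurableSet_box n)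
    refine h5.mono_measure ?_
    exact Measure.restrict_mono le_rfl Measure.restrict_le_self
  · refine Eventually.of_forall fun z => ?_
    unfold a0f
    by_cases hz : z ∈ box n
    · rw [Set.indicator_of_mem hz]; exact (hC z (hbK hz)).trans (le_max_left _ _)
    · rw [Set.indicator_of_notMem hz, norm_zero]; exact le_max_right _ _

open Classical in
/-- analysis coefficients -/
def a0 (p : ℝ) (F : ℂ → ELL2) (n : ℕ) : HH := if h : MemLp (a0f p F n) 2 (volume.restrict QQ) then h.toLp _ else 0

theorem a0_coe (p : ℝ) {F : ℂ → ELL2} (hF : DifferentiableOn ℂ F (Metric.ball 0 1)) (n : ℕ) :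
    a0 p F n =ᵐ[volume.restrict QQ] a0f p F n := by
  unfold a0; rw [dif_pos (a0f_memLp p hF n)]; exact MemLp.coeFn_toLp _

theorem a0f_add (p : ℝ) {F G : ℂ → ELL2} (hF : DifferentiableOn ℂ F (Metric.ball 0 1)) (hG : DifferentiableOn ℂ G (Metric.ball 0 1)) (n : ℕ) (z : ℝ × ℝ) :
    a0f p (F + G) n z = a0f p F n z + a0f p G n z := by
  unfold a0f
  by_cases hz : z ∈ box n
  · simp only [Set.indicator_of_mem hz]
    have hb := Metric.isOpen_ball.mem_nhds (pt_mem (box_subset n hz))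
    rw [deriv_add (hF.differentiableAt hb) (hG.differentiableAt hb), smul_add]
  · simp only [Set.indicator_of_notMem hz, add_zero]

theorem a0f_smul (p : ℝ) (c : ℂ) {F : ℂ → ELL2} (hF : DifferentiableOn ℂ F (Metric.ball 0 1)) (n : ℕ) (z : ℝ × ℝ) :
    a0f p (c • F) n z = c • a0f p F n z := by
  unfold a0f
  by_cases hz : z ∈ box n
  · simp only [Set.indicator_of_mem hz]
    have hb := Metric.isOpen_ball.mem_nhds (pt_mem (box_subset n hz))
    rw [deriv_const_smul _ (hF.differentiableAt hb), smul_comm]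
  · simp only [Set.indicator_of_notMem hz, smul_zero]

theorem a0_add (p : ℝ) {F G : ℂ → ELL2} (hF : DifferentiableOn ℂ F (Metric.ball 0 1)) (hG : DifferentiableOn ℂ G (Metric.ball 0 1)) (n : ℕ) :
    a0 p (F + G) n = a0 p F n + a0 p G n := by
  apply Lp.ext
  filter_upwards [a0_coe p hF n, a0_coe p hG n, a0_coe p (hF.add hG) n, Lp.coeFn_add (a0 p F n) (a0 p G n)] with z h1 h2 h3 h4
  rw [h4, h3, Pi.add_apply, h1, h2, a0f_add p hF hG]

theorem a0_smul (p : ℝ) (c : ℂ) {F : ℂ → ELL2} (hF : DifferentiableOn ℂ F (Metric.ball 0 1)) (n : ℕ) :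
    a0 p (c • F) n = c • a0 p F n := by
  apply Lp.ext
  filter_upwards [a0_coe p hF n, a0_coe p (hF.const_smul c) n, Lp.coeFn_smul c (a0 p F n)] with z h1 h3 h4
  rw [h4, h3, Pi.smul_apply, h1, a0f_smul p c hF]

theorem a0_energy {p : ℝ} (hp : 0 < p) {F : ℂ → ELL2} (hF : DifferentiableOn ℂ F (Metric.ball 0 1)) (n : ℕ) :
    ‖a0 p F n‖ₑ ^ (2:ℝ) * ENNReal.ofReal (len n) ^ (-(2/p)) ≤ en (deriv F) n := by
  have hl := len_pos n
  have h1 : ‖a0 p F n‖ₑ ^ (2:ℝ) ≤ ENNReal.ofReal (len n) ^ (2/p) * en (deriv F) n := by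
    rw [HH_sq]
    have e1 : ∫⁻ z in QQ, ‖a0 p F n z‖ₑ ^ (2:ℝ) = ∫⁻ z in QQ, (box n).indicator (fun z => ‖((len n ^ (1/p) * z.1 : ℝ) : ℂ) • deriv F (pt z)‖ₑ ^ (2:ℝ)) z := by
      refine lintegral_congr_ae ?_
      filter_upwards [a0_coe p hF n] with z hz
      rw [hz]; unfold a0f
      by_cases hb : z ∈ box n
      · simp only [Set.indicator_of_mem hb]
      · simp [Set.indicator_of_notMem hb]
    rw [e1, lint_box]
    unfold en
    rw [← lintegral_const_mul' _ _ (ENNReal.rpow_ne_top_of_nonneg (by positivity) ENNReal.ofReal_ne_top)]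
    refine setLIntegral_mono' (measurableSet_box n) fun z hz => ?_
    obtain ⟨_, hr, _⟩ := mem_box hz
    have hR := Rad_bounds hr
    rw [enorm_real_smul (mul_nonneg (Real.rpow_nonneg hl.le _) hR.1), ENNReal.mul_rpow_of_nonneg _ _ (by norm_num), ← mul_assoc,
      ENNReal.ofReal_mul (Real.rpow_nonneg hl.le _), ENNReal.mul_rpow_of_nonneg _ _ (by norm_num)]
    refine mul_le_mul' (mul_le_mul' (le_of_eq ?_) ?_) le_rfl
    · rw [← ENNReal.ofReal_rpow_of_pos hl, ← ENNReal.rpow_mul]; congr 1; ring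
    · rw [ENNReal.ofReal_rpow_of_nonneg hR.1 (by norm_num)]
      apply ENNReal.ofReal_le_ofReal
      rw [Real.rpow_two]; nlinarith [hR.1, hR.2.1]
  have hl0 : ENNReal.ofReal (len n) ≠ 0 := by simpa using hl
  calc _ ≤ ENNReal.ofReal (len n) ^ (2/p) * en (deriv F) n * ENNReal.ofReal (len n) ^ (-(2/p)) := mul_le_mul' h1 le_rfl
    _ = (ENNReal.ofReal (len n) ^ (2/p) * ENNReal.ofReal (len n) ^ (-(2/p))) * en (deriv F) n := by ring
    _ = en (deriv F) n := by
        rw [← ENNReal.rpow_add _ _ hl0 ENNReal.ofReal_ne_top, add_neg_cancel, ENNReal.rpow_zero, one_mul]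

section
variable {p : ℝ} {M : ℕ}

/-- the coefficient sequence -/
def axf (p : ℝ) (K0 : ELL2 →ₗ[ℂ] ELL2) (K : ℕ → HH →ₗ[ℂ] ELL2) (F : ℂ → ELL2) (n : ℕ) : ELL2 :=
  if n = 0 then K0 (F 0) else K n (a0 p F n)

theorem axf_qT (hp : 0 < p) (hp1 : p ≤ 1) {K0 : ELL2 →ₗ[ℂ] ELL2} {K : ℕ → HH →ₗ[ℂ] ELL2} {κ : ℝ} (hκ : 1 ≤ κ) (hK0 : ∀ x, ‖K0 x‖ ≤ ‖x‖) (hK : ∀ n x, ‖K n x‖ ≤ κ * ‖x‖)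
    {F : ℂ → ELL2} (hF : DifferentiableOn ℂ F (Metric.ball 0 1)) :
    qT p (axf p K0 K F) ≤ (ENNReal.ofReal κ ^ (2:ℝ)) ^ (p/2) * (2 * CA p * qH p F) := by
  have hA := A_general hp hp1 hF (K := qH p F) (fun r h0 h1 => le_qH p F h0 h1)
  refine le_trans ?_ (mul_le_mul' le_rfl hA)
  refine lint_dens_mono hp (ENNReal.rpow_ne_top_of_nonneg (by norm_num) ENNReal.ofReal_ne_top) fun n => ?_
  have hκ1 : 1 ≤ ENNReal.ofReal κ ^ (2:ℝ) := ENNReal.one_le_rpow (by simpa using hκ) (by norm_num)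
  unfold ga axf eA
  by_cases hn : n = 0
  · subst hn
    have hl : len 0 = 1 := by simp [len, lev]
    simp only [if_true]
    rw [hl, ENNReal.ofReal_one, ENNReal.one_rpow, mul_one]
    refine le_trans ?_ (le_mul_of_one_le_left' hκ1)
    refine ENNReal.rpow_le_rpow ?_ (by norm_num)
    rw [← ofReal_norm, ← ofReal_norm]; exact ENNReal.ofReal_le_ofReal (hK0 _)
  · rw [if_neg hn, if_neg hn]
    refine le_trans ?_ (mul_le_mul' le_rfl (a0_energy hp hF n))
    rw [← mul_assoc, ← ENNReal.mul_rpow_of_nonneg _ _ (by norm_num)]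
    refine mul_le_mul' (ENNReal.rpow_le_rpow ?_ (by norm_num)) le_rfl
    rw [← ofReal_norm, ← ofReal_norm, ← ENNReal.ofReal_mul (by linarith)]; exact ENNReal.ofReal_le_ofReal (hK n _)

/-- analysis constant -/
def CAX (p κ : ℝ) : ℝ≥0∞ := (ENNReal.ofReal κ ^ (2:ℝ)) ^ (p/2) * (2 * CA p)

theorem CAX_lt (hp : 0 < p) (hp1 : p ≤ 1) (κ : ℝ) : CAX p κ < ⊤ := by
  unfold CAX
  refine ENNReal.mul_lt_top (ENNReal.rpow_lt_top_of_nonneg (by positivity) (ENNReal.rpow_ne_top_of_nonneg (by norm_num) ENNReal.ofReal_ne_top)) (ENNReal.mul_lt_top (by norm_num) ?_)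
  exact (CA_ne_top p).lt_top

/-- analysis operator -/
def AX (hp : 0 < p) (hp1 : p ≤ 1) (K0 : ELL2 →ₗ[ℂ] ELL2) (K : ℕ → HH →ₗ[ℂ] ELL2) (κ : ℝ) (hκ : 1 ≤ κ) (hK0 : ∀ x, ‖K0 x‖ ≤ ‖x‖) (hK : ∀ n x, ‖K n x‖ ≤ κ * ‖x‖) :
    XX p hp hp1 →ₗ[ℂ] YY p hp hp1 where
  toFun F := ⟨axf p K0 K F.1, by
    refine (axf_qT hp hp1 hκ hK0 hK F.2.1.1).trans_lt ?_
    rw [← mul_assoc]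
    exact ENNReal.mul_lt_top (CAX_lt hp hp1 κ) F.2.1.2⟩
  map_add' F G := by
    ext1; funext n
    show axf p K0 K (F.1 + G.1) n = axf p K0 K F.1 n + axf p K0 K G.1 n
    unfold axf
    split_ifs
    · rw [Pi.add_apply, map_add]
    · rw [a0_add p F.2.1.1 G.2.1.1, map_add]
  map_smul' c F := by
    ext1; funext n
    show axf p K0 K (c • F.1) n = c • axf p K0 K F.1 n
    unfold axf
    split_ifs
    · rw [Pi.smul_apply, map_smul]
    · rw [a0_smul p c F.2.1.1, map_smul]

theorem AX_bound (hp : 0 < p) (hp1 : p ≤ 1) (K0 : ELL2 →ₗ[ℂ] ELL2) (K : ℕ → HH →ₗ[ℂ] ELL2) (κ : ℝ) (hκ : 1 ≤ κ) (hK0 : ∀ x, ‖K0 x‖ ≤ ‖x‖) (hK : ∀ n x, ‖K n x‖ ≤ κ * ‖x‖)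
    (F : XX p hp hp1) : qT p (AX hp hp1 K0 K κ hκ hK0 hK F).1 ≤ CAX p κ * qH p F.1 := by
  unfold CAX
  rw [mul_assoc]
  exact axf_qT hp hp1 hκ hK0 hK F.2.1.1

end
end HPTL
end

section
namespace HPTL
set_option linter.all false
set_option linter.unusedSectionVars false

instance HH_sec : SecondCountableTopology HH := by
  haveI : Fact ((2:ℝ≥0∞) ≠ ⊤) := ⟨by norm_num⟩
  exact Lp.SecondCountableTopology

section
variable {p : ℝ} {M : ℕ}

/-- The reproducing integrand. -/
def Phi (M : ℕ) (F : ℂ → ELL2) (j : ℕ) (z : ℝ × ℝ) : ELL2 := wt M j z • ((z.1:ℂ) • deriv F (pt z))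

theorem mode_int {G : ℂ → ELL2} (hG : DifferentiableOn ℂ G (Metric.ball 0 1)) {r : ℝ} (hr0 : 0 ≤ r) (hr : r < 1) (j : ℕ) :
    ∫ t in I₀, ev (-(j * t)) • G (r * ev t) = ((r ^ j : ℝ) : ℂ) • tc G j := by
  haveI : IsFiniteMeasure (volume.restrict I₀) := ⟨by rw [Measure.restrict_apply_univ, volume_I₀]; exact one_lt_top⟩
  have hI : ∀ m : ℤ, ∫ t in I₀, ev (m * t) = if m = 0 then 1 else 0 := by
    intro m
    rw [← int_ev m, intervalIntegral.integral_of_le (by norm_num)]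
    unfold I₀
    rw [integral_Ico_eq_integral_Ioc, show (-(1:ℝ)/2) = -(1/2) by ring]
  have hint : ∀ i : ℕ, Integrable (fun t : ℝ => ev (-(j * t)) • (((r:ℂ) * ev t) ^ i • tc G i)) (volume.restrict I₀) := by
    intro i
    have hc : Continuous fun t : ℝ => ev (-(j * t)) • (((r:ℂ) * ev t) ^ i • tc G i) :=
      (continuous_ev.comp (by fun_prop)).smul (((continuous_const.mul continuous_ev).pow i).smul continuous_const)
    refine Integrable.of_bound hc.aestronglyMeasurable (r^i * ‖tc G i‖) (Eventually.of_forall fun t => le_of_eq ?_)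
    rw [norm_smul, norm_smul, norm_ev, one_mul, norm_pow, norm_rev hr0]
  have hs : Summable fun i : ℕ => ∫ t in I₀, ‖ev (-(j * t)) • (((r:ℂ) * ev t) ^ i • tc G i)‖ := by
    refine (tc_summable hG hr0 hr).congr fun i => ?_
    have : ∀ t : ℝ, ‖ev (-(j * t)) • (((r:ℂ) * ev t) ^ i • tc G i)‖ = r^i * ‖tc G i‖ := by
      intro t; rw [norm_smul, norm_smul, norm_ev, one_mul, norm_pow, norm_rev hr0]
    simp_rw [this]
    rw [integral_const, measureReal_def, Measure.restrict_apply_univ, volume_I₀]; simp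
  have h := hasSum_integral_of_summable_integral_norm hint hs
  have e1 : ∀ t : ℝ, ∑' i : ℕ, ev (-(j * t)) • (((r:ℂ) * ev t) ^ i • tc G i) = ev (-(j * t)) • G (r * ev t) := by
    intro t
    have hm : (r:ℂ) * ev t ∈ Metric.ball (0:ℂ) 1 := by rw [mem_ball_zero_iff, norm_rev hr0]; exact hr
    exact ((tc_hasSum hG hm).const_smul (ev (-(j * t)))).tsum_eq
  simp_rw [e1] at h
  have e2 : ∀ i : ℕ, ∫ t in I₀, ev (-(j * t)) • (((r:ℂ) * ev t) ^ i • tc G i) = if i = j then ((r^j : ℝ):ℂ) • tc G j else 0 := by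
    intro i
    have : ∀ t : ℝ, ev (-(j * t)) • (((r:ℂ) * ev t) ^ i • tc G i) = (ev (((i:ℤ)-(j:ℤ) : ℤ) * t)) • (((r:ℂ)^i) • tc G i) := by
      intro t
      rw [mul_pow, ← ev_nat, smul_smul, smul_smul]
      congr 1
      have : ev (((i:ℤ)-(j:ℤ) : ℤ) * t) = ev (-(j*t)) * ev (i*t) := by
        rw [← ev_add]; congr 1; push_cast; ring
      rw [this]; ring
    simp_rw [this]
    rw [integral_smul_const, hI]
    by_cases hij : i = j
    · subst hij; simp
    · rw [if_neg hij, if_neg (by omega), zero_smul]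
  simp_rw [e2] at h
  exact h.unique (hasSum_ite_eq j _)

theorem Phi_eq {F : ℂ → ELL2} (hF : DifferentiableOn ℂ F (Metric.ball 0 1)) (p : ℝ) (j n : ℕ) {g : ℕ → HH} (hg : ∀ n, n ≠ 0 → g n = a0 p F n) :
    (fun z => wt M j z • Hb (gw p g) n z) =ᵐ[volume.restrict QQ] (box n).indicator (Phi M F j) := by
  filter_upwards [a0_coe p hF n] with z hz
  unfold Hb
  by_cases hb : z ∈ box n
  · rw [Set.indicator_of_mem hb, Set.indicator_of_mem hb]
    unfold gw Phi
    rw [hg n (mem_box hb).1, hz]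
    unfold a0f
    rw [Set.indicator_of_mem hb, smul_smul ((len n ^ (-(1/p)) : ℝ) : ℂ)]
    congr 2
    rw [← Complex.ofReal_mul, ← mul_assoc, ← Real.rpow_add (len_pos n)]
    simp
  · rw [Set.indicator_of_notMem hb, Set.indicator_of_notMem hb, smul_zero]

theorem mc_eq (A : Adm p M) {F : ℂ → ELL2} (hF : DifferentiableOn ℂ F (Metric.ball 0 1)) {g : ℕ → HH} (hg : ∀ n, n ≠ 0 → g n = a0 p F n)
    (h : qT p g < ⊤) (j : ℕ) : (Cj M j : ℂ) • mc M (gw p g) j = tc F (j+1) := by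
  have hmem := gw_memLp p g
  have hi : ∀ n, IntegrableOn (Phi M F j) (box n) := by
    intro n
    have := (wt_integrable M j (L2_intOn (Hb_memLp hmem n))).congr (Phi_eq (M := M) hF p j n hg)
    rw [integrable_indicator_iff (measurableSet_box n)] at this
    unfold IntegrableOn at this
    rwa [Measure.restrict_restrict (measurableSet_box n), Set.inter_eq_left.2 (box_subset n)] at this
  have hres : ∀ (n : ℕ) {E : Type} [NormedAddCommGroup E] [NormedSpace ℝ E] (f : ℝ × ℝ → E), ∫ z in QQ, (box n).indicator f z = ∫ z in box n, f z := by
    intro n E _ _ f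
    rw [integral_indicator (measurableSet_box n), Measure.restrict_restrict (measurableSet_box n), Set.inter_eq_left.2 (box_subset n)]
  have hsum : Summable fun n => ∫ z in box n, ‖Phi M F j z‖ := by
    set g' : ℕ → ℝ × ℝ → ℂ := fun n z => ((‖gw p g n z‖ : ℝ) : ℂ) with hg'
    have hmem' : ∀ n, MemLp (g' n) 2 (volume.restrict QQ) := fun n => (hmem n).norm.ofReal
    have heg : eg g' = eg (gw p g) := by
      funext n; unfold eg
      refine lintegral_congr fun z => ?_
      congr 1
      rw [hg', ← ofReal_norm, ← ofReal_norm, Complex.norm_real, norm_norm]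
    have hb := fun n => mm_Hb_bound2 (M := M) A.hp A.hM2 hmem' h.ne (by rw [heg]; exact gw_X A.hp g) n 0
    refine Summable.of_nonneg_of_le (fun n => integral_nonneg fun z => norm_nonneg _) (fun n => ?_) (KK_summable p M (qT p g))
    refine le_trans ?_ (hb n)
    rw [← hres n]
    have e1 : mm M (Hb g' n) 0 = ((∫ z in QQ, (2 * (1 - z.1^2)^M) * ‖Hb (gw p g) n z‖ : ℝ) : ℂ) := by
      rw [← integral_complex_ofReal]
      unfold mm
      refine integral_congr_ae (Eventually.of_forall fun z => ?_)
      show wt M 0 z • Hb g' n z = _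
      have : Hb g' n z = ((‖Hb (gw p g) n z‖ : ℝ) : ℂ) := by
        unfold Hb
        by_cases hz : z ∈ box n
        · rw [Set.indicator_of_mem hz, Set.indicator_of_mem hz]
        · rw [Set.indicator_of_notMem hz, Set.indicator_of_notMem hz]; simp
      rw [this]; unfold wt
      simp [ev]
    have hint2 : IntegrableOn (fun z : ℝ × ℝ => (2 * (1 - z.1^2)^M) * ‖Hb (gw p g) n z‖) QQ := by
      refine Integrable.bdd_mul (c := 2) (L2_intOn (Hb_memLp hmem n)).norm (by fun_prop) ?_
      filter_upwards [ae_restrict_mem measurableSet_QQ] with z hz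
      have := norm_wt M 0 hz
      rw [pow_zero, mul_one] at this
      rw [← this, norm_norm]; exact norm_wt_le_two M 0 hz
    rw [e1, Complex.norm_real]
    refine le_trans ?_ (le_abs_self _)
    refine integral_mono_ae ?_ hint2 ?_
    · rw [integrable_indicator_iff (measurableSet_box n)]
      unfold IntegrableOn
      rw [Measure.restrict_restrict (measurableSet_box n), Set.inter_eq_left.2 (box_subset n)]
      exact (hi n).norm
    · filter_upwards [Phi_eq (M := M) hF p j n hg, ae_restrict_mem measurableSet_QQ] with z h1 h2
      rw [← norm_indicator_eq_indicator_norm, ← h1, norm_smul]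
      exact mul_le_mul_of_nonneg_right (norm_wt_le M j h2) (norm_nonneg _)
  have hQ : IntegrableOn (Phi M F j) QQ := by
    rw [← iUnion_box]; exact integrableOn_iUnion_of_summable_integral_norm hi hsum
  have hmc : mc M (gw p g) j = ∫ z in QQ, Phi M F j z := by
    have := hasSum_integral_iUnion measurableSet_box box_disj (by rw [iUnion_box]; exact hQ)
    rw [iUnion_box] at this
    rw [← this.tsum_eq]
    unfold mc
    congr 1; funext n
    rw [← hres n]
    exact integral_congr_ae (Phi_eq (M := M) hF p j n hg)
  have hmc2 : mc M (gw p g) j = (((j.factorial * M.factorial : ℝ) / ((j + M + 1).factorial : ℝ) : ℝ) : ℂ) • tc (deriv F) j := by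
    rw [hmc]
    have e1 : ∫ z in QQ, Phi M F j z = ∫ r in Set.Ico (0:ℝ) 1, ∫ t in I₀, Phi M F j (r, t) := by
      unfold QQ at hQ ⊢
      rw [Measure.volume_eq_prod] at hQ ⊢
      exact setIntegral_prod _ hQ
    have e2 : ∀ r ∈ Set.Ico (0:ℝ) 1, ∫ t in I₀, Phi M F j (r, t) = ((2 * r^(2*j+1) * (1-r^2)^M : ℝ) : ℂ) • tc (deriv F) j := by
      intro r hr
      have : ∀ t : ℝ, Phi M F j (r, t) = ((2 * (1 - r^2)^M * r^j * r : ℝ) : ℂ) • (ev (-(j*t)) • deriv F (r * ev t)) := by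
        intro t; unfold Phi wt pt
        rw [smul_smul, smul_smul]; congr 1; push_cast; ring
      simp_rw [this]
      rw [integral_smul, mode_int (diff_deriv hF) hr.1 hr.2, smul_smul, ← Complex.ofReal_mul]
      congr 2; ring
    rw [e1, setIntegral_congr_fun measurableSet_Ico e2, integral_smul_const]
    congr 1
    rw [integral_complex_ofReal, ← beta_int, intervalIntegral.integral_of_le (by norm_num), integral_Ico_eq_integral_Ioc]
  rw [hmc2, tc_deriv, smul_smul, smul_smul]
  convert one_smul ℂ (tc F (j+1))
  have hc : Cj M j * ((j.factorial * M.factorial : ℝ) / ((j + M + 1).factorial : ℝ)) * ((j:ℝ)+1) = 1 := by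
    have h1 := Nat.add_choose_mul_factorial_mul_factorial (j+1) M
    have h2 : (((j+1+M).choose M : ℕ):ℝ) * ((j:ℝ)+1) * (j.factorial : ℝ) * (M.factorial:ℝ) = ((j+M+1).factorial : ℝ) := by
      rw [show j + M + 1 = j + 1 + M by ring, ← h1, Nat.factorial_succ]
      push_cast; ring
    have h3 : ((j+M+1).factorial : ℝ) ≠ 0 := by positivity
    unfold Cj
    field_simp
    linarith
  exact_mod_cast hc

theorem B_A (A : Adm p M) {F : ℂ → ELL2} (hF : DifferentiableOn ℂ F (Metric.ball 0 1)) (hF0 : ∀ z ∉ Metric.ball (0:ℂ) 1, F z = 0)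
    {g : ℕ → HH} (hg : ∀ n, n ≠ 0 → g n = a0 p F n) (h : qT p g < ⊤) : B0 p M (F 0) g = F := by
  funext z
  by_cases hz : z ∈ Metric.ball (0:ℂ) 1
  · rw [B0_in hz]
    have h1 := tc_hasSum hF hz
    rw [← hasSum_nat_add_iff' 1] at h1
    simp only [Finset.range_one, Finset.sum_singleton, pow_zero, one_smul, tc_zero] at h1
    have h2 : FS M (mc M (gw p g)) z = F z - F 0 := by
      rw [← h1.tsum_eq]; unfold FS
      refine tsum_congr fun j => ?_
      rw [← mc_eq A hF hg h, smul_smul, mul_comm]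
    rw [h2]; abel
  · rw [B0_out hz, hF0 z hz]

/-- H_p embeds complementably. -/
theorem exists_AB (A : Adm p M) : ∃ (S : XX p A.hp A.hp1 →ₗ[ℂ] YY p A.hp A.hp1) (R : YY p A.hp A.hp1 →ₗ[ℂ] XX p A.hp A.hp1),
    (∀ x, R (S x) = x) ∧ (∀ x, qT p (S x).1 ≤ CAX p 1 * qH p x.1) ∧
    (∀ y, qH p (R y).1 ≤ (1 + CAt M p * ENNReal.ofReal (Cst p)) * qT p y.1) := by
  obtain ⟨V⟩ := exists_isometry HH
  set W := ContinuousLinearMap.adjoint V.toContinuousLinearMap with hW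
  have hWV : ∀ x, W (V x) = x := fun x => by
    have := ContinuousLinearMap.ext_iff.1 (V.toContinuousLinearMap.norm_map_iff_adjoint_comp_self.1 V.norm_map) x
    exact this
  have hWn : ∀ y, ‖W y‖ ≤ ‖y‖ := fun y => by
    have h1 := W.le_opNorm y
    have h2 : ‖W‖ ≤ 1 := by rw [hW, LinearIsometryEquiv.norm_map]; exact V.norm_toContinuousLinearMap_le
    exact h1.trans (mul_le_of_le_one_left (norm_nonneg _) h2)
  have hK : ∀ (n : ℕ) x, ‖(fun _ : ℕ => V.toLinearMap) n x‖ ≤ 1 * ‖x‖ := fun n x => by rw [one_mul]; exact (V.norm_map x).le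
  have hL : ∀ (n : ℕ) x, ‖(fun _ : ℕ => W.toLinearMap) n x‖ ≤ ‖x‖ := fun n x => hWn x
  refine ⟨AX A.hp A.hp1 LinearMap.id (fun _ => V.toLinearMap) 1 le_rfl (fun x => le_rfl) hK,
    SY A LinearMap.id (fun _ => W.toLinearMap) (fun x => le_rfl) hL, ?_, ?_, ?_⟩
  · intro x
    ext1
    set y := AX A.hp A.hp1 LinearMap.id (fun _ => V.toLinearMap) 1 le_rfl (fun x => le_rfl) hK x with hy
    have hyn : ∀ n, n ≠ 0 → y.1 n = V (a0 p x.1 n) := fun n hn => by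
      show axf p LinearMap.id (fun _ => V.toLinearMap) x.1 n = _
      unfold axf; rw [if_neg hn]; rfl
    have hy0 : y.1 0 = x.1 0 := rfl
    show B0 p M (y.1 0) (fun n => W (y.1 n)) = x.1
    rw [hy0]
    refine B_A A x.2.1.1 x.2.2 (fun n hn => ?_) ((qT_mono A.hp fun n => hWn _).trans_lt y.2)
    show W (y.1 n) = _
    rw [hyn n hn, hWV]
  · exact fun x => AX_bound A.hp A.hp1 _ _ 1 le_rfl _ hK x
  · exact fun y => SY_bound A _ _ _ hL y

end
end HPTL
end

section
namespace HPTL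
set_option linter.all false
set_option linter.unusedSectionVars false

/-- sub-box -/
def SB (η : ℝ) (n : ℕ) : Set (ℝ × ℝ) :=
  Set.Ico (1 - len n * (1/2 + η)) (1 - len n / 2) ×ˢ Set.Ico (n * len n - 3/2) (n * len n - 3/2 + η * len n)

/-- its indicator -/
def hh (η : ℝ) (n : ℕ) : ℝ × ℝ → ℂ := (SB η n).indicator fun _ => 1

theorem measurableSet_SB (η : ℝ) (n : ℕ) : MeasurableSet (SB η n) := measurableSet_Ico.prod measurableSet_Ico

theorem SB_box {η : ℝ} (h0 : 0 < η) (h1 : η ≤ 1/4) {n : ℕ} (hn : n ≠ 0) : SB η n ⊆ box n := by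
  rintro z ⟨⟨a1, a2⟩, b1, b2⟩
  have hl := len_pos n
  unfold box; rw [if_neg hn]
  refine ⟨⟨by nlinarith, a2⟩, ?_⟩
  rw [mem_dyadJ hn]
  have hp : (0:ℝ) < 2 ^ lev n := by positivity
  have hlp : len n * 2 ^ lev n = 1 := by unfold len; exact inv_mul_cancel₀ hp.ne'
  constructor
  · calc (n:ℝ) = n * len n * 2 ^ lev n := by rw [mul_assoc, hlp, mul_one]
      _ ≤ _ := by apply mul_le_mul_of_nonneg_right _ hp.le; linarith
  · calc (z.2 + 3/2) * 2 ^ lev n < (n * len n + η * len n) * 2 ^ lev n := by apply mul_lt_mul_of_pos_right _ hp; linarith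
      _ = n + η := by rw [add_mul, mul_assoc, mul_assoc, hlp]; ring
      _ < n + 1 := by linarith

theorem volume_SB {η : ℝ} (h0 : 0 < η) (n : ℕ) : volume (SB η n) = ENNReal.ofReal ((η * len n)^2) := by
  unfold SB
  rw [Measure.volume_eq_prod, Measure.prod_prod, Real.volume_Ico, Real.volume_Ico, ← ENNReal.ofReal_mul]
  · congr 1; ring
  · have := len_pos n; nlinarith

theorem hh_memLp (η : ℝ) (n : ℕ) : MemLp (hh η n) 2 (volume.restrict QQ) :=
  (memLp_const (1:ℂ)).indicator (measurableSet_SB η n)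

theorem hh_int (η : ℝ) (n : ℕ) : IntegrableOn (hh η n) QQ := L2_intOn (hh_memLp η n)

theorem exists_eta (M : ℕ) : ∃ η : ℝ, 0 < η ∧ η ≤ 1/4 ∧ ∀ ξ : ℂ, ‖ξ‖ ≤ 12 * η → 1/2 ≤ (1 / (1 + ξ)^(M+2)).re := by
  have hc : ContinuousAt (fun ξ : ℂ => (1 / (1 + ξ)^(M+2)).re) 0 := by
    refine Complex.continuous_re.continuousAt.comp ?_
    refine ContinuousAt.div continuousAt_const (by fun_prop) (by simp)
  have h1 : ∀ᶠ ξ : ℂ in 𝓝 0, 1/2 < (1 / (1 + ξ)^(M+2)).re := by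
    refine hc.eventually_const_lt ?_
    simp; norm_num
  obtain ⟨δ, hδ, h2⟩ := Metric.eventually_nhds_iff.1 h1
  refine ⟨min (1/4) (δ/24), by positivity, min_le_left _ _, fun ξ hξ => (h2 ?_).le⟩
  rw [dist_zero_right]
  have := min_le_right (1/4) (δ/24)
  linarith

/-- kernel of the derivative -/
def dk (M : ℕ) (z : ℂ) (w : ℝ × ℝ) : ℂ := ((2 * (1 - w.1^2)^M * ((M:ℝ)+1) : ℝ) : ℂ) * (1 / (1 - z * (w.1 * ev (-w.2)))^(M+2))

theorem FD_kernel {E : Type*} [NormedAddCommGroup E] [InnerProductSpace ℂ E] [CompleteSpace E] (M : ℕ) {G : ℝ × ℝ → E} (hG : IntegrableOn G QQ) {z : ℂ} (hz : ‖z‖ < 1) :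
    FD M (mm M G) z = ∫ w in QQ, dk M z w • G w := by
  have h := hasSum_integral_of_summable_integral_norm (μ := volume.restrict QQ) (F := fun j w => ((Cj M j : ℂ) * (((j:ℂ)+1) * z^j)) • (wt M j w • G w))
    (fun j => (wt_integrable M j hG).smul _) ?_
  · unfold FD
    have e : ∀ j : ℕ, ((Cj M j : ℂ) * (((j:ℂ)+1) * z^j)) • mm M G j = ∫ w in QQ, ((Cj M j : ℂ) * (((j:ℂ)+1) * z^j)) • (wt M j w • G w) := by
      intro j; rw [integral_smul]; rfl
    simp_rw [e]
    rw [h.tsum_eq]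
    refine setIntegral_congr_fun measurableSet_QQ fun w hw => ?_
    have h1 : 0 ≤ w.1 := hw.1.1
    have h2 : w.1 < 1 := hw.1.2
    have hx : ‖z * (w.1 * ev (-w.2))‖ < 1 := by
      rw [norm_mul, norm_mul, norm_ev, mul_one, Complex.norm_real, Real.norm_of_nonneg h1]
      nlinarith [norm_nonneg z]
    have hs := hasSum_choose_mul_geometric_of_norm_lt_one (M+1) hx
    have hs2 := (hs.mul_left (((2 * (1 - w.1^2)^M * ((M:ℝ)+1) : ℝ) : ℂ))).smul_const (G w)
    refine Eq.trans ?_ hs2.tsum_eq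
    refine tsum_congr fun j => ?_
    have hC : (Cj M j : ℂ) * ((j:ℂ)+1) = ((M:ℂ)+1) * ((j+(M+1)).choose (M+1) : ℕ) := by
      exact_mod_cast congrArg (fun x : ℝ => (x:ℂ)) (Cj_succ_le M j)
    rw [smul_smul, wt_eq]
    congr 1
    rw [mul_pow, ← mul_assoc (Cj M j : ℂ), hC]; push_cast; ring
  · refine Summable.of_nonneg_of_le (fun j => integral_nonneg fun _ => norm_nonneg _) (fun j => ?_) ((FD_summable M (norm_nonneg z) hz).mul_right (∫ w in QQ, 2 * ‖G w‖))
    rw [← integral_const_mul]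
    refine setIntegral_mono_on ((wt_integrable M j hG).smul _).norm ((hG.norm.const_mul 2).const_mul _) measurableSet_QQ fun w hw => ?_
    have h1 : ‖((j:ℂ)+1)‖ = (j:ℝ)+1 := by
      rw [← Nat.cast_succ, Complex.norm_natCast]; push_cast; rfl
    rw [norm_smul, norm_smul, norm_mul, norm_mul, norm_pow, Complex.norm_real, Real.norm_of_nonneg (Cj_nonneg _ _), h1]
    have := Cj_nonneg M j
    have := norm_wt_le_two M j hw
    gcongr

theorem ev_zero' : ev 0 = 1 := by simp [ev]

set_option maxHeartbeats 800000 in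
theorem dk_lower {M : ℕ} {η : ℝ} (h0 : 0 < η) (h1 : η ≤ 1/4) (hη : ∀ ξ : ℂ, ‖ξ‖ ≤ 12 * η → 1/2 ≤ (1 / (1 + ξ)^(M+2)).re)
    {n : ℕ} {z w : ℝ × ℝ} (hz : z ∈ SB η n) (hw : w ∈ SB η n) : (1/2)^M * (len n ^ 2)⁻¹ ≤ (dk M (pt z) w).re := by
  obtain ⟨⟨a1, a2⟩, b1, b2⟩ := hz
  obtain ⟨⟨c1, c2⟩, d1, d2⟩ := hw
  have hl := len_pos n
  have hl1 := len_le_one n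
  set ℓ := len n with hℓ
  set r := z.1
  set s := w.1
  have hr0 : 0 ≤ r := by nlinarith
  have hs0 : 0 ≤ s := by nlinarith
  have hr1 : r ≤ 1 := by linarith
  have hs1 : s ≤ 1 := by linarith
  set ρ := 1 - ℓ/2 with hρ
  set b := 1 - ρ^2 with hb
  have hb1 : 3/4*ℓ ≤ b := by rw [hb, hρ]; nlinarith
  have hb2 : b ≤ ℓ := by rw [hb, hρ]; nlinarith
  have hb0 : 0 < b := by linarith
  set x : ℂ := pt z * (w.1 * ev (-w.2)) with hx
  have hxe : x = ((r*s:ℝ):ℂ) * ev (z.2 - w.2) := by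
    rw [hx, sub_eq_add_neg, ev_add]; unfold pt; push_cast; ring
  have hd : ‖((ρ^2:ℝ):ℂ) - x‖ ≤ 9*(η*ℓ) := by
    have e : ((ρ^2:ℝ):ℂ) - x = ((ρ^2 - r*s:ℝ):ℂ) + ((r*s:ℝ):ℂ) * (ev 0 - ev (z.2 - w.2)) := by
      rw [hxe, ev_zero']; push_cast; ring
    rw [e]
    refine (norm_add_le _ _).trans ?_
    rw [norm_mul, Complex.norm_real, Complex.norm_real, Real.norm_eq_abs, Real.norm_of_nonneg (by positivity)]
    have h2 : |ρ^2 - r*s| ≤ 2*(η*ℓ) := by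
      rw [abs_le]; constructor <;> nlinarith
    have h3 := ev_lip 0 (z.2 - w.2)
    have h4 : |0 - (z.2 - w.2)| ≤ η*ℓ := by rw [abs_le]; constructor <;> linarith
    have h5 : 2 * Real.pi * |0 - (z.2 - w.2)| ≤ 2 * 3.15 * (η*ℓ) := by
      have := Real.pi_lt_d2
      have := Real.pi_pos
      have := abs_nonneg (0 - (z.2 - w.2))
      gcongr
    have h6 : r*s*‖ev 0 - ev (z.2 - w.2)‖ ≤ ‖ev 0 - ev (z.2 - w.2)‖ :=
      mul_le_of_le_one_left (norm_nonneg _) (by nlinarith)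
    nlinarith
  set ξ : ℂ := (((ρ^2:ℝ):ℂ) - x) / (b:ℂ) with hξ
  have hbC : (b:ℂ) ≠ 0 := by exact_mod_cast hb0.ne'
  have hξn : ‖ξ‖ ≤ 12*η := by
    rw [hξ, norm_div, Complex.norm_real, Real.norm_of_nonneg hb0.le, div_le_iff₀ hb0]
    nlinarith
  have h1x : 1 - x = (b:ℂ) * (1 + ξ) := by
    rw [hξ, mul_add, mul_div_cancel₀ _ hbC, hb]; push_cast; ring
  have hdk : dk M (pt z) w = ((2 * (1 - s^2)^M * ((M:ℝ)+1) / b^(M+2) : ℝ) : ℂ) * (1 / (1+ξ)^(M+2)) := by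
    unfold dk
    rw [← hx, h1x, mul_pow]
    push_cast
    rw [one_div, mul_inv, one_div]; ring
  rw [hdk, Complex.re_ofReal_mul]
  have hs2 : ℓ/2 ≤ 1 - s^2 := by nlinarith
  have hA : (1/2)^M * (ℓ ^ 2)⁻¹ * 2 ≤ 2 * (1 - s^2)^M * ((M:ℝ)+1) / b^(M+2) := by
    calc (1/2)^M * (ℓ ^ 2)⁻¹ * 2 = 2 * (ℓ/2)^M * 1 / ℓ^(M+2) := by rw [div_pow, div_pow, pow_add, one_pow]; field_simp
      _ ≤ _ := by
        have : (0:ℝ) ≤ M := Nat.cast_nonneg M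
        have hp : 0 ≤ (1 - s^2)^M := by apply pow_nonneg; linarith
        have hp2 : (ℓ/2)^M ≤ (1 - s^2)^M := pow_le_pow_left₀ (by positivity) hs2 M
        have hp3 : b^(M+2) ≤ ℓ^(M+2) := pow_le_pow_left₀ hb0.le hb2 _
        refine div_le_div₀ (by positivity) ?_ (by positivity) hp3
        refine mul_le_mul (by linarith) (by linarith) (by norm_num) (by positivity)
  have := hη ξ hξn
  have hA0 : 0 ≤ (1/2)^M * (ℓ ^ 2)⁻¹ * 2 := by positivity
  nlinarith

end HPTL
end

section
namespace HPTL
set_option linter.all false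
set_option linter.unusedSectionVars false

section
variable {p : ℝ} {M : ℕ} {η : ℝ}

theorem hh_smul_int {E : Type*} [NormedAddCommGroup E] [NormedSpace ℂ E] {n : ℕ} (hsub : SB η n ⊆ QQ) (f : ℝ × ℝ → E) :
    ∫ z in QQ, hh η n z • f z = ∫ z in SB η n, f z := by
  have : ∀ z, hh η n z • f z = (SB η n).indicator f z := by
    intro z; unfold hh
    by_cases hz : z ∈ SB η n
    · rw [Set.indicator_of_mem hz, Set.indicator_of_mem hz, one_smul]
    · rw [Set.indicator_of_notMem hz, Set.indicator_of_notMem hz, zero_smul]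
  simp_rw [this]
  rw [integral_indicator (measurableSet_SB η n), Measure.restrict_restrict (measurableSet_SB η n), Set.inter_eq_left.2 hsub]

theorem real_SB (h0 : 0 < η) (n : ℕ) : volume.real (SB η n) = (η * len n)^2 := by
  rw [measureReal_def, volume_SB h0, ENNReal.toReal_ofReal (by positivity)]

theorem mmh_bound (M : ℕ) (η : ℝ) (n : ℕ) : ∀ j, ‖mm M (hh η n) j‖ ≤ ∫ z in QQ, 2 * ‖hh η n z‖ := fun j => mm_bound (hh_int η n) j

theorem FD_re (h0 : 0 < η) (h1 : η ≤ 1/4) (hη : ∀ ξ : ℂ, ‖ξ‖ ≤ 12 * η → 1/2 ≤ (1 / (1 + ξ)^(M+2)).re)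
    {n : ℕ} (hn : n ≠ 0) {z : ℝ × ℝ} (hz : z ∈ SB η n) : (1/2)^M * η^2 ≤ (FD M (mm M (hh η n)) (pt z)).re := by
  have hl := len_pos n
  have hsub : SB η n ⊆ QQ := (SB_box h0 h1 hn).trans (box_subset n)
  have hzm := pt_mem (hsub hz)
  rw [mem_ball_zero_iff] at hzm
  rw [FD_kernel M (hh_int η n) hzm]
  have e : ∫ w in QQ, dk M (pt z) w • hh η n w = ∫ w in SB η n, dk M (pt z) w := by
    rw [← hh_smul_int hsub]
    refine integral_congr_ae (Eventually.of_forall fun w => ?_)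
    simp only [smul_eq_mul]; ring
  rw [e]
  have hi : IntegrableOn (dk M (pt z)) (SB η n) := by
    have hc : ContinuousOn (dk M (pt z)) (Set.Icc 0 1 ×ˢ Set.Icc (-1/2:ℝ) (1/2)) := by
      unfold dk
      refine ContinuousOn.mul (Complex.continuous_ofReal.comp (by fun_prop)).continuousOn ?_
      refine ContinuousOn.div continuousOn_const ?_ ?_
      · refine Continuous.continuousOn ?_
        refine (continuous_const.sub (continuous_const.mul ((Complex.continuous_ofReal.comp continuous_fst).mul (continuous_ev.comp continuous_snd.neg)))).pow _
      · intro w hw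
        refine pow_ne_zero _ ?_
        intro h
        have h2 : ‖pt z * (w.1 * ev (-w.2))‖ < 1 := by
          rw [norm_mul, norm_mul, norm_ev, mul_one, Complex.norm_real, Real.norm_of_nonneg hw.1.1]
          nlinarith [norm_nonneg (pt z), hw.1.2, hw.1.1]
        rw [← sub_eq_zero.1 h, norm_one] at h2
        exact lt_irrefl _ h2
    refine (hc.integrableOn_compact (isCompact_Icc.prod isCompact_Icc)).mono_set (hsub.trans ?_)
    exact Set.prod_mono Set.Ico_subset_Icc_self Set.Ico_subset_Icc_self
  have hre : (∫ w in SB η n, dk M (pt z) w).re = ∫ w in SB η n, (dk M (pt z) w).re := (integral_re hi).symm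
  rw [hre]
  have hvol : volume (SB η n) ≠ ⊤ := by rw [volume_SB h0]; exact ENNReal.ofReal_ne_top
  calc (1/2)^M * η^2 = ∫ w in SB η n, (1/2)^M * (len n ^ 2)⁻¹ := by
        rw [setIntegral_const, real_SB h0, smul_eq_mul]; field_simp
    _ ≤ _ := setIntegral_mono_on (integrableOn_const hvol) hi.re (measurableSet_SB η n) fun w hw => dk_lower h0 h1 hη hz hw

/-- the diagonal constant -/
def ee (M : ℕ) (η : ℝ) (n : ℕ) : ℂ := ∫ z in SB η n, (z.1:ℂ) * FD M (mm M (hh η n)) (pt z)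

theorem FDint (M : ℕ) (h0 : 0 < η) (h1 : η ≤ 1/4) {n : ℕ} (hn : n ≠ 0) : IntegrableOn (fun z : ℝ × ℝ => (z.1:ℂ) * FD M (mm M (hh η n)) (pt z)) (SB η n) := by
  have hl := len_pos n
  set K : Set (ℝ × ℝ) := Set.Icc 0 (1 - len n/2) ×ˢ Set.Icc (-(1:ℝ)/2) (1/2) with hK
  have hbK : SB η n ⊆ K := by
    intro z hz
    obtain ⟨_, h2, h3⟩ := mem_box (SB_box h0 h1 hn hz)
    have h4 := dyadJ_subset n h3
    exact ⟨⟨(Rad_bounds h2).1, h2.2.le⟩, h4.1, h4.2.le⟩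
  have hdiff : DifferentiableOn ℂ (FS M (mm M (hh η n))) (Metric.ball 0 1) := fun z hz =>
    (FS_hasDerivAt M (mmh_bound M η n) (by rwa [mem_ball_zero_iff] at hz)).differentiableAt.differentiableWithinAt
  have hFD : ContinuousOn (FD M (mm M (hh η n))) (Metric.ball 0 1) := by
    refine (diff_deriv hdiff).continuousOn.congr fun z hz => ?_
    exact (FS_hasDerivAt M (mmh_bound M η n) (by rwa [mem_ball_zero_iff] at hz)).deriv.symm
  have hs : ContinuousOn (fun z : ℝ × ℝ => (z.1 : ℂ)) K := (Complex.continuous_ofReal.comp continuous_fst).continuousOn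
  refine IntegrableOn.mono_set (ContinuousOn.integrableOn_compact (isCompact_Icc.prod isCompact_Icc) (hs.mul (hFD.comp continuous_pt.continuousOn ?_))) hbK
  intro z hz
  rw [mem_ball_zero_iff]; unfold pt
  rw [norm_mul, norm_ev, Complex.norm_real, Real.norm_eq_abs, abs_of_nonneg hz.1.1, mul_one]
  linarith [hz.1.2]

theorem ee_lower (h0 : 0 < η) (h1 : η ≤ 1/4) (hη : ∀ ξ : ℂ, ‖ξ‖ ≤ 12 * η → 1/2 ≤ (1 / (1 + ξ)^(M+2)).re)
    {n : ℕ} (hn : n ≠ 0) : (1/2)^M * η^2 * (1/4) * (η * len n)^2 ≤ ‖ee M η n‖ := by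
  have hl := len_pos n
  have hl1 := len_le_one n
  have hi := FDint M h0 h1 hn
  refine le_trans ?_ (Complex.re_le_norm _)
  have hre : (ee M η n).re = ∫ z in SB η n, ((z.1:ℂ) * FD M (mm M (hh η n)) (pt z)).re := (integral_re hi).symm
  rw [hre]
  have hvol : volume (SB η n) ≠ ⊤ := by rw [volume_SB h0]; exact ENNReal.ofReal_ne_top
  calc (1/2)^M * η^2 * (1/4) * (η * len n)^2 = ∫ w in SB η n, (1/2)^M * η^2 * (1/4) := by
        rw [setIntegral_const, real_SB h0, smul_eq_mul]; ring
    _ ≤ _ := by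
      refine setIntegral_mono_on (integrableOn_const hvol) hi.re (measurableSet_SB η n) fun z hz => ?_
      have h2 := FD_re h0 h1 hη hn hz
      rw [Complex.re_ofReal_mul]
      have h3 : 1/4 ≤ z.1 := by have := hz.1.1; nlinarith
      have h4 : 0 ≤ (1/2:ℝ)^M * η^2 := by positivity
      nlinarith

/-- embedding of the n-th coordinate -/
def Lc (η : ℝ) (n : ℕ) : ELL2 →ₗ[ℂ] HH where
  toFun x := indicatorConstLp 2 (measurableSet_SB η n) (measure_ne_top _ _) ((((η * len n)⁻¹ : ℝ) : ℂ) • push (fP n) (fP_inj n) x)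
  map_add' x y := by rw [map_add, smul_add, indicatorConstLp_add]
  map_smul' c x := by
    rw [map_smul, smul_comm, RingHom.id_apply]
    apply Lp.ext
    refine indicatorConstLp_coeFn.trans ?_
    refine EventuallyEq.trans ?_ (Lp.coeFn_smul _ _).symm
    filter_upwards [indicatorConstLp_coeFn (p := 2) (hs := measurableSet_SB η n) (hμs := measure_ne_top (volume.restrict QQ) _) (c := (((η * len n)⁻¹ : ℝ) : ℂ) • push (fP n) (fP_inj n) x)] with z hz
    rw [Pi.smul_apply, hz]
    by_cases hb : z ∈ SB η n
    · rw [Set.indicator_of_mem hb, Set.indicator_of_mem hb]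
    · rw [Set.indicator_of_notMem hb, Set.indicator_of_notMem hb, smul_zero]

theorem Lc_coe (η : ℝ) (n : ℕ) (x : ELL2) : Lc η n x =ᵐ[volume.restrict QQ] fun z => hh η n z • ((((η * len n)⁻¹ : ℝ) : ℂ) • push (fP n) (fP_inj n) x) := by
  refine (indicatorConstLp_coeFn (p := 2) (hs := measurableSet_SB η n) (hμs := measure_ne_top (volume.restrict QQ) _) (c := (((η * len n)⁻¹ : ℝ) : ℂ) • push (fP n) (fP_inj n) x)).trans (Eventually.of_forall fun z => ?_)
  unfold hh
  by_cases hb : z ∈ SB η n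
  · rw [Set.indicator_of_mem hb]; simp only [Set.indicator_of_mem hb, one_smul]
  · rw [Set.indicator_of_notMem hb]; simp only [Set.indicator_of_notMem hb, zero_smul]

theorem Lc_norm (h0 : 0 < η) (n : ℕ) (x : ELL2) : ‖Lc η n x‖ ≤ ‖x‖ := by
  have hl := len_pos n
  have : ‖Lc η n x‖ = _ := norm_indicatorConstLp (hs := measurableSet_SB η n) (hμs := measure_ne_top (volume.restrict QQ) _) (c := (((η * len n)⁻¹ : ℝ) : ℂ) • push (fP n) (fP_inj n) x) (by norm_num) (by norm_num)
  rw [this, norm_smul, norm_push, Complex.norm_real, Real.norm_of_nonneg (by positivity)]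
  have h1 : (volume.restrict QQ).real (SB η n) ≤ (η * len n)^2 := by
    rw [← real_SB h0]
    refine ENNReal.toReal_mono ?_ (Measure.restrict_apply_le _ _)
    rw [volume_SB h0]; exact ENNReal.ofReal_ne_top
  have h2 : (volume.restrict QQ).real (SB η n) ^ (1 / (2:ℝ≥0∞).toReal) ≤ η * len n := by
    refine (Real.rpow_le_rpow measureReal_nonneg h1 (by norm_num)).trans (le_of_eq ?_)
    rw [ENNReal.toReal_ofNat, ← Real.sqrt_eq_rpow, Real.sqrt_sq (by positivity)]
  calc (η * len n)⁻¹ * ‖x‖ * (volume.restrict QQ).real (SB η n) ^ (1 / (2:ℝ≥0∞).toReal) ≤ (η * len n)⁻¹ * ‖x‖ * (η * len n) :=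
        mul_le_mul_of_nonneg_left h2 (by positivity)
    _ = ‖x‖ := by field_simp

theorem hh_smul_intble (η : ℝ) (n : ℕ) (y : HH) : Integrable (fun z => hh η n z • y z) (volume.restrict QQ) := by
  refine Integrable.bdd_smul (L2_intOn (Lp.memLp y)) 1 (hh_memLp η n).1 (Eventually.of_forall fun z => ?_)
  unfold hh
  by_cases hb : z ∈ SB η n
  · rw [Set.indicator_of_mem hb]; simp
  · rw [Set.indicator_of_notMem hb]; simp

/-- functional -/
def Kc (M : ℕ) (η : ℝ) (n : ℕ) : HH →ₗ[ℂ] ELL2 where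
  toFun y := if n = 0 then 0 else (((η * len n : ℝ) : ℂ) * (ee M η n)⁻¹) • pull (fP n) (fP_inj n) (∫ z in QQ, hh η n z • y z)
  map_add' x y := by
    split_ifs
    · simp
    · rw [← smul_add, ← map_add, ← integral_add (hh_smul_intble η n x) (hh_smul_intble η n y)]
      congr 2
      refine integral_congr_ae ?_
      filter_upwards [Lp.coeFn_add x y] with z hz
      rw [hz, Pi.add_apply, smul_add]
  map_smul' c x := by
    split_ifs
    · simp
    · have e : ∫ z in QQ, hh η n z • (c • x : HH) z = c • ∫ z in QQ, hh η n z • x z := by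
        rw [← integral_smul c (fun z => hh η n z • x z)]
        refine integral_congr_ae ?_
        filter_upwards [Lp.coeFn_smul c x] with z hz
        rw [hz, Pi.smul_apply, smul_comm]
      rw [RingHom.id_apply, e, map_smul, smul_comm]

/-- constant -/
def kap (M : ℕ) (η : ℝ) : ℝ := 1 + 4 * 2^M / η^3

theorem Kc_norm (h0 : 0 < η) (h1 : η ≤ 1/4) (hη : ∀ ξ : ℂ, ‖ξ‖ ≤ 12 * η → 1/2 ≤ (1 / (1 + ξ)^(M+2)).re)
    (n : ℕ) (y : HH) : ‖Kc M η n y‖ ≤ kap M η * ‖y‖ := by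
  have hl := len_pos n
  have hk : 0 ≤ kap M η := by unfold kap; positivity
  show ‖if n = 0 then 0 else (((η * len n : ℝ) : ℂ) * (ee M η n)⁻¹) • pull (fP n) (fP_inj n) (∫ z in QQ, hh η n z • y z)‖ ≤ _
  split_ifs with hn
  · rw [norm_zero]; positivity
  have hm : ∀ n : ℕ, MemLp ((fun _ : ℕ => (y : ℝ × ℝ → ELL2)) n) 2 (volume.restrict QQ) := fun _ => Lp.memLp y
  have h2 := int_box_le hm n
  have h3 : ‖∫ z in QQ, hh η n z • y z‖ ≤ len n * ‖y‖ := by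
    refine (norm_integral_le_of_norm_le (L2_intOn (Hb_memLp hm n)).norm (Eventually.of_forall fun z => ?_)).trans (h2.trans ?_)
    · unfold hh Hb
      by_cases hb : z ∈ SB η n
      · rw [Set.indicator_of_mem hb, Set.indicator_of_mem (SB_box h0 h1 hn hb), one_smul]
      · rw [Set.indicator_of_notMem hb, zero_smul, norm_zero]; exact norm_nonneg _
    · refine mul_le_mul_of_nonneg_left ?_ hl.le
      rw [← Real.sqrt_sq (norm_nonneg y)]
      refine Real.sqrt_le_sqrt ?_
      have h4 : eg (fun _ : ℕ => (y : ℝ × ℝ → ELL2)) n ≤ ‖y‖ₑ ^ (2:ℝ) := by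
        rw [HH_sq]; exact lintegral_mono_set (box_subset n)
      have h5 := ENNReal.toReal_mono (by simp) h4
      rw [← ENNReal.toReal_rpow, toReal_enorm, Real.rpow_two] at h5
      exact h5
  have h5 := ee_lower h0 h1 hη hn
  have hpos : 0 < (1/2:ℝ)^M * η^2 * (1/4) * (η * len n)^2 := by positivity
  rw [norm_smul, norm_mul, norm_inv, Complex.norm_real, Real.norm_of_nonneg (by positivity)]
  have h6 : ‖ee M η n‖⁻¹ ≤ ((1/2:ℝ)^M * η^2 * (1/4) * (η * len n)^2)⁻¹ := inv_anti₀ hpos h5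
  calc η * len n * ‖ee M η n‖⁻¹ * ‖pull (fP n) (fP_inj n) (∫ z in QQ, hh η n z • y z)‖
      ≤ η * len n * ((1/2:ℝ)^M * η^2 * (1/4) * (η * len n)^2)⁻¹ * (len n * ‖y‖) := by
        refine mul_le_mul (mul_le_mul_of_nonneg_left h6 (by positivity)) ((norm_pull_le _ _ _).trans h3) (norm_nonneg _) (by positivity)
    _ = 4 * 2^M / η^3 * ‖y‖ := by rw [one_div, inv_pow]; field_simp
    _ ≤ _ := by refine mul_le_mul_of_nonneg_right ?_ (norm_nonneg _); unfold kap; linarith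

end
end HPTL
end

section
namespace HPTL
set_option linter.all false
set_option linter.unusedSectionVars false

section
variable {p : ℝ} {M : ℕ} {η : ℝ}

/-- coefficient -/
def al (p η : ℝ) (n : ℕ) : ℂ := ((len n ^ (-(1/p)) : ℝ) : ℂ) * (((η * len n)⁻¹ : ℝ) : ℂ)

theorem Hb_gw_Lc (h0 : 0 < η) (h1 : η ≤ 1/4) (γ : ℕ → ELL2) {k : ℕ} (hk : k ≠ 0) :
    Hb (gw p (fun n => Lc η n (γ n))) k =ᵐ[volume.restrict QQ] fun z => hh η k z • (al p η k • push (fP k) (fP_inj k) (γ k)) := by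
  filter_upwards [Lc_coe η k (γ k)] with z hz
  unfold Hb
  by_cases hb : z ∈ box k
  · rw [Set.indicator_of_mem hb]
    unfold gw al
    rw [hz, smul_comm, mul_smul]
  · rw [Set.indicator_of_notMem hb]
    have : z ∉ SB η k := fun h => hb (SB_box h0 h1 hk h)
    unfold hh; rw [Set.indicator_of_notMem this, zero_smul]

theorem mm_Lc (h0 : 0 < η) (h1 : η ≤ 1/4) (γ : ℕ → ELL2) {k : ℕ} (hk : k ≠ 0) (j : ℕ) :
    mm M (Hb (gw p (fun n => Lc η n (γ n))) k) j = mm M (hh η k) j • (al p η k • push (fP k) (fP_inj k) (γ k)) := by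
  rw [mm_congr (Hb_gw_Lc h0 h1 γ hk)]
  unfold mm
  rw [← integral_smul_const]
  refine integral_congr_ae (Eventually.of_forall fun z => ?_)
  simp only [smul_eq_mul, mul_smul]

theorem mm_Lc0 (g : ℕ → HH) (j : ℕ) : mm M (Hb (gw p g) 0) j = 0 := by
  unfold mm Hb
  have : box 0 = ∅ := by unfold box; simp
  simp [this]

theorem pull_mc (A : Adm p M) (h0 : 0 < η) (h1 : η ≤ 1/4) {γ : ℕ → ELL2} (h : qT p (fun n => Lc η n (γ n)) < ⊤) {n : ℕ} (hn : n ≠ 0) (j : ℕ) :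
    pull (fP n) (fP_inj n) (mc M (gw p (fun n => Lc η n (γ n))) j) = mm M (hh η n) j • (al p η n • γ n) := by
  have s := (mc_hasSum A.hp A.hM2 (gw_memLp p (fun n => Lc η n (γ n))) h.ne (gw_X A.hp _) j).mapL (pull (fP n) (fP_inj n))
  refine s.unique ?_
  have : mm M (hh η n) j • (al p η n • γ n) = pull (fP n) (fP_inj n) (mm M (Hb (gw p (fun n => Lc η n (γ n))) n) j) := by
    rw [mm_Lc h0 h1 γ hn, map_smul, map_smul, pull_push]
  rw [this]
  refine hasSum_single n fun k hk => ?_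
  by_cases hk0 : k = 0
  · subst hk0; rw [mm_Lc0, map_zero]
  · rw [mm_Lc h0 h1 γ hk0, map_smul, map_smul, pull_push_disj _ _ _ _ (fun i j => fP_ne hk.symm i j), smul_zero, smul_zero]

theorem pull_FD (A : Adm p M) (h0 : 0 < η) (h1 : η ≤ 1/4) {γ : ℕ → ELL2} (h : qT p (fun n => Lc η n (γ n)) < ⊤) {n : ℕ} (hn : n ≠ 0)
    {z : ℂ} (hz : ‖z‖ < 1) :
    pull (fP n) (fP_inj n) (FD M (mc M (gw p (fun n => Lc η n (γ n)))) z) = FD M (mm M (hh η n)) z • (al p η n • γ n) := by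
  have s := (FD_hasSum M (mcg_bound A h) hz).mapL (pull (fP n) (fP_inj n))
  refine s.unique ?_
  have s2 := (FD_hasSum M (mmh_bound M η n) hz).smul_const (al p η n • γ n)
  refine s2.congr_fun ?_
  intro j
  rw [map_smul, pull_mc A h0 h1 h hn, smul_assoc]

theorem Kc_a0 (A : Adm p M) (h0 : 0 < η) (h1 : η ≤ 1/4) (hη : ∀ ξ : ℂ, ‖ξ‖ ≤ 12 * η → 1/2 ≤ (1 / (1 + ξ)^(M+2)).re)
    {γ : ℕ → ELL2} (h : qT p (fun n => Lc η n (γ n)) < ⊤) (v : ELL2) {n : ℕ} (hn : n ≠ 0) :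
    Kc M η n (a0 p (B0 p M v (fun n => Lc η n (γ n))) n) = γ n := by
  have hl := len_pos n
  have hsub : SB η n ⊆ QQ := (SB_box h0 h1 hn).trans (box_subset n)
  set F := B0 p M v (fun n => Lc η n (γ n)) with hF
  have hd : DifferentiableOn ℂ F (Metric.ball 0 1) := B0_diff A h
  show (if n = 0 then 0 else (((η * len n : ℝ) : ℂ) * (ee M η n)⁻¹) • pull (fP n) (fP_inj n) (∫ z in QQ, hh η n z • a0 p F n z)) = _
  rw [if_neg hn]
  have e1 : pull (fP n) (fP_inj n) (∫ z in QQ, hh η n z • a0 p F n z) = ∫ z in QQ, pull (fP n) (fP_inj n) (hh η n z • a0 p F n z) :=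
    (ContinuousLinearMap.integral_comp_comm _ (hh_smul_intble η n (a0 p F n))).symm
  have e2 : ∫ z in QQ, pull (fP n) (fP_inj n) (hh η n z • a0 p F n z) =
      ∫ z in QQ, hh η n z • (((z.1:ℂ) * FD M (mm M (hh η n)) (pt z)) • (((len n ^ (1/p) : ℝ) : ℂ) • (al p η n • γ n))) := by
    refine integral_congr_ae ?_
    filter_upwards [a0_coe p hd n] with z hz
    rw [hz]
    by_cases hb : z ∈ SB η n
    · have hbb := SB_box h0 h1 hn hb
      have hpt := pt_mem (hsub hb)
      have hder : deriv F (pt z) = _ := (B0_hasDerivAt A (v := v) h hpt).deriv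
      unfold a0f
      rw [Set.indicator_of_mem hbb, hder, map_smul, map_smul, pull_FD A h0 h1 h hn (by rwa [mem_ball_zero_iff] at hpt)]
      congr 1
      simp only [smul_smul]
      congr 1
      push_cast
      ring
    · have : hh η n z = 0 := by unfold hh; exact Set.indicator_of_notMem hb _
      rw [this, zero_smul, zero_smul, map_zero]
  have e3 := hh_smul_int hsub (fun z => ((z.1:ℂ) * FD M (mm M (hh η n)) (pt z)) • (((len n ^ (1/p) : ℝ) : ℂ) • (al p η n • γ n)))
  rw [e1]
  refine (congrArg _ (e2.trans e3)).trans ?_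
  rw [integral_smul_const]
  change _ • (ee M η n • _) = _
  have hee : ee M η n ≠ 0 := by
    have := ee_lower h0 h1 hη hn
    have hpos : 0 < (1/2:ℝ)^M * η^2 * (1/4) * (η * len n)^2 := by positivity
    exact norm_pos_iff.1 (hpos.trans_le this)
  unfold al
  rw [smul_smul, smul_smul, smul_smul]
  have h2 : ((len n ^ (1/p) : ℝ) : ℂ) * ((len n ^ (-(1/p)) : ℝ) : ℂ) = 1 := by
    rw [← Complex.ofReal_mul, ← Real.rpow_add hl, add_neg_cancel, Real.rpow_zero, Complex.ofReal_one]
  have h3 : ((η * len n : ℝ) : ℂ) * (((η * len n)⁻¹ : ℝ) : ℂ) = 1 := by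
    rw [← Complex.ofReal_mul, mul_inv_cancel₀ (by positivity), Complex.ofReal_one]
  have h4 : ((η * len n : ℝ) : ℂ) * (ee M η n)⁻¹ * (ee M η n) * (((len n ^ (1/p) : ℝ) : ℂ) * (((len n ^ (-(1/p)) : ℝ) : ℂ) * (((η * len n)⁻¹ : ℝ) : ℂ))) = 1 := by
    rw [mul_assoc _ (ee M η n)⁻¹, inv_mul_cancel₀ hee, mul_one, ← mul_assoc _ ((len n ^ (-(1/p)) : ℝ) : ℂ), h2, one_mul, h3]
  convert one_smul ℂ (γ n) using 2
  rw [← h4]; ring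

theorem exists_CD (A : Adm p M) : ∃ (κ : ℝ) (S : YY p A.hp A.hp1 →ₗ[ℂ] XX p A.hp A.hp1) (R : XX p A.hp A.hp1 →ₗ[ℂ] YY p A.hp A.hp1),
    (∀ y, R (S y) = y) ∧ (∀ x, qT p (R x).1 ≤ CAX p κ * qH p x.1) ∧
    (∀ y, qH p (S y).1 ≤ (1 + CAt M p * ENNReal.ofReal (Cst p)) * qT p y.1) := by
  obtain ⟨η, h0, h1, hη⟩ := exists_eta M
  have hκ : 1 ≤ kap M η := by unfold kap; have : 0 ≤ 4 * 2^M / η^3 := by positivity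
                              linarith
  have hK0 : ∀ x, ‖(pull (fP 0) (fP_inj 0)).toLinearMap x‖ ≤ ‖x‖ := norm_pull_le _ _
  have hL0 : ∀ x, ‖(push (fP 0) (fP_inj 0)).toLinearMap x‖ ≤ ‖x‖ := fun x => (norm_push _ _ x).le
  refine ⟨kap M η, SY A (push (fP 0) (fP_inj 0)).toLinearMap (Lc η) hL0 (Lc_norm h0),
    AX A.hp A.hp1 (pull (fP 0) (fP_inj 0)).toLinearMap (Kc M η) (kap M η) hκ hK0 (Kc_norm h0 h1 hη), ?_, ?_, ?_⟩
  · intro y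
    ext1; funext n
    have h : qT p (fun n => Lc η n (y.1 n)) < ⊤ := (qT_mono A.hp fun n => Lc_norm h0 n _).trans_lt y.2
    show axf p (pull (fP 0) (fP_inj 0)).toLinearMap (Kc M η) (B0 p M (push (fP 0) (fP_inj 0) (y.1 0)) (fun n => Lc η n (y.1 n))) n = y.1 n
    unfold axf
    split_ifs with hn
    · subst hn; rw [B0_zero]; exact pull_push _ _ _
    · exact Kc_a0 A h0 h1 hη h _ hn
  · exact fun x => AX_bound A.hp A.hp1 _ _ _ hκ hK0 _ x
  · exact fun y => SY_bound A _ _ hL0 _ y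

theorem X_iso_Y (hp : 0 < p) (hp1 : p ≤ 1) : BIso (fun F : XX p hp hp1 => qH p F.1) (fun F : YY p hp hp1 => qT p F.1) := by
  obtain ⟨M, A⟩ := exists_Adm hp hp1
  obtain ⟨S, R, a1, a2, a3⟩ := exists_AB A
  obtain ⟨κ, C, D, b1, b2, b3⟩ := exists_CD A
  have hfin : (1 + CAt M p * ENNReal.ofReal (Cst p)) < ⊤ :=
    ENNReal.add_lt_top.2 ⟨one_lt_top, ENNReal.mul_lt_top (CAt_ne_top M hp hp1).lt_top ENNReal.ofReal_lt_top⟩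
  refine pelczynski S R a1 C D b1 (CAX_lt hp hp1 1) hfin hfin (CAX_lt hp hp1 κ) (show (2:ℝ≥0∞) < ⊤ by norm_num) a2 a3 b3 b2 ?_ ?_ ?_ ?_ (X_double hp hp1) (Y_double hp hp1)
  · intro y y'
    refine (qH_add hp hp1 y.2.1.1).trans ?_
    exact le_mul_of_one_le_left' (by norm_num)
  · intro y
    refine le_antisymm (qH_mono hp fun z => ?_) (qH_mono hp fun z => ?_)
    · show ‖(-y.1) z‖ ≤ _
      rw [Pi.neg_apply, norm_neg]
    · show _ ≤ ‖(-y.1) z‖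
      rw [Pi.neg_apply, norm_neg]
  · exact fun y y' => qT_add hp hp1 y.1 y'.1
  · exact fun y => qT_neg p y.1

end
end HPTL
end

/-- For `0 < p ≤ 1`, `H_p(𝔻, ℓ₂) ≃ T_{p,2}(ℓ₂)`: there is a linear map `T`
carrying `H_p(𝔻, ℓ₂)` onto `T_{p,2}(ℓ₂)` with two-sided quasi-norm estimates. -/
theorem HpD_ell2_isomorphic_TL (p : ℝ) (hp : 0 < p) (hp1 : p ≤ 1) :
    ∃ (T : (ℂ → ELL2) →ₗ[ℂ] (ℕ → ELL2)) (c C : ℝ≥0∞), 0 < c ∧ C < ⊤ ∧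
      (∀ F, memHpD p F → memTL p (T F) ∧
        c * qHpD p F ≤ tlNorm p (T F) ∧ tlNorm p (T F) ≤ C * qHpD p F) ∧
      (∀ γ, memTL p γ → ∃ F, memHpD p F ∧ T F = γ) := by
  exact HPTL.finish p hp hp1 (HPTL.X_iso_Y hp hp1)

end
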